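/- arXiv:1409.0064 — 2 statements merged into one kernel-verified Lean document; each statement's English description precedes it below -/
import Mathlib

section
/- Let (i_t, j_t), t ∈ ℕ, be a countable family of pairs of real numbers with 0 < i_t, j_t < 1 and i_t + j_t = 1, let θ_t ∈ ℝ² for each t, and set σ := sup_{t∈ℕ} min{i_t, j_t}. Let a, b ∈ ℝ with a ≠ 0 and L_{a,b} := {(x, ax + b) : x ∈ ℝ}. Suppose there exists ε > 0 such that liminf_{q→∞} q^{1/σ − ε} · max{‖qa‖, ‖qb‖} > 0, where the liminf is over positive integers q. Then the Hausdorff dimension of ⋂_{t∈ℕ} ( Bad_{θ_t}(i_t, j_t) ∩ L_{a,b} ) equals 1. -/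
open Filter Set

/-- Distance from a real number to the nearest integer. -/
noncomputable def distNearestInt (t : ℝ) : ℝ := |t - round t|

/-- The inhomogeneous set `Bad_θ(i,j)` of `(i,j)`-badly approximable pairs. -/
def badPair (i j : ℝ) (θ : ℝ × ℝ) : Set (ℝ × ℝ) :=
  {p : ℝ × ℝ | ∃ c : ℝ, 0 < c ∧ ∀ q : ℕ, 0 < q →
    c / (q : ℝ) < max (distNearestInt ((q : ℝ) * p.1 - θ.1) ^ (1 / i))
                      (distNearestInt ((q : ℝ) * p.2 - θ.2) ^ (1 / j))}

/-- The `m`-th `K`-adic interval of level `n`. -/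
def kI (K n m : ℕ) : Set ℝ := Icc ((m : ℝ) / (K : ℝ) ^ n) (((m : ℝ) + 1) / (K : ℝ) ^ n)

lemma kI_child_subset (K n m r : ℕ) (hK : 0 < K) (hr : r < K) :
    kI K (n + 1) (K * m + r) ⊆ kI K n m := by
  intro u hu
  have hK' : (0 : ℝ) < K := by exact_mod_cast hK
  have hr' : (r : ℝ) + 1 ≤ K := by exact_mod_cast hr
  have hr0 : (0 : ℝ) ≤ r := Nat.cast_nonneg r
  have hKn : (0 : ℝ) < (K : ℝ) ^ n := by positivity
  simp only [kI, mem_Icc] at hu ⊢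
  obtain ⟨h1, h2⟩ := hu
  rw [div_le_iff₀ (by positivity)] at h1 ⊢
  rw [le_div_iff₀ (by positivity)] at h2 ⊢
  push_cast at h1 h2
  rw [pow_succ] at h1 h2
  constructor
  · have : (K : ℝ) * m ≤ K * (u * (K : ℝ) ^ n) := by nlinarith
    exact le_of_mul_le_mul_left this hK'
  · have : K * (u * (K : ℝ) ^ n) ≤ (K : ℝ) * (m + 1) := by nlinarith
    exact le_of_mul_le_mul_left this hK'

lemma cantor_dim (B : ℕ) (hB : 2 ≤ B) (S : Set ℝ) (good : ℕ → ℕ → Prop) (h0 : good 0 0)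
    (hstep : ∀ n m, good n m → ∃ c : Fin B → ℕ, Function.Injective c ∧
      ∀ x, c x < 2 * B ∧ good (n + 1) (4 * B * m + 2 * c x))
    (hS : ∀ u, (∃ idx : ℕ → ℕ, ∀ n, good n (idx n) ∧ u ∈ kI (4 * B) n (idx n)) → u ∈ S) :
    ENNReal.ofReal (Real.log B / Real.log (4 * B)) ≤ dimH S := by
  classical
  have hstep' : ∀ n m, ∃ c : Fin B → ℕ, good n m → (Function.Injective c ∧
      ∀ x, c x < 2 * B ∧ good (n + 1) (4 * B * m + 2 * c x)) := by
    intro n m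
    by_cases h : good n m
    · obtain ⟨c, hc⟩ := hstep n m h
      exact ⟨c, fun _ => hc⟩
    · exact ⟨fun _ => 0, fun h' => absurd h' h⟩
  choose c hc using hstep'
  let idx : (ℕ → Fin B) → ℕ → ℕ := fun a n =>
    Nat.rec 0 (fun k m => 4 * B * m + 2 * c k m (a k)) n
  have idx0 : ∀ a, idx a 0 = 0 := fun a => rfl
  have idxS : ∀ a n, idx a (n + 1) = 4 * B * idx a n + 2 * c n (idx a n) (a n) := fun a n => rfl
  have hgood : ∀ a n, good n (idx a n) := by
    intro a n
    induction n with
    | zero => exact h0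
    | succ n ih => rw [idxS]; exact ((hc n _ ih).2 (a n)).2
  have hx : ∀ a : ℕ → Fin B, ∃ u : ℝ, ∀ n, u ∈ kI (4 * B) n (idx a n) := by
    intro a
    have := IsCompact.nonempty_iInter_of_sequence_nonempty_isCompact_isClosed
      (fun n => kI (4 * B) n (idx a n))
      (fun n => by
        rw [idxS]
        apply kI_child_subset
        · omega
        · have := ((hc n _ (hgood a n)).2 (a n)).1
          omega)
      (fun n => by
        refine nonempty_Icc.2 ?_
        gcongr
        linarith)
      isCompact_Icc (fun n => isClosed_Icc)
    obtain ⟨u, hu⟩ := this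
    exact ⟨u, fun n => mem_iInter.1 hu n⟩
  choose x hx using hx
  have hBr : (2 : ℝ) ≤ B := by exact_mod_cast hB
  -- key separation
  have hsep : ∀ a b : ℕ → Fin B, ∀ n, (∀ k < n, a k = b k) → a n ≠ b n →
      1 / (4 * (B : ℝ)) ^ (n + 1) ≤ |x a - x b| := by
    intro a b n hk hn
    have hpre : ∀ k ≤ n, idx a k = idx b k := by
      intro k hkn
      induction k with
      | zero => rfl
      | succ k ih => rw [idxS, idxS, ih (by omega), hk k (by omega)]
    have hne : c n (idx a n) (a n) ≠ c n (idx b n) (b n) := by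
      rw [← hpre n le_rfl]
      exact fun h => hn ((hc n _ (hgood a n)).1 h)
    have ha := hx a (n + 1)
    have hb := hx b (n + 1)
    rw [idxS] at ha hb
    rw [← hpre n le_rfl] at hb hne
    simp only [kI, mem_Icc] at ha hb
    push_cast at ha hb
    have hpos : (0 : ℝ) < (4 * (B : ℝ)) ^ (n + 1) := by positivity
    rw [div_le_iff₀ hpos, le_div_iff₀ hpos] at ha hb
    rw [div_le_iff₀ hpos, ← abs_of_pos hpos, ← abs_mul, sub_mul]
    rcases lt_or_gt_of_ne hne with h | h
    · have h' : (c n (idx a n) (a n) : ℝ) + 1 ≤ c n (idx a n) (b n) := by exact_mod_cast h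
      rw [le_abs]; right; linarith [ha.1, ha.2, hb.1, hb.2]
    · have h' : (c n (idx a n) (b n) : ℝ) + 1 ≤ c n (idx a n) (a n) := by exact_mod_cast h
      rw [le_abs]; left; linarith [ha.1, ha.2, hb.1, hb.2]
  have hinj : Function.Injective x := by
    intro a b hab
    by_contra hne
    have hex : ∃ n, a n ≠ b n := Function.ne_iff.1 hne
    have := hsep a b (Nat.find hex)
      (fun k hk => by simpa using Nat.find_min hex hk) (Nat.find_spec hex)
    rw [hab, sub_self, abs_zero] at this
    have hp : 0 < 1 / (4 * (B : ℝ)) ^ (Nat.find hex + 1) := by positivity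
    linarith
  let f : ℝ → ℝ := fun u => if h : ∃ a, x a = u then Real.ofDigits h.choose else 0
  have hf : ∀ a, f (x a) = Real.ofDigits a := by
    intro a
    have h : ∃ a', x a' = x a := ⟨a, rfl⟩
    simp only [f, dif_pos h]
    rw [hinj h.choose_spec]
  have hlogB : 0 < Real.log B := Real.log_pos (by linarith)
  have hlogK : 0 < Real.log (4 * B) := Real.log_pos (by linarith)
  set d : ℝ := Real.log B / Real.log (4 * B) with hd
  have hdpos : 0 < d := div_pos hlogB hlogK
  have hKd : (4 * (B : ℝ)) ^ d = B := by
    rw [Real.rpow_def_of_pos (by positivity), hd, mul_div_cancel₀ _ hlogK.ne',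
      Real.exp_log (by positivity)]
  have hholder : HolderOnWith (B : NNReal) (Real.toNNReal d) f (range x) := by
    rintro _ ⟨a, rfl⟩ _ ⟨b, rfl⟩
    rw [hf, hf]
    by_cases hab : a = b
    · subst hab; simp
    have hex : ∃ n, a n ≠ b n := Function.ne_iff.1 hab
    set n := Nat.find hex with hn
    have hlt : ∀ k < n, a k = b k := fun k hk => by simpa using Nat.find_min hex hk
    have h1 := hsep a b n hlt (Nat.find_spec hex)
    have h2 := Real.abs_ofDigits_sub_ofDigits_le hlt
    have h3 : |Real.ofDigits a - Real.ofDigits b| ≤ B * |x a - x b| ^ d := by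
      calc |Real.ofDigits a - Real.ofDigits b| ≤ ((B : ℝ) ^ n)⁻¹ := h2
        _ = B * (1 / (4 * (B : ℝ)) ^ (n + 1)) ^ d := by
          rw [Real.div_rpow (by positivity) (by positivity), Real.one_rpow,
            ← Real.rpow_natCast (4 * (B : ℝ)), ← Real.rpow_mul (by positivity), mul_comm _ d,
            Real.rpow_mul (by positivity), hKd, Real.rpow_natCast, pow_succ]
          field_simp
        _ ≤ B * |x a - x b| ^ d := by
          gcongr
    rw [edist_dist, edist_dist, Real.dist_eq, Real.dist_eq, Real.coe_toNNReal _ hdpos.le,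
      ENNReal.ofReal_rpow_of_nonneg (abs_nonneg _) hdpos.le]
    calc ENNReal.ofReal |Real.ofDigits a - Real.ofDigits b|
        ≤ ENNReal.ofReal (B * |x a - x b| ^ d) := ENNReal.ofReal_le_ofReal h3
      _ = _ := by
        rw [ENNReal.ofReal_mul (by positivity)]
        simp
  have him : Icc (0 : ℝ) 1 ⊆ f '' range x := by
    intro t ht
    obtain ⟨a, -, ha⟩ := Real.ofDigits_SurjOn (b := B) (by omega) ht
    exact ⟨x a, ⟨a, rfl⟩, by rw [hf, ha]⟩
  have h1 : (1 : ENNReal) ≤ dimH (f '' range x) := by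
    refine le_trans ?_ (dimH_mono him)
    have := Real.dimH_of_nonempty_interior (s := Icc (0 : ℝ) 1) (by simp)
    rw [this]; simp
  have h2 := hholder.dimH_image_le (by simpa using hdpos)
  have h3 := h1.trans h2
  have hsub : range x ⊆ S := by
    rintro _ ⟨a, rfl⟩
    exact hS _ ⟨idx a, fun n => ⟨hgood a n, hx a n⟩⟩
  refine le_trans ?_ (dimH_mono hsub)
  rw [ENNReal.le_div_iff_mul_le (Or.inl (by simpa using hdpos)) (Or.inl (by simp)), one_mul] at h3
  exact h3


lemma card_le_of_diff (T : Finset ℕ) (L : ℝ) (hL : 0 ≤ L)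
    (h : ∀ r ∈ T, ∀ r' ∈ T, (r' : ℝ) - r ≤ L) : (T.card : ℝ) ≤ L + 1 := by
  rcases T.eq_empty_or_nonempty with rfl | hne
  · simp; linarith
  have hsub : T ⊆ Finset.Icc (T.min' hne) (T.max' hne) := fun r hr =>
    Finset.mem_Icc.2 ⟨T.min'_le r hr, T.le_max' r hr⟩
  have hc := Finset.card_le_card hsub
  rw [Nat.card_Icc] at hc
  have hmm : T.min' hne ≤ T.max' hne := T.min'_le _ (T.max'_mem hne)
  have h1 := h _ (T.min'_mem hne) _ (T.max'_mem hne)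
  have hc' : T.card + T.min' hne ≤ T.max' hne + 1 := by omega
  have hc'' : (T.card : ℝ) + T.min' hne ≤ T.max' hne + 1 := by exact_mod_cast hc'
  linarith

/-- A set of reals which is `(K, δ)`-potential winning through a system of unique obstacles. -/
def Pot (K : ℕ) (δ : ℝ) (S : Set ℝ) : Prop :=
  ∃ (Γ : Type) (lv : Γ → ℕ) (D : Γ → Set ℝ) (ω : Γ → ℝ),
    (∀ g, 0 ≤ ω g) ∧ (∀ g, (D g).Nonempty → 0 < ω g) ∧
    (∀ n, ∑' g, (if lv g = n then ENNReal.ofReal (ω g) else 0) ≤ ENNReal.ofReal δ) ∧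
    (∀ g m, m < K ^ lv g → (∃ z, ∀ u ∈ D g ∩ kI K (lv g) m, |u - z| ≤ ω g ^ 2 / (K : ℝ) ^ lv g) ∨
      ∃ g', lv g' < lv g ∧ kI K (lv g) m ⊆ D g') ∧
    (∀ u ∈ Icc (0 : ℝ) 1, (∀ g, u ∉ D g) → u ∈ S)

lemma Pot.iInter {K : ℕ} {δ : ℝ} {S : ℕ → Set ℝ} (δ' : ℕ → ℝ)
    (hδ : ∑' t, ENNReal.ofReal (δ' t) ≤ ENNReal.ofReal δ) (h : ∀ t, Pot K (δ' t) (S t)) :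
    Pot K δ (⋂ t, S t) := by
  choose Γ lv D ω h1 h2 h3 h4 h5 using h
  refine ⟨Σ t, Γ t, fun g => lv g.1 g.2, fun g => D g.1 g.2, fun g => ω g.1 g.2,
    fun g => h1 _ _, fun g => h2 _ _, ?_, ?_, ?_⟩
  · intro n
    rw [ENNReal.tsum_sigma']
    exact (ENNReal.tsum_le_tsum fun t => h3 t n).trans hδ
  · rintro ⟨t, g⟩ m hm
    rcases h4 t g m hm with h | ⟨g', hg', hs⟩
    · exact Or.inl h
    · exact Or.inr ⟨⟨t, g'⟩, hg', hs⟩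
  · intro u hu hg
    exact mem_iInter.2 fun t => h5 t u hu fun g => hg ⟨t, g⟩

lemma kI_anc (K n l m : ℕ) (hK : 0 < K) (hl : l ≤ n) (hm : m < K ^ n) :
    m / K ^ (n - l) < K ^ l ∧ kI K n m ⊆ kI K l (m / K ^ (n - l)) := by
  constructor
  · rw [Nat.div_lt_iff_lt_mul (by positivity), ← pow_add]
    rwa [Nat.add_sub_cancel' hl]
  · intro u hu
    set e := n - l with he
    have hn : n = l + e := by omega
    set m' := m / K ^ e with hm'
    have hK' : (0 : ℝ) < K := by exact_mod_cast hK
    have h1 : m' * K ^ e ≤ m := Nat.div_mul_le_self _ _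
    have h2 : m + 1 ≤ (m' + 1) * K ^ e := by
      have := Nat.lt_div_mul_add (a := m) (b := K ^ e) (by positivity)
      rw [← hm'] at this
      nlinarith
    have h1' : (m' : ℝ) * (K : ℝ) ^ e ≤ m := by exact_mod_cast h1
    have h2' : (m : ℝ) + 1 ≤ (m' + 1) * (K : ℝ) ^ e := by exact_mod_cast h2
    simp only [kI, mem_Icc] at hu ⊢
    rw [hn, pow_add] at hu
    obtain ⟨ha, hb⟩ := hu
    have hl0 : (0 : ℝ) < (K : ℝ) ^ l := by positivity
    have he0 : (0 : ℝ) < (K : ℝ) ^ e := by positivity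
    rw [div_le_iff₀ (by positivity)] at ha ⊢
    rw [le_div_iff₀ (by positivity)] at hb ⊢
    constructor
    · have : (m' : ℝ) * (K : ℝ) ^ e ≤ (u * (K : ℝ) ^ l) * (K : ℝ) ^ e := by linarith
      exact le_of_mul_le_mul_right this he0
    · have : (u * (K : ℝ) ^ l) * (K : ℝ) ^ e ≤ ((m' : ℝ) + 1) * (K : ℝ) ^ e := by linarith
      exact le_of_mul_le_mul_right this he0

open Classical in
/-- The potential of an interval. -/
noncomputable def potl {Γ : Type} (K : ℕ) (lv : Γ → ℕ) (D : Γ → Set ℝ) (ω : Γ → ℝ)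
    (n m : ℕ) : ENNReal :=
  ∑' g, if lv g ≤ n ∧ (D g ∩ kI K n m).Nonempty then
    ENNReal.ofReal (ω g * √(K : ℝ) ^ (n - lv g)) else 0

lemma term_le {Γ : Type} {K : ℕ} {lv : Γ → ℕ} {D : Γ → Set ℝ} {ω : Γ → ℝ} {n m : ℕ} {θ : ℝ}
    (hθ : 0 ≤ θ) (hφ : potl K lv D ω n m ≤ ENNReal.ofReal θ) (g : Γ) (hg : lv g ≤ n)
    (hne : (D g ∩ kI K n m).Nonempty) : ω g * √(K : ℝ) ^ (n - lv g) ≤ θ := by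
  classical
  have h := (ENNReal.le_tsum g).trans hφ
  rw [if_pos ⟨hg, hne⟩] at h
  exact (ENNReal.ofReal_le_ofReal_iff hθ).1 h

lemma sqrt_pow_sq (K e : ℕ) : (√(K : ℝ) ^ e) ^ 2 = (K : ℝ) ^ e := by
  rw [← pow_mul, mul_comm, pow_mul, Real.sq_sqrt (Nat.cast_nonneg K)]

lemma pot_cover {Γ : Type} {K : ℕ} {lv : Γ → ℕ} {D : Γ → Set ℝ} {ω : Γ → ℝ} {n m : ℕ} {θ : ℝ}
    (hK : 0 < K) (hω : ∀ g, 0 ≤ ω g)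
    (hU : ∀ g m, m < K ^ lv g →
      (∃ z, ∀ u ∈ D g ∩ kI K (lv g) m, |u - z| ≤ ω g ^ 2 / (K : ℝ) ^ lv g) ∨
      ∃ g', lv g' < lv g ∧ kI K (lv g) m ⊆ D g')
    (hθ : 0 ≤ θ) (hθ1 : θ ≤ 1 / 2) (hm : m < K ^ n)
    (hφ : potl K lv D ω n m ≤ ENNReal.ofReal θ) :
    ∀ N g, lv g = N → N ≤ n → ∃ z, ∀ u ∈ D g ∩ kI K n m, |u - z| ≤ ω g ^ 2 / (K : ℝ) ^ lv g := by
  have hK' : (0 : ℝ) < K := by exact_mod_cast hK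
  intro N
  induction N using Nat.strong_induction_on with
  | _ N ih =>
    intro g hgN hN
    subst hgN
    obtain ⟨hm', hsub⟩ := kI_anc K n (lv g) m hK hN hm
    rcases hU g _ hm' with ⟨z, hz⟩ | ⟨g', hg', hs⟩
    · exact ⟨z, fun u hu => hz u ⟨hu.1, hsub hu.2⟩⟩
    · exfalso
      obtain ⟨z, hz⟩ := ih (lv g') hg' g' rfl (by omega)
      have hall : kI K n m ⊆ D g' := hsub.trans hs
      have hKn : (0 : ℝ) < (K : ℝ) ^ n := by positivity
      have hle : (m : ℝ) / (K : ℝ) ^ n ≤ ((m : ℝ) + 1) / (K : ℝ) ^ n := by gcongr; linarith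
      have hl : (m : ℝ) / (K : ℝ) ^ n ∈ kI K n m := left_mem_Icc.2 hle
      have hr : ((m : ℝ) + 1) / (K : ℝ) ^ n ∈ kI K n m := right_mem_Icc.2 hle
      have h1 := abs_le.1 (hz _ ⟨hall hl, hl⟩)
      have h2 := abs_le.1 (hz _ ⟨hall hr, hr⟩)
      have h3 := term_le hθ hφ g' (by omega) ⟨_, hall hl, hl⟩
      have h4 : 1 / (K : ℝ) ^ n ≤ 2 * (ω g' ^ 2 / (K : ℝ) ^ lv g') := by
        have : ((m : ℝ) + 1) / (K : ℝ) ^ n - (m : ℝ) / (K : ℝ) ^ n = 1 / (K : ℝ) ^ n := by ring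
        linarith [h1.1, h2.2]
      have h5 : (ω g' * √(K : ℝ) ^ (n - lv g')) ^ 2 = ω g' ^ 2 * (K : ℝ) ^ (n - lv g') := by
        rw [mul_pow, sqrt_pow_sq]
      have h6 : (K : ℝ) ^ n = (K : ℝ) ^ (n - lv g') * (K : ℝ) ^ lv g' := by
        rw [← pow_add]; congr 1; omega
      have h0 : 0 ≤ ω g' * √(K : ℝ) ^ (n - lv g') := mul_nonneg (hω _) (by positivity)
      have h7 : 1 ≤ 2 * (ω g' ^ 2 * (K : ℝ) ^ (n - lv g')) := by
        rw [h6, div_le_iff₀ (by positivity)] at h4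
        have e : 2 * (ω g' ^ 2 / (K : ℝ) ^ lv g') * ((K : ℝ) ^ (n - lv g') * (K : ℝ) ^ lv g')
          = 2 * (ω g' ^ 2 * (K : ℝ) ^ (n - lv g')) := by
          field_simp
        linarith
      nlinarith

lemma pot_step {Γ : Type} {B : ℕ} {lv : Γ → ℕ} {D : Γ → Set ℝ} {ω : Γ → ℝ} {n m : ℕ}
    (hB : 144 ≤ B) (hω : ∀ g, 0 ≤ ω g) {θ : ℝ} (hθ : θ = 1 / (8 * √((4 * B : ℕ) : ℝ)))
    (hU : ∀ g m, m < (4 * B) ^ lv g →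
      (∃ z, ∀ u ∈ D g ∩ kI (4 * B) (lv g) m, |u - z| ≤ ω g ^ 2 / ((4 * B : ℕ) : ℝ) ^ lv g) ∨
      ∃ g', lv g' < lv g ∧ kI (4 * B) (lv g) m ⊆ D g')
    (hsum : ∀ n, ∑' g, (if lv g = n then ENNReal.ofReal (ω g) else 0) ≤ ENNReal.ofReal (θ / 2))
    (hm : m < (4 * B) ^ n)
    (hφ : potl (4 * B) lv D ω n m ≤ ENNReal.ofReal θ) :
    ∃ c : Fin B → ℕ, Function.Injective c ∧
      ∀ x, c x < 2 * B ∧ (4 * B * m + 2 * c x < (4 * B) ^ (n + 1) ∧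
        potl (4 * B) lv D ω (n + 1) (4 * B * m + 2 * c x) ≤ ENNReal.ofReal θ) := by
  classical
  set K : ℕ := 4 * B with hKdef
  have hK : 0 < K := by omega
  have hK' : (0 : ℝ) < K := by exact_mod_cast hK
  set s : ℝ := √(K : ℝ) with hs
  have hs2 : s ^ 2 = K := Real.sq_sqrt hK'.le
  have hBr : (144 : ℝ) ≤ B := by exact_mod_cast hB
  have hKB : (K : ℝ) = 4 * B := by simp [hKdef]
  have hs24 : 24 ≤ s := by
    rw [hs]; apply Real.le_sqrt_of_sq_le; rw [hKB]; linarith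
  have hθpos : 0 < θ := by rw [hθ]; positivity
  have hθs : 8 * s * θ = 1 := by rw [hθ]; field_simp
  have hKθ : (K : ℝ) * θ ^ 2 = 1 / 64 := by
    have : (8 * s * θ) ^ 2 = 1 := by rw [hθs]; norm_num
    rw [← hs2]; nlinarith
  have hθ12 : θ ≤ 1 / 2 := by nlinarith
  have hcov := pot_cover hK hω hU hθpos.le hθ12 hm hφ
  let old : ℕ → ENNReal := fun r => ∑' g, if lv g ≤ n ∧
    (D g ∩ kI K (n + 1) (K * m + 2 * r)).Nonempty then
    ENNReal.ofReal (ω g * s ^ (n + 1 - lv g)) else 0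
  have hsplit : ∀ r, potl K lv D ω (n + 1) (K * m + 2 * r) ≤ old r + ENNReal.ofReal (θ / 2) := by
    intro r
    refine le_trans ?_ (add_le_add_right (hsum (n + 1)) _)
    rw [← ENNReal.tsum_add]
    refine ENNReal.tsum_le_tsum fun g => ?_
    by_cases h1 : lv g ≤ n + 1 ∧ (D g ∩ kI K (n + 1) (K * m + 2 * r)).Nonempty
    · rw [if_pos h1]
      by_cases h2 : lv g ≤ n
      · rw [if_pos ⟨h2, h1.2⟩]
        exact le_self_add
      · have h3 : lv g = n + 1 := by omega
        rw [if_pos h3, h3]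
        simp
    · rw [if_neg h1]; exact bot_le
  have hcard : ∀ g, lv g ≤ n → (D g ∩ kI K n m).Nonempty →
      (((Finset.range (2 * B)).filter fun r =>
        (D g ∩ kI K (n + 1) (K * m + 2 * r)).Nonempty).card : ℝ) ≤ 3 := by
    intro g hg hne
    have hτ := term_le hθpos.le hφ g hg hne
    obtain ⟨z, hz⟩ := hcov _ g rfl hg
    set τ := ω g * √(K : ℝ) ^ (n - lv g) with hτdef
    have hτ0 : 0 ≤ τ := mul_nonneg (hω _) (by positivity)
    have hrad : ω g ^ 2 / (K : ℝ) ^ lv g * (K : ℝ) ^ (n + 1) = K * τ ^ 2 := by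
      have h6 : (K : ℝ) ^ (n + 1) = (K : ℝ) ^ (n - lv g) * (K : ℝ) ^ lv g * K := by
        rw [← pow_add, ← pow_succ]; congr 2; omega
      rw [hτdef, mul_pow, sqrt_pow_sq, h6]
      field_simp
    have hKτ : (K : ℝ) * τ ^ 2 ≤ 1 / 64 := by
      rw [← hKθ]; gcongr
    have hpos : (0 : ℝ) < (K : ℝ) ^ (n + 1) := by positivity
    have key : ∀ r ∈ ((Finset.range (2 * B)).filter fun r =>
        (D g ∩ kI K (n + 1) (K * m + 2 * r)).Nonempty),
        (K : ℝ) * m + 2 * r ≤ z * (K : ℝ) ^ (n + 1) + 1 / 64 ∧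
        z * (K : ℝ) ^ (n + 1) - 1 / 64 ≤ K * m + 2 * r + 1 := by
      intro r hr
      obtain ⟨hr1, u, hu, huI⟩ := Finset.mem_filter.1 hr
      have hr2 : 2 * r < K := by have := Finset.mem_range.1 hr1; omega
      have hin := kI_child_subset K n m (2 * r) hK hr2 huI
      have h1 := abs_le.1 (hz u ⟨hu, hin⟩)
      simp only [kI, mem_Icc] at huI
      push_cast at huI
      rw [div_le_iff₀ hpos, le_div_iff₀ hpos] at huI
      have h2 := mul_le_mul_of_nonneg_right h1.1 hpos.le
      have h3 := mul_le_mul_of_nonneg_right h1.2 hpos.le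
      rw [neg_mul, hrad] at h2
      rw [hrad] at h3
      constructor <;> nlinarith [huI.1, huI.2]
    have := card_le_of_diff _ 1 zero_le_one (fun r hr r' hr' => by
      have a := key r hr
      have b := key r' hr'
      linarith [a.1, a.2, b.1, b.2])
    linarith
  have hold : ∑ r ∈ Finset.range (2 * B), old r ≤ ENNReal.ofReal (3 * s * θ) := by
    calc ∑ r ∈ Finset.range (2 * B), old r
        = ∑' g, ∑ r ∈ Finset.range (2 * B), (if lv g ≤ n ∧
            (D g ∩ kI K (n + 1) (K * m + 2 * r)).Nonempty then
            ENNReal.ofReal (ω g * s ^ (n + 1 - lv g)) else 0) := by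
          rw [Summable.tsum_finsetSum]
          intro r _; exact ENNReal.summable
      _ ≤ ∑' g, ENNReal.ofReal (3 * s) * (if lv g ≤ n ∧ (D g ∩ kI K n m).Nonempty then
            ENNReal.ofReal (ω g * √(K : ℝ) ^ (n - lv g)) else 0) := by
          refine ENNReal.tsum_le_tsum fun g => ?_
          by_cases hg : lv g ≤ n
          swap
          · simp [hg]
          by_cases hne : (D g ∩ kI K n m).Nonempty
          swap
          · rw [if_neg (fun h => hne h.2), mul_zero]
            apply le_of_eq
            refine Finset.sum_eq_zero fun r hr => if_neg ?_
            rintro ⟨-, u, hu, huI⟩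
            have hr2 : 2 * r < K := by have := Finset.mem_range.1 hr; omega
            exact hne ⟨u, hu, kI_child_subset K n m (2 * r) hK hr2 huI⟩
          rw [if_pos ⟨hg, hne⟩]
          simp only [hg, true_and]
          rw [← Finset.sum_filter, Finset.sum_const, nsmul_eq_mul,
            ← ENNReal.ofReal_natCast, ← ENNReal.ofReal_mul (by positivity),
            ← ENNReal.ofReal_mul (by positivity)]
          apply ENNReal.ofReal_le_ofReal
          have e : s ^ (n + 1 - lv g) = s * √(K : ℝ) ^ (n - lv g) := by
            rw [← hs, ← pow_succ']; congr 1; omega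
          rw [e]
          have h0 : 0 ≤ ω g * √(K : ℝ) ^ (n - lv g) := mul_nonneg (hω _) (by positivity)
          have h3 := mul_le_mul_of_nonneg_right (hcard g hg hne)
            (mul_nonneg (show 0 ≤ s by linarith) h0)
          nlinarith
      _ = ENNReal.ofReal (3 * s) * potl K lv D ω n m := by
          rw [ENNReal.tsum_mul_left]; rfl
      _ ≤ ENNReal.ofReal (3 * s) * ENNReal.ofReal θ := by gcongr
      _ = _ := by rw [← ENNReal.ofReal_mul (by positivity)]
  obtain ⟨P, hP⟩ : ∃ P : ℕ → Prop, ∀ r, P r ↔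
      potl K lv D ω (n + 1) (K * m + 2 * r) ≤ ENNReal.ofReal θ := ⟨_, fun _ => Iff.rfl⟩
  have hbad : ((Finset.range (2 * B)).filter fun r => ¬ P r).card ≤ B := by
    set T := (Finset.range (2 * B)).filter fun r => ¬ P r with hT
    have h1 : ∀ r ∈ T, ENNReal.ofReal (θ / 2) ≤ old r := by
      intro r hr
      have hr2 : ¬ P r := (Finset.mem_filter.1 hr).2
      by_contra hlt
      push Not at hlt
      apply hr2
      refine (hP r).2 ((hsplit r).trans ?_)
      calc old r + ENNReal.ofReal (θ / 2) ≤ ENNReal.ofReal (θ / 2) + ENNReal.ofReal (θ / 2) := by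
            gcongr
        _ = ENNReal.ofReal θ := by
            rw [← ENNReal.ofReal_add (by positivity) (by positivity)]; congr 1; ring
    have h2 : (T.card : ENNReal) * ENNReal.ofReal (θ / 2) ≤ ENNReal.ofReal (3 * s * θ) := by
      calc (T.card : ENNReal) * ENNReal.ofReal (θ / 2) = ∑ r ∈ T, ENNReal.ofReal (θ / 2) := by
            rw [Finset.sum_const, nsmul_eq_mul]
        _ ≤ ∑ r ∈ T, old r := Finset.sum_le_sum h1
        _ ≤ ∑ r ∈ Finset.range (2 * B), old r :=
            Finset.sum_le_sum_of_subset (Finset.filter_subset _ _)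
        _ ≤ _ := hold
    rw [← ENNReal.ofReal_natCast, ← ENNReal.ofReal_mul (by positivity),
      ENNReal.ofReal_le_ofReal_iff (by positivity)] at h2
    have h3 : (T.card : ℝ) ≤ 6 * s := by
      have : (T.card : ℝ) * (θ / 2) ≤ (6 * s) * (θ / 2) := by linarith
      exact le_of_mul_le_mul_right this (by positivity)
    have h4 : (T.card : ℝ) ≤ B := by nlinarith
    exact_mod_cast h4
  have hgood : B ≤ ((Finset.range (2 * B)).filter fun r => P r).card := by
    have := Finset.card_filter_add_card_filter_not (s := Finset.range (2 * B)) P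
    rw [Finset.card_range] at this
    have h2 : B ≤ (Finset.filter P (Finset.range (2 * B))).card := by
      by_contra h3
      push Not at h3
      have h4 : ((Finset.range (2 * B)).filter fun r => ¬ P r).card ≤ B := hbad
      have h5 := Finset.card_filter_add_card_filter_not (s := Finset.range (2 * B)) P
      rw [Finset.card_range] at h5
      linarith
    exact h2
  obtain ⟨T, hTs, hTc⟩ := Finset.exists_subset_card_eq hgood
  refine ⟨fun x => T.orderEmbOfFin hTc x, fun x y h => by simpa using h, fun x => ?_⟩
  have hx := hTs (T.orderEmbOfFin_mem hTc x)
  obtain ⟨hx1, hx2⟩ := Finset.mem_filter.1 hx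
  have hx3 := Finset.mem_range.1 hx1
  refine ⟨hx3, ?_, (hP _).1 hx2⟩
  rw [pow_succ]
  have : (m + 1) * K ≤ K ^ n * K := Nat.mul_le_mul_right _ hm
  nlinarith

lemma pot_dim {B : ℕ} (hB : 144 ≤ B) {S : Set ℝ}
    (h : Pot (4 * B) (1 / (8 * √((4 * B : ℕ) : ℝ)) / 2) S) :
    ENNReal.ofReal (Real.log B / Real.log (4 * B)) ≤ dimH S := by
  classical
  obtain ⟨Γ, lv, D, ω, hω, hpos, hsum, hU, hS⟩ := h
  set θ : ℝ := 1 / (8 * √((4 * B : ℕ) : ℝ)) with hθ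
  have hK : 0 < 4 * B := by omega
  have hK' : (0 : ℝ) < ((4 * B : ℕ) : ℝ) := by exact_mod_cast hK
  have hθpos : 0 < θ := by positivity
  refine cantor_dim B (by omega) S
    (fun n m => m < (4 * B) ^ n ∧ potl (4 * B) lv D ω n m ≤ ENNReal.ofReal θ) ?_ ?_ ?_
  · refine ⟨by simp, ?_⟩
    refine le_trans ?_ ((hsum 0).trans (ENNReal.ofReal_le_ofReal (by linarith)))
    refine ENNReal.tsum_le_tsum fun g => ?_
    by_cases h1 : lv g = 0
    · simp only [h1]
      split_ifs <;> simp
    · rw [if_neg (fun h => h1 (by omega))]; exact bot_le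
  · rintro n m ⟨hm, hφ⟩
    exact pot_step hB hω hθ hU hsum hm hφ
  · rintro u ⟨idx, hidx⟩
    apply hS u
    · have h0 := (hidx 0).2
      have h1 := (hidx 0).1.1
      have h2 : idx 0 = 0 := by simpa using h1
      simpa [kI, h2] using h0
    · intro g hg
      have hωg := hpos g ⟨u, hg⟩
      have hs1 : (1 : ℝ) < √((4 * B : ℕ) : ℝ) := by
        rw [Real.lt_sqrt (by norm_num)]
        have : (1 : ℝ) < ((4 * B : ℕ) : ℝ) := by exact_mod_cast (by omega : 1 < 4 * B)
        linarith
      obtain ⟨e, he⟩ := pow_unbounded_of_one_lt (θ / ω g) hs1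
      rw [div_lt_iff₀ hωg] at he
      have := term_le hθpos.le (hidx (lv g + e)).1.2 g (by omega) ⟨u, hg, (hidx _).2⟩
      rw [Nat.add_sub_cancel_left] at this
      linarith


/-- Least level whose intervals are no longer than `ρ`. -/
noncomputable def nlev (K : ℕ) (ρ : ℝ) : ℕ := sInf {n : ℕ | 1 / (K : ℝ) ^ n ≤ ρ}

lemma nlev_spec {K : ℕ} (hK : 2 ≤ K) {ρ : ℝ} (hρ : 0 < ρ) : 1 / (K : ℝ) ^ nlev K ρ ≤ ρ := by
  have hK1 : (1 : ℝ) < K := by exact_mod_cast (by omega : 1 < K)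
  have hne : {n : ℕ | 1 / (K : ℝ) ^ n ≤ ρ}.Nonempty := by
    obtain ⟨n, hn⟩ := pow_unbounded_of_one_lt (1 / ρ) hK1
    refine ⟨n, ?_⟩
    rw [div_lt_iff₀ hρ] at hn
    rw [mem_ofPred_eq, div_le_iff₀ (by positivity)]
    linarith
  exact Nat.sInf_mem hne

lemma nlev_le {K n : ℕ} {ρ : ℝ} (h : 1 / (K : ℝ) ^ n ≤ ρ) : nlev K ρ ≤ n := Nat.sInf_le h

lemma nlev_upper {K : ℕ} (hK : 2 ≤ K) {ρ : ℝ} (hρ1 : ρ ≤ 1) :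
    ρ ≤ K / (K : ℝ) ^ nlev K ρ := by
  have hK1 : (1 : ℝ) < K := by exact_mod_cast (by omega : 1 < K)
  rcases Nat.eq_zero_or_pos (nlev K ρ) with h | h
  · rw [h]; simp; linarith
  · obtain ⟨n, hn⟩ := Nat.exists_eq_succ_of_ne_zero h.ne'
    by_contra hlt
    push Not at hlt
    have h1 : 1 / (K : ℝ) ^ n ≤ ρ := by
      rw [hn, pow_succ] at hlt
      have : (K : ℝ) / ((K : ℝ) ^ n * K) = 1 / (K : ℝ) ^ n := by field_simp
      linarith
    have := nlev_le h1
    omega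

lemma nlev_lt {K : ℕ} (hK : 2 ≤ K) {ρ ρ' : ℝ} (hρ : 0 < ρ) (hρ1 : ρ < 1) (h : K * ρ ≤ ρ') :
    nlev K ρ' < nlev K ρ := by
  have hK1 : (1 : ℝ) < K := by exact_mod_cast (by omega : 1 < K)
  have hs := nlev_spec hK hρ
  rcases Nat.eq_zero_or_pos (nlev K ρ) with h0 | h0
  · rw [h0] at hs; simp at hs; linarith
  · obtain ⟨n, hn⟩ := Nat.exists_eq_succ_of_ne_zero h0.ne'
    rw [hn] at hs ⊢
    have h1 : 1 / (K : ℝ) ^ n ≤ ρ' := by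
      rw [pow_succ] at hs
      have : (K : ℝ) * (1 / ((K : ℝ) ^ n * K)) = 1 / (K : ℝ) ^ n := by field_simp
      have h2 := mul_le_mul_of_nonneg_left hs (by linarith : (0 : ℝ) ≤ K)
      linarith
    have := nlev_le h1
    omega

lemma lev_sum {K : ℕ} (hK : 2 ≤ K) (ρ : ℕ → ℝ) (hρ : ∀ h, 0 < ρ h)
    (hdec : ∀ h, ρ (h + 1) ≤ ρ h / 2) (w : ℝ) (n : ℕ) :
    ∑' h, (if nlev K (ρ h) = n then ENNReal.ofReal (if ρ h ≤ 1 then w else 0) else 0)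
      ≤ ENNReal.ofReal (K * w) := by
  classical
  have hK1 : (1 : ℝ) < K := by exact_mod_cast (by omega : 1 < K)
  have hd : ∀ h e, ρ (h + e) ≤ ρ h / 2 ^ e := by
    intro h e
    induction e with
    | zero => simp
    | succ e ih =>
      rw [← add_assoc, pow_succ]
      refine (hdec _).trans ?_
      rw [← div_div]; linarith
  by_cases hex : ∃ h, ρ h ≤ 1 ∧ nlev K (ρ h) = n
  swap
  · push Not at hex
    have : ∀ h, (if nlev K (ρ h) = n then ENNReal.ofReal (if ρ h ≤ 1 then w else 0) else 0) = 0 := by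
      intro h
      by_cases h1 : nlev K (ρ h) = n
      · have h2 : ¬ ρ h ≤ 1 := fun h2 => hex h h2 h1
        simp [h2]
      · simp [h1]
    simp [this]
  · have hm := Nat.find_spec hex
    set h0 := Nat.find hex with hh0
    have hzero : ∀ h ∉ Finset.Ico h0 (h0 + K),
        (if nlev K (ρ h) = n then ENNReal.ofReal (if ρ h ≤ 1 then w else 0) else 0) = 0 := by
      intro h hh
      by_cases h1 : nlev K (ρ h) = n
      swap
      · simp [h1]
      by_cases h2 : ρ h ≤ 1
      swap
      · simp [h2]
      exfalso
      have h3 : h0 ≤ h := Nat.find_min' hex ⟨h2, h1⟩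
      have h4 : h0 + K ≤ h := by
        by_contra h5
        exact hh (Finset.mem_Ico.2 ⟨h3, by omega⟩)
      obtain ⟨e, rfl⟩ := Nat.exists_eq_add_of_le h3
      have h5 := hd h0 e
      have h6 := nlev_spec hK (hρ (h0 + e))
      have h7 := nlev_upper hK hm.1
      rw [h1] at h6
      rw [hm.2] at h7
      have h8 : 1 / (K : ℝ) ^ n ≤ K / (K : ℝ) ^ n / 2 ^ e := h6.trans (h5.trans (by gcongr))
      have h9 : (2 : ℝ) ^ e ≤ K := by
        rw [div_div, div_le_div_iff₀ (by positivity) (by positivity)] at h8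
        have hp : (0 : ℝ) < (K : ℝ) ^ n := by positivity
        nlinarith
      have h10 : 2 ^ e ≤ K := by exact_mod_cast h9
      have : e < 2 ^ e := Nat.lt_two_pow_self
      omega
    rw [tsum_eq_sum hzero]
    calc _ ≤ ∑ h ∈ Finset.Ico h0 (h0 + K), ENNReal.ofReal w := by
          refine Finset.sum_le_sum fun h _ => ?_
          split_ifs <;> simp
      _ = _ := by
          rw [Finset.sum_const, Nat.card_Ico, Nat.add_sub_cancel_left, nsmul_eq_mul,
            ENNReal.ofReal_mul (by positivity), ENNReal.ofReal_natCast]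

lemma exists_two_pow {x : ℝ} (hx : 1 ≤ x) : ∃ h : ℕ, (2 : ℝ) ^ h ≤ x ∧ x < 2 * (2 : ℝ) ^ h := by
  obtain ⟨n, h1, h2⟩ := exists_nat_pow_near hx (by norm_num : (1 : ℝ) < 2)
  exact ⟨n, h1, by rwa [pow_succ'] at h2⟩

lemma coreL {A B C A' B' C' a1 b1 a2 b2 P Q H T J Ca κ c u u0 u1 : ℝ}
    (hP : 0 < P) (hQ : 0 < Q) (hT : 0 < T) (hJ : 1 ≤ J) (hH : P * Q = H) (hCa : 0 < Ca)
    (hκ : 0 < κ) (hc : c ≤ Ca * κ)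
    (hA : |A| ≤ P) (hA' : |A'| ≤ P) (hB : |B| ≤ Q) (hB' : |B'| ≤ Q)
    (hα : |A * a1 + B * a2| ≤ Ca * P / T) (hα' : |A' * a1 + B' * a2| ≤ Ca * P / T)
    (hF : |A * (a1 * u0 + b1) + B * (a2 * u0 + b2) + C| ≤ c / H)
    (hF' : |A' * (a1 * u1 + b1) + B' * (a2 * u1 + b2) + C'| ≤ c / H)
    (h0 : |u - u0| ≤ κ * (T * J) / (H * P)) (h1 : |u - u1| ≤ κ * (T * J) / (H * P)) :
    |(A * B' - A' * B) * (a1 * u + b1) - (B * C' - B' * C)| ≤ 4 * Ca * κ * J / P ∧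
    |(A * B' - A' * B) * (a2 * u + b2) - (A' * C - A * C')| ≤ 4 * Ca * κ * J / Q ∧
    |A * B' - A' * B| * |a1| ≤ 2 * Ca * H / T := by
  have hH0 : 0 < H := by rw [← hH]; positivity
  have key : ∀ A B C u0 : ℝ, |A * a1 + B * a2| ≤ Ca * P / T →
      |A * (a1 * u0 + b1) + B * (a2 * u0 + b2) + C| ≤ c / H →
      |u - u0| ≤ κ * (T * J) / (H * P) →
      |A * (a1 * u + b1) + B * (a2 * u + b2) + C| ≤ 2 * Ca * κ * J / H := by
    intro A B C u0 hα hF h0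
    have e : A * (a1 * u + b1) + B * (a2 * u + b2) + C =
      (A * (a1 * u0 + b1) + B * (a2 * u0 + b2) + C) + (A * a1 + B * a2) * (u - u0) := by ring
    rw [e]
    refine (abs_add_le _ _).trans ?_
    rw [abs_mul]
    have h2 : |A * a1 + B * a2| * |u - u0| ≤ Ca * P / T * (κ * (T * J) / (H * P)) := by gcongr
    have h3 : Ca * P / T * (κ * (T * J) / (H * P)) = Ca * κ * J / H := by field_simp
    have h4 : c / H ≤ Ca * κ * J / H := by
      gcongr
      have : 0 < Ca * κ := by positivity
      nlinarith
    have h5 : 2 * Ca * κ * J / H = Ca * κ * J / H + Ca * κ * J / H := by ring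
    linarith
  have f := key A B C u0 hα hF h0
  have f' := key A' B' C' u1 hα' hF' h1
  set F := A * (a1 * u + b1) + B * (a2 * u + b2) + C with hFd
  set F' := A' * (a1 * u + b1) + B' * (a2 * u + b2) + C' with hFd'
  refine ⟨?_, ?_, ?_⟩
  · have e : (A * B' - A' * B) * (a1 * u + b1) - (B * C' - B' * C) = B' * F - B * F' := by
      rw [hFd, hFd']; ring
    rw [e]
    refine (abs_sub _ _).trans ?_
    rw [abs_mul, abs_mul]
    have g1 : |B'| * |F| ≤ Q * (2 * Ca * κ * J / H) := by gcongr
    have g2 : |B| * |F'| ≤ Q * (2 * Ca * κ * J / H) := by gcongr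
    have g3 : Q * (2 * Ca * κ * J / H) = 2 * Ca * κ * J / P := by rw [← hH]; field_simp
    have : 4 * Ca * κ * J / P = 2 * Ca * κ * J / P + 2 * Ca * κ * J / P := by ring
    linarith
  · have e : (A * B' - A' * B) * (a2 * u + b2) - (A' * C - A * C') = A * F' - A' * F := by
      rw [hFd, hFd']; ring
    rw [e]
    refine (abs_sub _ _).trans ?_
    rw [abs_mul, abs_mul]
    have g1 : |A| * |F'| ≤ P * (2 * Ca * κ * J / H) := by gcongr
    have g2 : |A'| * |F| ≤ P * (2 * Ca * κ * J / H) := by gcongr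
    have g3 : P * (2 * Ca * κ * J / H) = 2 * Ca * κ * J / Q := by rw [← hH]; field_simp
    have : 4 * Ca * κ * J / Q = 2 * Ca * κ * J / Q + 2 * Ca * κ * J / Q := by ring
    linarith
  · rw [← abs_mul]
    have e : (A * B' - A' * B) * a1 = (A * a1 + B * a2) * B' - (A' * a1 + B' * a2) * B := by ring
    rw [e]
    refine (abs_sub _ _).trans ?_
    rw [abs_mul, abs_mul]
    have g1 : |A * a1 + B * a2| * |B'| ≤ Ca * P / T * Q := by gcongr
    have g2 : |A' * a1 + B' * a2| * |B| ≤ Ca * P / T * Q := by gcongr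
    have g3 : 2 * Ca * H / T = Ca * P / T * Q + Ca * P / T * Q := by rw [← hH]; ring
    linarith

set_option maxHeartbeats 1000000 in
lemma coreP {q p1 p2 q' p1' p2' a1 b1 a2 b2 P Q H C3 C4 p y u u0 u1 : ℝ}
    (hQ : 0 < Q) (hQP : Q ≤ P) (hH : P * Q = H) (ha1 : a1 ≠ 0) (hp : 0 < p)
    (hy : 0 < y) (hpy : p ≤ y) (hpa : p ≤ |a1| * y) (hC3 : C3 = 1 + |a2 / a1|)
    (hC4 : C4 = 4 * C3 + 12 * |a2| + 12 * |a1| + 6 * |a1| * C3)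
    (hq0 : 0 ≤ q) (hq : q ≤ 2 * H) (hq0' : 0 ≤ q') (hq' : q' ≤ 2 * H)
    (hX : |q * (a1 * u0 + b1) - p1| ≤ p / P) (hY : |q * (a2 * u0 + b2) - p2| ≤ p / Q)
    (hX' : |q' * (a1 * u1 + b1) - p1'| ≤ p / P) (hY' : |q' * (a2 * u1 + b2) - p2'| ≤ p / Q)
    (h0 : |u - u0| ≤ y / (H * P)) (h1 : |u - u1| ≤ y / (H * P)) :
    |p2 * q' - q * p2'| ≤ C4 * y * P ∧ |q * p1' - p1 * q'| ≤ C4 * y * Q ∧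
    |(p2 * q' - q * p2') * (a1 * u + b1) + (q * p1' - p1 * q') * (a2 * u + b2) +
      (p1 * p2' - p2 * p1')| ≤ C4 * p * y / H ∧
    |(p2 * q' - q * p2') * a1 + (q * p1' - p1 * q') * a2| ≤ C4 * p * P := by
  have hP : 0 < P := by linarith
  have hH0 : 0 < H := by rw [← hH]; positivity
  have ha : 0 < |a1| := abs_pos.2 ha1
  have hC30 : 0 < C3 := by rw [hC3]; positivity
  have keyX : ∀ q p1 u0 : ℝ, 0 ≤ q → q ≤ 2 * H → |q * (a1 * u0 + b1) - p1| ≤ p / P →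
      |u - u0| ≤ y / (H * P) → |q * (a1 * u + b1) - p1| ≤ 3 * |a1| * y / P := by
    intro q p1 u0 hq0 hq hX h0
    have e : q * (a1 * u + b1) - p1 = (q * (a1 * u0 + b1) - p1) + q * a1 * (u - u0) := by ring
    rw [e]
    refine (abs_add_le _ _).trans ?_
    rw [abs_mul, abs_mul, abs_of_nonneg hq0]
    have g1 : q * |a1| * |u - u0| ≤ 2 * H * |a1| * (y / (H * P)) := by gcongr
    have g2 : 2 * H * |a1| * (y / (H * P)) = 2 * |a1| * y / P := by field_simp
    have g3 : p / P ≤ |a1| * y / P := by gcongr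
    have : 3 * |a1| * y / P = |a1| * y / P + 2 * |a1| * y / P := by ring
    linarith
  have keyΔ : ∀ q p1 p2 u0 : ℝ, |q * (a1 * u0 + b1) - p1| ≤ p / P →
      |q * (a2 * u0 + b2) - p2| ≤ p / Q →
      |(q * (a2 * u + b2) - p2) - a2 / a1 * (q * (a1 * u + b1) - p1)| ≤ C3 * p / Q := by
    intro q p1 p2 u0 hX hY
    have e : (q * (a2 * u + b2) - p2) - a2 / a1 * (q * (a1 * u + b1) - p1)
       = (q * (a2 * u0 + b2) - p2) - a2 / a1 * (q * (a1 * u0 + b1) - p1) := by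
      field_simp; ring
    rw [e]
    refine (abs_sub _ _).trans ?_
    rw [abs_mul]
    have g1 : |a2 / a1| * |q * (a1 * u0 + b1) - p1| ≤ |a2 / a1| * (p / Q) := by
      gcongr
      exact hX.trans (by gcongr)
    have : C3 * p / Q = p / Q + |a2 / a1| * (p / Q) := by rw [hC3]; ring
    linarith
  have x := keyX q p1 u0 hq0 hq hX h0
  have x' := keyX q' p1' u1 hq0' hq' hX' h1
  have d := keyΔ q p1 p2 u0 hX hY
  have d' := keyΔ q' p1' p2' u1 hX' hY'
  set X := q * (a1 * u + b1) - p1 with hXd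
  set X' := q' * (a1 * u + b1) - p1' with hXd'
  set Δ := (q * (a2 * u + b2) - p2) - a2 / a1 * X with hΔ
  set Δ' := (q' * (a2 * u + b2) - p2') - a2 / a1 * X' with hΔ'
  have dd : |q * Δ' - q' * Δ| ≤ 4 * C3 * p * P := by
    refine (abs_sub _ _).trans ?_
    rw [abs_mul, abs_mul, abs_of_nonneg hq0, abs_of_nonneg hq0']
    have g1 : q * |Δ'| ≤ 2 * H * (C3 * p / Q) := by gcongr
    have g2 : q' * |Δ| ≤ 2 * H * (C3 * p / Q) := by gcongr
    have g3 : 2 * H * (C3 * p / Q) = 2 * C3 * p * P := by rw [← hH]; field_simp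
    linarith
  have xx : |q * X' - q' * X| ≤ 12 * |a1| * y * Q := by
    refine (abs_sub _ _).trans ?_
    rw [abs_mul, abs_mul, abs_of_nonneg hq0, abs_of_nonneg hq0']
    have g1 : q * |X'| ≤ 2 * H * (3 * |a1| * y / P) := by gcongr
    have g2 : q' * |X| ≤ 2 * H * (3 * |a1| * y / P) := by gcongr
    have g3 : 2 * H * (3 * |a1| * y / P) = 6 * |a1| * y * Q := by rw [← hH]; field_simp; ring
    linarith
  have n1 : 0 ≤ |a2| := abs_nonneg _
  refine ⟨?_, ?_, ?_, ?_⟩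
  · have e : p2 * q' - q * p2' = (q * Δ' - q' * Δ) + a2 / a1 * (q * X' - q' * X) := by
      rw [hΔ, hΔ']; ring
    rw [e]
    refine (abs_add_le _ _).trans ?_
    rw [abs_mul, abs_div]
    have g1 : |a2| / |a1| * |q * X' - q' * X| ≤ |a2| / |a1| * (12 * |a1| * y * P) := by
      gcongr
      exact xx.trans (by gcongr)
    have g2 : |a2| / |a1| * (12 * |a1| * y * P) = 12 * |a2| * (y * P) := by field_simp
    have g3 : 4 * C3 * p * P ≤ 4 * C3 * (y * P) := by
      rw [← mul_assoc]; gcongr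
    have g4 : 0 ≤ (12 * |a1| + 6 * |a1| * C3) * (y * P) := by positivity
    rw [hC4]; nlinarith
  · have e : q * p1' - p1 * q' = -(q * X' - q' * X) := by rw [hXd, hXd']; ring
    rw [e, abs_neg]
    have g4 : 0 ≤ (4 * C3 + 12 * |a2| + 6 * |a1| * C3) * (y * Q) := by positivity
    rw [hC4]; nlinarith
  · have e : (p2 * q' - q * p2') * (a1 * u + b1) + (q * p1' - p1 * q') * (a2 * u + b2) +
      (p1 * p2' - p2 * p1') = X * Δ' - X' * Δ := by
      rw [hΔ, hΔ', hXd, hXd']; ring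
    rw [e]
    refine (abs_sub _ _).trans ?_
    rw [abs_mul, abs_mul]
    have g1 : |X| * |Δ'| ≤ 3 * |a1| * y / P * (C3 * p / Q) := by gcongr
    have g2 : |X'| * |Δ| ≤ 3 * |a1| * y / P * (C3 * p / Q) := by gcongr
    have g3 : 3 * |a1| * y / P * (C3 * p / Q) = 3 * |a1| * C3 * p * y / H := by
      rw [← hH]; field_simp
    have g4 : 0 ≤ (4 * C3 + 12 * |a2| + 12 * |a1|) * p * y / H := by positivity
    have g5 : C4 * p * y / H = 3 * |a1| * C3 * p * y / H + 3 * |a1| * C3 * p * y / H +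
      (4 * C3 + 12 * |a2| + 12 * |a1|) * p * y / H := by rw [hC4]; ring
    linarith
  · have e : (p2 * q' - q * p2') * a1 + (q * p1' - p1 * q') * a2 = a1 * (q * Δ' - q' * Δ) := by
      rw [hΔ, hΔ', hXd, hXd']; field_simp; ring
    rw [e, abs_mul]
    have g1 : |a1| * |q * Δ' - q' * Δ| ≤ |a1| * (4 * C3 * p * P) := by gcongr
    have g2 : 0 ≤ |a1| * p * P := by positivity
    have g3 : 0 ≤ |a2| * p * P := by positivity
    have g4 : 0 ≤ C3 * p * P := by positivity
    have g6 : 0 ≤ |a1| * C3 * p * P := by positivity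
    have g7 : C4 * p * P = 4 * (C3 * p * P) + 12 * (|a2| * p * P) + 12 * (|a1| * p * P) +
      6 * (|a1| * C3 * p * P) := by rw [hC4]; ring
    have g8 : |a1| * (4 * C3 * p * P) = 4 * (|a1| * C3 * p * P) := by ring
    linarith

/-- Parameters of the construction. -/
structure Par where
  K : ℕ
  a1 : ℝ
  b1 : ℝ
  a2 : ℝ
  b2 : ℝ
  r : ℝ
  s : ℝ
  ε : ℝ
  c0 : ℝ
  C1 : ℝ
  C2 : ℝ
  C3 : ℝ
  C4 : ℝ
  Ca : ℝ
  κ : ℝ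
  c : ℝ
  p : ℝ
  y : ℝ
  p' : ℝ
  y' : ℝ
  jj : ℝ
  hK : 2 ≤ K
  ha1 : a1 ≠ 0
  hs : 0 < s
  hsr : s ≤ r
  hrs : r + s = 1
  hε : 0 < ε
  hc0 : 0 < c0
  hCa : Ca = |a1| + |a2|
  hC1 : C1 = 2 * Ca / |a1|
  hC2 : 1 ≤ C2
  hC2' : 2 * Ca / c0 ≤ C2
  hC3 : C3 = 1 + |a2 / a1|
  hC4 : C4 = 4 * C3 + 12 * |a2| + 12 * |a1| + 6 * |a1| * C3
  hjj : 0 < jj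
  hjs : 2 * jj ≤ s
  hjε : 2 * jj ≤ ε
  hp : 0 < p
  hy : 0 < y
  hp' : 0 < p'
  hy' : 0 < y'
  hκ0 : 0 < κ
  hκ : κ * (4 * Ca * C1) = p
  hc : c = 2 * C4 ^ 2 * p * y ^ 2
  n1 : c ≤ Ca * κ
  n2 : c ≤ c0 / 2
  n3 : 4 * Ca * C2 * κ < 1
  n4 : κ * C2 ^ 2 < 1
  n5 : K * C1 ^ 2 * κ ≤ y
  n6 : p ≤ |a1| * y
  n7 : p ≤ y
  n8 : C4 * y ≤ 1
  n9 : y < 1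
  n10 : 4 * K * C4 ^ 2 * p * y ^ 2 ≤ κ * Ca
  n11 : 2 * (p' + 2 * Ca * y') ≤ p
  n12 : K * y' ≤ y
  dio : ∀ (h : ℕ) (A B C : ℤ), (A ≠ 0 ∨ B ≠ 0) → |(A : ℝ)| ≤ ((2 : ℝ) ^ h) ^ r →
    |(B : ℝ)| ≤ ((2 : ℝ) ^ h) ^ s →
    c0 * ((2 : ℝ) ^ h) ^ ε ≤ max |A * a1 + B * a2| |A * b1 + B * b2 + C| * (2 : ℝ) ^ h

namespace Par

variable (X : Par)

/-- A dangerous line. -/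
def WL (h k : ℕ) (A B C : ℤ) (u : ℝ) : Prop :=
  (A ≠ 0 ∨ B ≠ 0) ∧ |(A : ℝ)| ≤ ((2 : ℝ) ^ h) ^ X.r ∧
    |(B : ℝ)| ≤ ((2 : ℝ) ^ h) ^ X.s ∧
    X.Ca * ((2 : ℝ) ^ h) ^ X.r / (2 * (2 : ℝ) ^ k) < |A * X.a1 + B * X.a2| ∧
    |A * X.a1 + B * X.a2| ≤ X.Ca * ((2 : ℝ) ^ h) ^ X.r / (2 : ℝ) ^ k ∧
    |A * (X.a1 * u + X.b1) + B * (X.a2 * u + X.b2) + C| ≤ X.c / (2 : ℝ) ^ h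

/-- Line obstacles. -/
def DL (h k : ℕ) : Set ℝ := {u : ℝ | u ∈ Icc (0 : ℝ) 1 ∧ ∃ A B C : ℤ, X.WL h k A B C u}

/-- A dangerous point. -/
def WP (γ δ p : ℝ) (h : ℕ) (q p1 p2 : ℤ) (u : ℝ) : Prop :=
  (2 : ℝ) ^ h ≤ q ∧ (q : ℝ) < 2 * (2 : ℝ) ^ h ∧
    |q * (X.a1 * u + X.b1) - γ - p1| ≤ p / ((2 : ℝ) ^ h) ^ X.r ∧
    |q * (X.a2 * u + X.b2) - δ - p2| ≤ p / ((2 : ℝ) ^ h) ^ X.s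

/-- Point obstacles. -/
def DP (γ δ p : ℝ) (h : ℕ) : Set ℝ := {u : ℝ | ∃ q p1 p2 : ℤ, X.WP γ δ p h q p1 p2 u}

/-- Scale of line obstacles. -/
noncomputable def ρL (h k : ℕ) : ℝ :=
  X.κ * ((2 : ℝ) ^ k * ((2 : ℝ) ^ k) ^ X.jj) / ((2 : ℝ) ^ h * ((2 : ℝ) ^ h) ^ X.r)

/-- Scale of point obstacles. -/
noncomputable def ρP (y : ℝ) (h : ℕ) : ℝ := y / ((2 : ℝ) ^ h * ((2 : ℝ) ^ h) ^ X.r)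

lemma mem_DP_of_int {p u : ℝ} {h : ℕ} (q p1 p2 : ℤ)
    (h1 : (2 : ℝ) ^ h ≤ |(q : ℝ)|) (h2 : |(q : ℝ)| < 2 * (2 : ℝ) ^ h)
    (h3 : |q * (X.a1 * u + X.b1) - p1| ≤ p / ((2 : ℝ) ^ h) ^ X.r)
    (h4 : |q * (X.a2 * u + X.b2) - p2| ≤ p / ((2 : ℝ) ^ h) ^ X.s) :
    u ∈ X.DP 0 0 p h := by
  rcases le_total (0 : ℝ) q with hq | hq
  · rw [abs_of_nonneg hq] at h1 h2
    exact ⟨q, p1, p2, h1, h2, by simpa using h3, by simpa using h4⟩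
  · rw [abs_of_nonpos hq] at h1 h2
    refine ⟨-q, -p1, -p2, by simpa using h1, by simpa using h2, ?_, ?_⟩
    · rw [← abs_neg] at h3
      convert h3 using 2; push_cast; ring
    · rw [← abs_neg] at h4
      convert h4 using 2; push_cast; ring

lemma r_pos : 0 < X.r := X.hs.trans_le X.hsr
lemma r_lt : X.r < 1 := by linarith [X.hs, X.hrs]
lemma a1_pos : 0 < |X.a1| := abs_pos.2 X.ha1
lemma Ca_pos : 0 < X.Ca := by rw [X.hCa]; linarith [X.a1_pos, abs_nonneg X.a2]
lemma C1_ge : 2 ≤ X.C1 := by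
  rw [X.hC1, le_div_iff₀ X.a1_pos, X.hCa]; linarith [abs_nonneg X.a2]
lemma C3_ge : 1 ≤ X.C3 := by rw [X.hC3]; linarith [abs_nonneg (X.a2 / X.a1)]
lemma C4_ge : 1 ≤ X.C4 := by
  have h1 := X.C3_ge
  have h2 := X.a1_pos
  have : 0 ≤ |X.a1| * X.C3 := by positivity
  rw [X.hC4]; linarith [abs_nonneg X.a2]
lemma c_pos : 0 < X.c := by
  have := X.C4_ge
  have := X.hp
  have := X.hy
  rw [X.hc]; positivity
lemma K_ge : (2 : ℝ) ≤ X.K := by exact_mod_cast X.hK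

lemma two_pow_ge (h : ℕ) : (1 : ℝ) ≤ (2 : ℝ) ^ h := one_le_pow₀ (by norm_num)
lemma P_ge (h : ℕ) : 1 ≤ ((2 : ℝ) ^ h) ^ X.r := Real.one_le_rpow (two_pow_ge h) X.r_pos.le
lemma Q_ge (h : ℕ) : 1 ≤ ((2 : ℝ) ^ h) ^ X.s := Real.one_le_rpow (two_pow_ge h) X.hs.le
lemma QP (h : ℕ) : ((2 : ℝ) ^ h) ^ X.s ≤ ((2 : ℝ) ^ h) ^ X.r :=
  Real.rpow_le_rpow_of_exponent_le (two_pow_ge h) X.hsr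
lemma PQ (h : ℕ) : ((2 : ℝ) ^ h) ^ X.r * ((2 : ℝ) ^ h) ^ X.s = (2 : ℝ) ^ h := by
  rw [← Real.rpow_add (by positivity), X.hrs, Real.rpow_one]

lemma ρL_pos (h k : ℕ) : 0 < X.ρL h k := by
  have := X.hκ0
  unfold ρL; positivity
lemma ρP_pos {y : ℝ} (hy : 0 < y) (h : ℕ) : 0 < X.ρP y h := by
  unfold ρP; positivity
lemma ρP_lt {y : ℝ} (hy : 0 < y) (hy1 : y < 1) (h : ℕ) : X.ρP y h < 1 := by
  unfold ρP
  rw [div_lt_one (by positivity)]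
  have := X.P_ge h
  have := two_pow_ge h
  nlinarith

lemma dio_lower {h : ℕ} {A B C : ℤ} {u : ℝ} (hu : u ∈ Icc (0 : ℝ) 1) (hAB : A ≠ 0 ∨ B ≠ 0)
    (hA : |(A : ℝ)| ≤ ((2 : ℝ) ^ h) ^ X.r) (hB : |(B : ℝ)| ≤ ((2 : ℝ) ^ h) ^ X.s)
    (hF : |A * (X.a1 * u + X.b1) + B * (X.a2 * u + X.b2) + C| ≤ X.c / (2 : ℝ) ^ h) :
    X.c0 / 2 * ((2 : ℝ) ^ h) ^ X.ε ≤ |A * X.a1 + B * X.a2| * (2 : ℝ) ^ h := by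
  have hd := X.dio h A B C hAB hA hB
  set H := (2 : ℝ) ^ h with hH
  have hH1 : 1 ≤ H := two_pow_ge h
  have hE : 1 ≤ H ^ X.ε := Real.one_le_rpow hH1 X.hε.le
  set α := (A : ℝ) * X.a1 + B * X.a2 with hα
  have h1 : |A * X.b1 + B * X.b2 + C| ≤ X.c / H + |α| := by
    have e : A * X.b1 + B * X.b2 + (C : ℝ) =
      (A * (X.a1 * u + X.b1) + B * (X.a2 * u + X.b2) + C) - α * u := by rw [hα]; ring
    rw [e]
    refine (abs_sub _ _).trans ?_
    have : |α * u| ≤ |α| := by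
      rw [abs_mul, abs_of_nonneg hu.1]
      exact mul_le_of_le_one_right (abs_nonneg _) hu.2
    linarith
  have hc := X.c_pos
  have h2 : max |α| |A * X.b1 + B * X.b2 + C| ≤ X.c / H + |α| :=
    max_le (by have : 0 ≤ X.c / H := by positivity
               linarith) h1
  have h3 : X.c0 * H ^ X.ε ≤ (X.c / H + |α|) * H := hd.trans (by gcongr)
  have h4 : (X.c / H + |α|) * H = X.c + |α| * H := by field_simp
  have := X.n2
  have := X.hc0
  nlinarith

lemma T_le {h k : ℕ} {A B C : ℤ} {u : ℝ} (hu : u ∈ Icc (0 : ℝ) 1) (hw : X.WL h k A B C u) :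
    (2 : ℝ) ^ k * ((2 : ℝ) ^ h) ^ X.ε ≤ X.C2 * ((2 : ℝ) ^ h * ((2 : ℝ) ^ h) ^ X.r) := by
  obtain ⟨hAB, hA, hB, hα1, hα2, hF⟩ := hw
  have hd := X.dio_lower hu hAB hA hB hF
  set H := (2 : ℝ) ^ h with hH
  set T := (2 : ℝ) ^ k with hT
  have hT0 : 0 < T := by positivity
  have hP0 : 0 < H ^ X.r := by positivity
  have hH0 : 0 < H := by positivity
  have hE0 : 0 < H ^ X.ε := by positivity
  have hc0 := X.hc0
  have hCa := X.Ca_pos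
  have h1 : X.c0 / 2 * H ^ X.ε ≤ X.Ca * H ^ X.r / T * H := hd.trans (by gcongr)
  have h2 : X.c0 / 2 * H ^ X.ε * T ≤ X.Ca * H ^ X.r * H := by
    have := mul_le_mul_of_nonneg_right h1 hT0.le
    have e : X.Ca * H ^ X.r / T * H * T = X.Ca * H ^ X.r * H := by field_simp
    linarith
  have h3 : T * H ^ X.ε ≤ 2 * X.Ca / X.c0 * (H * H ^ X.r) := by
    rw [div_mul_eq_mul_div, le_div_iff₀ hc0]; nlinarith
  exact h3.trans (by gcongr; exact X.hC2')

lemma J_le {h k : ℕ} {A B C : ℤ} {u : ℝ} (hu : u ∈ Icc (0 : ℝ) 1) (hw : X.WL h k A B C u) :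
    ((2 : ℝ) ^ k) ^ X.jj ≤ X.C2 * ((2 : ℝ) ^ h) ^ (2 * X.jj) := by
  have h1 := X.T_le hu hw
  set H := (2 : ℝ) ^ h with hH
  set T := (2 : ℝ) ^ k with hT
  have hT0 : 0 < T := by positivity
  have hH1 : 1 ≤ H := two_pow_ge h
  have hH0 : 0 < H := by positivity
  have hE : 1 ≤ H ^ X.ε := Real.one_le_rpow hH1 X.hε.le
  have hP : H ^ X.r ≤ H := by
    conv_rhs => rw [← Real.rpow_one H]
    exact Real.rpow_le_rpow_of_exponent_le hH1 X.r_lt.le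
  have hC2 := X.hC2
  have h2 : T ≤ X.C2 * H ^ (2 : ℝ) := by
    calc T ≤ T * H ^ X.ε := le_mul_of_one_le_right hT0.le hE
      _ ≤ X.C2 * (H * H ^ X.r) := h1
      _ ≤ X.C2 * (H * H) := by gcongr
      _ = _ := by rw [Real.rpow_two]; ring
  have hj := X.hjj
  have hjs := X.hjs
  have hj1 : X.jj ≤ 1 := by linarith [X.hrs, X.r_pos]
  calc T ^ X.jj ≤ (X.C2 * H ^ (2 : ℝ)) ^ X.jj := by gcongr
    _ = X.C2 ^ X.jj * H ^ (2 * X.jj) := by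
      rw [Real.mul_rpow (by linarith) (by positivity), ← Real.rpow_mul hH0.le]
    _ ≤ X.C2 * H ^ (2 * X.jj) := by
      gcongr
      conv_rhs => rw [← Real.rpow_one X.C2]
      exact Real.rpow_le_rpow_of_exponent_le hC2 hj1

lemma J_le_Q {h k : ℕ} {A B C : ℤ} {u : ℝ} (hu : u ∈ Icc (0 : ℝ) 1) (hw : X.WL h k A B C u) :
    ((2 : ℝ) ^ k) ^ X.jj ≤ X.C2 * ((2 : ℝ) ^ h) ^ X.s := by
  refine (X.J_le hu hw).trans ?_
  have := X.hC2
  gcongr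
  · exact two_pow_ge h
  · exact X.hjs

lemma ρL_lt {h k : ℕ} {A B C : ℤ} {u : ℝ} (hu : u ∈ Icc (0 : ℝ) 1) (hw : X.WL h k A B C u) :
    X.ρL h k < 1 := by
  have h1 := X.T_le hu hw
  have h2 : ((2 : ℝ) ^ k) ^ X.jj ≤ X.C2 * ((2 : ℝ) ^ h) ^ X.ε := by
    refine (X.J_le hu hw).trans ?_
    have := X.hC2
    gcongr
    · exact two_pow_ge h
    · exact X.hjε
  unfold ρL
  set H := (2 : ℝ) ^ h with hH
  set T := (2 : ℝ) ^ k with hT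
  have hT0 : 0 < T := by positivity
  have hH0 : 0 < H := by positivity
  have hE0 : 0 < H ^ X.ε := by positivity
  have hP0 : 0 < H ^ X.r := by positivity
  have hκ := X.hκ0
  have hC2 := X.hC2
  rw [div_lt_one (by positivity)]
  calc X.κ * (T * T ^ X.jj) ≤ X.κ * (T * (X.C2 * H ^ X.ε)) := by gcongr
    _ = X.κ * X.C2 * (T * H ^ X.ε) := by ring
    _ ≤ X.κ * X.C2 * (X.C2 * (H * H ^ X.r)) := by gcongr
    _ = X.κ * X.C2 ^ 2 * (H * H ^ X.r) := by ring
    _ < 1 * (H * H ^ X.r) := by gcongr; exact X.n4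
    _ = _ := one_mul _

lemma kI_dist {K n m : ℕ} {u v : ℝ} (hu : u ∈ kI K n m) (hv : v ∈ kI K n m) :
    |u - v| ≤ 1 / (K : ℝ) ^ n := by
  have e : ((m : ℝ) + 1) / (K : ℝ) ^ n = m / (K : ℝ) ^ n + 1 / (K : ℝ) ^ n := by ring
  simp only [kI, mem_Icc] at hu hv
  rw [abs_le]; constructor <;> linarith [hu.1, hu.2, hv.1, hv.2]

lemma kI_unit {K n m : ℕ} (hK : 0 < K) (hm : m < K ^ n) {u : ℝ} (hu : u ∈ kI K n m) :
    u ∈ Icc (0 : ℝ) 1 := by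
  have hKn : (0 : ℝ) < (K : ℝ) ^ n := by
    have : (0 : ℝ) < K := by exact_mod_cast hK
    positivity
  simp only [kI, mem_Icc] at hu
  have h1 : (m : ℝ) + 1 ≤ (K : ℝ) ^ n := by exact_mod_cast hm
  constructor
  · exact le_trans (by positivity) hu.1
  · exact hu.2.trans ((div_le_one hKn).2 h1)

lemma zero_of_prop {a1 a2 b1 b2 A B C A' B' C' : ℝ} (h1 : A * B' - A' * B = 0)
    (h2 : B * C' - B' * C = 0) (h3 : A' * C - A * C' = 0) :
    (A * a1 + B * a2) * (A' * b1 + B' * b2 + C') = (A' * a1 + B' * a2) * (A * b1 + B * b2 + C) := by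
  linear_combination (a1 * b2 - a2 * b1) * h1 + a2 * h2 - a1 * h3

end Par

namespace Par

variable (X : Par)

lemma rpow_le_of_le {h' : ℕ} {H T C e : ℝ} (hH : 0 < H) (hT : 0 < T) (hC : 1 ≤ C) (he : 0 ≤ e)
    (he1 : e ≤ 1) (h : (2 : ℝ) ^ h' ≤ C * H / T) :
    ((2 : ℝ) ^ h') ^ e * T ^ e ≤ C * H ^ e := by
  calc ((2 : ℝ) ^ h') ^ e * T ^ e ≤ (C * H / T) ^ e * T ^ e := by gcongr
    _ = (C * H) ^ e := by
      rw [← Real.mul_rpow (by positivity) hT.le]; congr 1; field_simp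
    _ = C ^ e * H ^ e := Real.mul_rpow (by linarith) hH.le
    _ ≤ C * H ^ e := by
      gcongr
      conv_rhs => rw [← Real.rpow_one C]
      exact Real.rpow_le_rpow_of_exponent_le hC he1

lemma UL (h k m : ℕ) :
    (∃ z, ∀ u ∈ X.DL h k ∩ kI X.K (nlev X.K (X.ρL h k)) m,
      |u - z| ≤ 2 * X.c * (2 : ℝ) ^ k / (X.Ca * ((2 : ℝ) ^ h * ((2 : ℝ) ^ h) ^ X.r))) ∨
    ∃ h', nlev X.K (X.ρP X.y h') < nlev X.K (X.ρL h k) ∧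
      kI X.K (nlev X.K (X.ρL h k)) m ⊆ X.DP 0 0 X.p h' := by
  set n := nlev X.K (X.ρL h k) with hn
  have hKpos : 0 < X.K := by have := X.hK; omega
  by_cases hne : ∃ u0 ∈ X.DL h k ∩ kI X.K n m, True
  swap
  · left
    exact ⟨0, fun u hu => absurd ⟨u, hu, trivial⟩ hne⟩
  obtain ⟨u0, ⟨⟨hu01, A, B, C, hw⟩, hu0I⟩, -⟩ := hne
  have hlt := X.ρL_lt hu01 hw
  have hJQ := X.J_le_Q hu01 hw
  have hspec : 1 / (X.K : ℝ) ^ n ≤ X.ρL h k := nlev_spec X.hK (X.ρL_pos h k)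
  have hCa := X.Ca_pos
  have hκ := X.hκ0
  have hc := X.c_pos
  have hC1 := X.C1_ge
  have ha1 := X.a1_pos
  have hT0 : (0 : ℝ) < (2 : ℝ) ^ k := by positivity
  have hH0 : (0 : ℝ) < (2 : ℝ) ^ h := by positivity
  have hP0 : (0 : ℝ) < ((2 : ℝ) ^ h) ^ X.r := by positivity
  have hQ0 : (0 : ℝ) < ((2 : ℝ) ^ h) ^ X.s := by positivity
  have hT1 : (1 : ℝ) ≤ (2 : ℝ) ^ k := two_pow_ge k
  have hJ1 : 1 ≤ ((2 : ℝ) ^ k) ^ X.jj := Real.one_le_rpow hT1 X.hjj.le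
  by_cases hx : ∃ u1 ∈ kI X.K n m, ∃ A' B' C' : ℤ, X.WL h k A' B' C' u1 ∧
      (A * B' - A' * B ≠ 0 ∨ B * C' - B' * C ≠ 0 ∨ A' * C - A * C' ≠ 0)
  · right
    obtain ⟨u1, hu1I, A', B', C', hw', hcr⟩ := hx
    have core : ∀ u ∈ kI X.K n m, _ := fun u hu => by
      have hd0 := (kI_dist hu hu0I).trans hspec
      have hd1 := (kI_dist hu hu1I).trans hspec
      exact coreL hP0 hQ0 hT0 hJ1 (X.PQ h) hCa hκ X.n1 hw.2.1 hw'.2.1 hw.2.2.1 hw'.2.2.1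
        hw.2.2.2.2.1 hw'.2.2.2.2.1 hw.2.2.2.2.2 hw'.2.2.2.2.2 hd0 hd1
    set H := (2 : ℝ) ^ h with hH
    set T := (2 : ℝ) ^ k with hT
    have hq0 : A * B' - A' * B ≠ 0 := by
      intro hq
      obtain ⟨g1, g2, -⟩ := core u0 hu0I
      have hqr : (A : ℝ) * B' - A' * B = 0 := by exact_mod_cast hq
      rw [hqr, zero_mul, zero_sub, abs_neg] at g1 g2
      have hs1 : 4 * X.Ca * X.κ * T ^ X.jj / H ^ X.s < 1 := by
        rw [div_lt_one hQ0]
        calc 4 * X.Ca * X.κ * T ^ X.jj ≤ 4 * X.Ca * X.κ * (X.C2 * H ^ X.s) := by gcongr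
          _ = 4 * X.Ca * X.C2 * X.κ * H ^ X.s := by ring
          _ < 1 * H ^ X.s := by gcongr; exact X.n3
          _ = _ := one_mul _
      have hs2 : 4 * X.Ca * X.κ * T ^ X.jj / H ^ X.r < 1 := by
        refine lt_of_le_of_lt ?_ hs1
        gcongr
        · exact two_pow_ge h
        · exact X.hsr
      have i1 : B * C' - B' * C = 0 := by
        have : |((B * C' - B' * C : ℤ) : ℝ)| < 1 := by push_cast; linarith
        rw [← Int.cast_abs] at this
        exact Int.abs_lt_one_iff.1 (by exact_mod_cast this)
      have i2 : A' * C - A * C' = 0 := by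
        have : |((A' * C - A * C' : ℤ) : ℝ)| < 1 := by push_cast; linarith
        rw [← Int.cast_abs] at this
        exact Int.abs_lt_one_iff.1 (by exact_mod_cast this)
      tauto
    have hq1 : (1 : ℝ) ≤ |((A * B' - A' * B : ℤ) : ℝ)| := by
      rw [← Int.cast_abs]; exact_mod_cast Int.one_le_abs hq0
    obtain ⟨h', hh1, hh2⟩ := exists_two_pow hq1
    have hq2 : |((A * B' - A' * B : ℤ) : ℝ)| ≤ X.C1 * H / T := by
      have := (core u0 hu0I).2.2
      push_cast
      rw [← le_div_iff₀ ha1] at this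
      refine this.trans (le_of_eq ?_)
      rw [X.hC1]; ring
    have hh3 : (2 : ℝ) ^ h' ≤ X.C1 * H / T := hh1.trans hq2
    have hjs := X.hjs
    have hjj := X.hjj
    have hJr : T ^ X.jj ≤ T ^ X.r :=
      Real.rpow_le_rpow_of_exponent_le hT1 (by linarith [X.hsr])
    have hJs : T ^ X.jj ≤ T ^ X.s :=
      Real.rpow_le_rpow_of_exponent_le hT1 (by linarith)
    have hr := rpow_le_of_le hH0 hT0 (by linarith) X.r_pos.le X.r_lt.le hh3
    have hs := rpow_le_of_le hH0 hT0 (by linarith) X.hs.le (by linarith [X.hrs, X.r_pos]) hh3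
    refine ⟨h', ?_, ?_⟩
    · apply nlev_lt X.hK (X.ρL_pos h k) hlt
      unfold ρL ρP
      rw [← hH, ← hT, mul_div_assoc', div_le_div_iff₀ (by positivity) (by positivity)]
      have hh4 : (2 : ℝ) ^ h' * T ≤ X.C1 * H := by rwa [le_div_iff₀ hT0] at hh3
      have hJr' : ((2 : ℝ) ^ h') ^ X.r * T ^ X.jj ≤ X.C1 * H ^ X.r :=
        le_trans (by gcongr) hr
      calc X.K * (X.κ * (T * T ^ X.jj)) * ((2 : ℝ) ^ h' * ((2 : ℝ) ^ h') ^ X.r)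
          = X.K * X.κ * (((2 : ℝ) ^ h' * T) * (((2 : ℝ) ^ h') ^ X.r * T ^ X.jj)) := by ring
        _ ≤ X.K * X.κ * ((X.C1 * H) * (X.C1 * H ^ X.r)) := by gcongr
        _ = X.K * X.C1 ^ 2 * X.κ * (H * H ^ X.r) := by ring
        _ ≤ X.y * (H * H ^ X.r) := by gcongr; exact X.n5
    · intro u hu
      obtain ⟨g1, g2, -⟩ := core u hu
      refine X.mem_DP_of_int (A * B' - A' * B) (B * C' - B' * C) (A' * C - A * C') hh1 hh2 ?_ ?_
      · push_cast
        refine g1.trans ?_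
        rw [div_le_div_iff₀ hP0 (by positivity), ← X.hκ]
        have : ((2 : ℝ) ^ h') ^ X.r * T ^ X.jj ≤ X.C1 * H ^ X.r := le_trans (by gcongr) hr
        calc 4 * X.Ca * X.κ * T ^ X.jj * ((2 : ℝ) ^ h') ^ X.r
            = 4 * X.Ca * X.κ * (((2 : ℝ) ^ h') ^ X.r * T ^ X.jj) := by ring
          _ ≤ 4 * X.Ca * X.κ * (X.C1 * H ^ X.r) := by gcongr
          _ = _ := by ring
      · push_cast
        refine g2.trans ?_
        rw [div_le_div_iff₀ hQ0 (by positivity), ← X.hκ]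
        have : ((2 : ℝ) ^ h') ^ X.s * T ^ X.jj ≤ X.C1 * H ^ X.s := le_trans (by gcongr) hs
        calc 4 * X.Ca * X.κ * T ^ X.jj * ((2 : ℝ) ^ h') ^ X.s
            = 4 * X.Ca * X.κ * (((2 : ℝ) ^ h') ^ X.s * T ^ X.jj) := by ring
          _ ≤ 4 * X.Ca * X.κ * (X.C1 * H ^ X.s) := by gcongr
          _ = _ := by ring
  · left
    push Not at hx
    have hα0 : A * X.a1 + B * X.a2 ≠ 0 := by
      have := hw.2.2.2.1
      intro h0
      rw [h0, abs_zero] at this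
      have h2 : 0 < X.Ca * ((2 : ℝ) ^ h) ^ X.r / (2 * (2 : ℝ) ^ k) := by positivity
      linarith
    refine ⟨-(A * X.b1 + B * X.b2 + C) / (A * X.a1 + B * X.a2), ?_⟩
    rintro u ⟨⟨hu1, A', B', C', hw'⟩, huI⟩
    obtain ⟨i1, i2, i3⟩ := hx u huI A' B' C' hw'
    have hz := zero_of_prop (a1 := X.a1) (a2 := X.a2) (b1 := X.b1) (b2 := X.b2)
      (A := A) (B := B) (C := C) (A' := A') (B' := B') (C' := C')
      (by exact_mod_cast i1) (by exact_mod_cast i2) (by exact_mod_cast i3)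
    obtain ⟨-, -, -, w4, -, w6⟩ := hw'
    set α := (A : ℝ) * X.a1 + B * X.a2 with hα
    set α' := (A' : ℝ) * X.a1 + B' * X.a2 with hα'
    have hα'0 : 0 < |α'| := lt_trans (by positivity) w4
    have hα'ne : α' ≠ 0 := abs_pos.1 hα'0
    have e : A' * (X.a1 * u + X.b1) + B' * (X.a2 * u + X.b2) + (C' : ℝ) =
        α' * (u - -(A * X.b1 + B * X.b2 + C) / α) := by
      have : A' * X.b1 + B' * X.b2 + (C' : ℝ) = α' * (A * X.b1 + B * X.b2 + C) / α := by
        rw [eq_div_iff hα0]; linarith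
      have e2 : A' * (X.a1 * u + X.b1) + B' * (X.a2 * u + X.b2) + (C' : ℝ) =
        α' * u + (A' * X.b1 + B' * X.b2 + (C' : ℝ)) := by rw [hα']; ring
      rw [e2, this]; ring
    rw [e, abs_mul] at w6
    have h1 : |u - -(A * X.b1 + B * X.b2 + C) / α| ≤ X.c / (2 : ℝ) ^ h / |α'| := by
      rw [le_div_iff₀ hα'0]; linarith
    refine h1.trans ?_
    calc X.c / (2 : ℝ) ^ h / |α'| ≤ X.c / (2 : ℝ) ^ h /
          (X.Ca * ((2 : ℝ) ^ h) ^ X.r / (2 * (2 : ℝ) ^ k)) := by gcongr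
      _ = _ := by field_simp

end Par

namespace Par

variable (X : Par)

lemma int_zero_of_lt {n : ℤ} (h : |(n : ℝ)| < 1) : n = 0 := by
  rw [← Int.cast_abs] at h
  exact Int.abs_lt_one_iff.1 (by exact_mod_cast h)

lemma one_le_of_rpow {x e : ℝ} {n : ℤ} (hx : 0 ≤ x) (he : 0 < e) (hn : n ≠ 0)
    (h : |(n : ℝ)| ≤ x ^ e) : 1 ≤ x := by
  have h1 : (1 : ℝ) ≤ |(n : ℝ)| := by
    rw [← Int.cast_abs]; exact_mod_cast Int.one_le_abs hn
  by_contra hlt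
  push Not at hlt
  have := Real.rpow_lt_one hx hlt he
  linarith

lemma mul_rpow_le {a H e : ℝ} (ha : 0 ≤ a) (ha1 : a ≤ 1) (hH : 0 ≤ H) (he : e ≤ 1)
    (he0 : 0 < e) : a * H ^ e ≤ (a * H) ^ e := by
  rw [Real.mul_rpow ha hH]
  gcongr
  rcases ha.eq_or_lt with rfl | h0
  · rw [Real.zero_rpow he0.ne']
  · conv_lhs => rw [← Real.rpow_one a]
    exact Real.rpow_le_rpow_of_exponent_ge h0 ha1 he

lemma cover_pt {γ p u : ℝ} {h : ℕ} {q p1 q' p1' : ℤ} (hp : 0 < p)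
    (hq' : (2 : ℝ) ^ h ≤ q') (hx : |q' * (X.a1 * u + X.b1) - γ - p1'| ≤ p / ((2 : ℝ) ^ h) ^ X.r)
    (hq : (2 : ℝ) ^ h ≤ q) (he : (q : ℝ) * (p1' + γ) = (p1 + γ) * q') :
    |u - ((p1 + γ) / q - X.b1) / X.a1| ≤ p / (|X.a1| * ((2 : ℝ) ^ h * ((2 : ℝ) ^ h) ^ X.r)) := by
  have ha1 := X.a1_pos
  have hH0 : (0 : ℝ) < (2 : ℝ) ^ h := by positivity
  have hq0 : (0 : ℝ) < q := by linarith
  have hq0' : (0 : ℝ) < q' := by linarith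
  have hane := X.ha1
  have e : q' * (X.a1 * u + X.b1) - γ - p1' =
      q' * X.a1 * (u - ((p1 + γ) / q - X.b1) / X.a1) := by
    have : (p1 + γ) / q = (p1' + γ) / q' := by
      rw [div_eq_div_iff hq0.ne' hq0'.ne']; linarith
    rw [this]; field_simp; ring
  rw [e, abs_mul, abs_mul, abs_of_pos hq0'] at hx
  have h1 : |u - ((p1 + γ) / q - X.b1) / X.a1| ≤ p / ((2 : ℝ) ^ h) ^ X.r / (q' * |X.a1|) := by
    rw [le_div_iff₀ (by positivity)]; linarith
  refine h1.trans ?_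
  calc p / ((2 : ℝ) ^ h) ^ X.r / (q' * |X.a1|) ≤ p / ((2 : ℝ) ^ h) ^ X.r / ((2 : ℝ) ^ h * |X.a1|) := by
        gcongr
    _ = _ := by field_simp

lemma UP (h m : ℕ) (hm : m < X.K ^ nlev X.K (X.ρP X.y h)) :
    (∃ z, ∀ u ∈ X.DP 0 0 X.p h ∩ kI X.K (nlev X.K (X.ρP X.y h)) m,
      |u - z| ≤ X.p / (|X.a1| * ((2 : ℝ) ^ h * ((2 : ℝ) ^ h) ^ X.r))) ∨
    ∃ h' k', nlev X.K (X.ρL h' k') < nlev X.K (X.ρP X.y h) ∧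
      kI X.K (nlev X.K (X.ρP X.y h)) m ⊆ X.DL h' k' := by
  set n := nlev X.K (X.ρP X.y h) with hn
  have hKpos : 0 < X.K := by have := X.hK; omega
  by_cases hne : ∃ u0 ∈ X.DP 0 0 X.p h ∩ kI X.K n m, True
  swap
  · left
    exact ⟨0, fun u hu => absurd ⟨u, hu, trivial⟩ hne⟩
  obtain ⟨u0, ⟨⟨q, p1, p2, hw⟩, hu0I⟩, -⟩ := hne
  have hlt := X.ρP_lt X.hy X.n9 h
  have hspec : 1 / (X.K : ℝ) ^ n ≤ X.ρP X.y h := nlev_spec X.hK (X.ρP_pos X.hy h)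
  have hCa := X.Ca_pos
  have hκ := X.hκ0
  have hc := X.c_pos
  have hC4 := X.C4_ge
  have ha1 := X.a1_pos
  have hp := X.hp
  have hy := X.hy
  have hH0 : (0 : ℝ) < (2 : ℝ) ^ h := by positivity
  have hP0 : (0 : ℝ) < ((2 : ℝ) ^ h) ^ X.r := by positivity
  have hQ0 : (0 : ℝ) < ((2 : ℝ) ^ h) ^ X.s := by positivity
  by_cases hx : ∃ u1 ∈ kI X.K n m, ∃ q' p1' p2' : ℤ, X.WP 0 0 X.p h q' p1' p2' u1 ∧
      (p2 * q' - q * p2' ≠ 0 ∨ q * p1' - p1 * q' ≠ 0 ∨ p1 * p2' - p2 * p1' ≠ 0)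
  · right
    obtain ⟨u1, hu1I, q', p1', p2', hw', hcr⟩ := hx
    obtain ⟨w1, w2, w3, w4⟩ := hw
    obtain ⟨w1', w2', w3', w4'⟩ := hw'
    rw [sub_zero] at w3 w4 w3' w4'
    have core : ∀ u ∈ kI X.K n m, _ := fun u hu => by
      have hd0 := (kI_dist hu hu0I).trans hspec
      have hd1 := (kI_dist hu hu1I).trans hspec
      exact coreP hQ0 (X.QP h) (X.PQ h) X.ha1 hp hy X.n7 X.n6 X.hC3 X.hC4
        (hH0.le.trans w1) w2.le (hH0.le.trans w1') w2'.le w3 w4 w3' w4' hd0 hd1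
    set A : ℤ := p2 * q' - q * p2' with hA
    set B : ℤ := q * p1' - p1 * q' with hB
    set C : ℤ := p1 * p2' - p2 * p1' with hC
    have eA : (A : ℝ) = p2 * q' - q * p2' := by rw [hA]; push_cast; ring
    have eB : (B : ℝ) = q * p1' - p1 * q' := by rw [hB]; push_cast; ring
    have eC : (C : ℝ) = p1 * p2' - p2 * p1' := by rw [hC]; push_cast; ring
    rw [← eA, ← eB, ← eC] at core
    set H := (2 : ℝ) ^ h with hH
    have hH1 : 1 ≤ H := two_pow_ge h
    have hCy0 : 0 < X.C4 * X.y := by positivity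
    have hp1 : X.p < 1 := X.n7.trans_lt X.n9
    obtain ⟨cA, cB, cF, cα⟩ := core u0 hu0I
    have hAx : |(A : ℝ)| ≤ (X.C4 * X.y * H) ^ X.r :=
      cA.trans (mul_rpow_le hCy0.le X.n8 hH0.le X.r_lt.le X.r_pos)
    have hBx : |(B : ℝ)| ≤ (X.C4 * X.y * H) ^ X.s :=
      cB.trans (mul_rpow_le hCy0.le X.n8 hH0.le (by linarith [X.hrs, X.r_pos]) X.hs)
    have hAB : A ≠ 0 ∨ B ≠ 0 := by
      by_contra hcon
      push Not at hcon
      obtain ⟨hA0, hB0⟩ := hcon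
      rw [hA0, hB0] at cF
      have : C = 0 := by
        apply int_zero_of_lt
        simp only [Int.cast_zero, zero_mul, zero_add] at cF
        refine cF.trans_lt ?_
        rw [div_lt_one hH0]
        have := X.n8
        nlinarith
      tauto
    have hx0 : 0 ≤ X.C4 * X.y * H := by positivity
    have hx1 : 1 ≤ X.C4 * X.y * H := by
      rcases hAB with h0 | h0
      · exact one_le_of_rpow hx0 X.r_pos h0 hAx
      · exact one_le_of_rpow hx0 X.hs h0 hBx
    obtain ⟨h2, hh1, hh2⟩ := exists_two_pow hx1
    obtain ⟨H2, hH2⟩ : ∃ H2 : ℝ, H2 = (2 : ℝ) ^ (h2 + 1) := ⟨_, rfl⟩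
    have hl : X.C4 * X.y * H ≤ H2 := by rw [hH2, pow_succ']; exact hh2.le
    have hu2 : H2 ≤ 2 * (X.C4 * X.y * H) := by rw [hH2, pow_succ']; linarith
    have hH20 : 0 < H2 := by rw [hH2]; positivity
    have hA2 : |(A : ℝ)| ≤ H2 ^ X.r :=
      hAx.trans (Real.rpow_le_rpow hx0 hl X.r_pos.le)
    have hB2 : |(B : ℝ)| ≤ H2 ^ X.s :=
      hBx.trans (Real.rpow_le_rpow hx0 hl X.hs.le)
    have hF2 : ∀ u ∈ kI X.K n m,
        |A * (X.a1 * u + X.b1) + B * (X.a2 * u + X.b2) + C| ≤ X.c / H2 := by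
      intro u hu
      refine (core u hu).2.2.1.trans ?_
      rw [div_le_div_iff₀ hH0 hH20, X.hc]
      calc X.C4 * X.p * X.y * H2 ≤ X.C4 * X.p * X.y * (2 * (X.C4 * X.y * H)) := by gcongr
        _ = _ := by ring
    have hdl : 0 < |A * X.a1 + B * X.a2| := by
      have hd := X.dio_lower (h := h2 + 1) (kI_unit hKpos hm hu0I) hAB (by rw [← hH2]; exact hA2)
        (by rw [← hH2]; exact hB2) (by rw [← hH2]; exact hF2 u0 hu0I)
      rw [← hH2] at hd
      have hc0 := X.hc0
      have h3 : 0 < |A * X.a1 + B * X.a2| * H2 := lt_of_lt_of_le (by positivity) hd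
      exact pos_of_mul_pos_left h3 hH20.le
    have hup : |A * X.a1 + B * X.a2| ≤ X.Ca * H2 ^ X.r := by
      refine (abs_add_le _ _).trans ?_
      rw [abs_mul, abs_mul, X.hCa]
      have hQP : H2 ^ X.s ≤ H2 ^ X.r := by rw [hH2]; exact X.QP (h2 + 1)
      have g1 : |(A : ℝ)| * |X.a1| ≤ H2 ^ X.r * |X.a1| := by gcongr
      have g2 : |(B : ℝ)| * |X.a2| ≤ H2 ^ X.r * |X.a2| := by gcongr; exact hB2.trans hQP
      linarith
    obtain ⟨k, hk1, hk2⟩ := exists_two_pow ((one_le_div hdl).2 hup)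
    have hP2 : 0 < H2 ^ X.r := by positivity
    have hT0 : (0 : ℝ) < (2 : ℝ) ^ k := by positivity
    have hT1 : (1 : ℝ) ≤ (2 : ℝ) ^ k := two_pow_ge k
    have hJ1 : 1 ≤ ((2 : ℝ) ^ k) ^ X.jj := Real.one_le_rpow hT1 X.hjj.le
    refine ⟨h2 + 1, k, ?_, ?_⟩
    · apply nlev_lt X.hK (X.ρP_pos X.hy h) hlt
      unfold ρL ρP
      rw [← hH, ← hH2, mul_div_assoc', div_le_div_iff₀ (by positivity) (by positivity)]
      rw [div_lt_iff₀ hdl] at hk2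
      have g1 : X.Ca * H2 ^ X.r ≤ 2 * (2 : ℝ) ^ k * (X.C4 * X.p * H ^ X.r) :=
        hk2.le.trans (by gcongr)
      have g2 : X.K * X.y * (H2 * H2 ^ X.r) * X.Ca ≤
          X.κ * (2 : ℝ) ^ k * (H * H ^ X.r) * X.Ca := by
        calc X.K * X.y * (H2 * H2 ^ X.r) * X.Ca = X.K * X.y * (H2 * (X.Ca * H2 ^ X.r)) := by ring
          _ ≤ X.K * X.y * ((2 * (X.C4 * X.y * H)) * (2 * (2 : ℝ) ^ k * (X.C4 * X.p * H ^ X.r))) := by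
            gcongr
          _ = (4 * X.K * X.C4 ^ 2 * X.p * X.y ^ 2) * (2 : ℝ) ^ k * (H * H ^ X.r) := by ring
          _ ≤ (X.κ * X.Ca) * (2 : ℝ) ^ k * (H * H ^ X.r) :=
            mul_le_mul_of_nonneg_right (mul_le_mul_of_nonneg_right X.n10 hT0.le) (by positivity)
          _ = _ := by ring
      have g3 := le_of_mul_le_mul_right g2 hCa
      refine g3.trans ?_
      have g4 : (2 : ℝ) ^ k ≤ (2 : ℝ) ^ k * ((2 : ℝ) ^ k) ^ X.jj := le_mul_of_one_le_right hT0.le hJ1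
      gcongr
    · intro u hu
      refine ⟨kI_unit hKpos hm hu, A, B, C, hAB, ?_, ?_, ?_, ?_, ?_⟩
      · rw [← hH2]; exact hA2
      · rw [← hH2]; exact hB2
      · rw [← hH2, div_lt_iff₀ (by positivity)]
        rw [div_lt_iff₀ hdl] at hk2; linarith
      · rw [← hH2, le_div_iff₀ hT0]
        rw [le_div_iff₀ hdl] at hk1; linarith
      · rw [← hH2]; exact hF2 u hu
  · left
    push Not at hx
    refine ⟨((p1 + 0) / q - X.b1) / X.a1, ?_⟩
    rintro u ⟨⟨q', p1', p2', hw'⟩, huI⟩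
    obtain ⟨-, i2, -⟩ := hx u huI q' p1' p2' hw'
    refine X.cover_pt hp hw'.1 hw'.2.2.1 hw.1 ?_
    have : (q : ℝ) * p1' - p1 * q' = 0 := by exact_mod_cast i2
    linarith

lemma UT (γ δ : ℝ) (h m : ℕ) :
    (∃ z, ∀ u ∈ X.DP γ δ X.p' h ∩ kI X.K (nlev X.K (X.ρP X.y' h)) m,
      |u - z| ≤ X.p' / (|X.a1| * ((2 : ℝ) ^ h * ((2 : ℝ) ^ h) ^ X.r))) ∨
    ∃ h', nlev X.K (X.ρP X.y h') < nlev X.K (X.ρP X.y' h) ∧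
      kI X.K (nlev X.K (X.ρP X.y' h)) m ⊆ X.DP 0 0 X.p h' := by
  set n := nlev X.K (X.ρP X.y' h) with hn
  by_cases hne : ∃ u0 ∈ X.DP γ δ X.p' h ∩ kI X.K n m, True
  swap
  · left
    exact ⟨0, fun u hu => absurd ⟨u, hu, trivial⟩ hne⟩
  obtain ⟨u0, ⟨⟨q, p1, p2, hw⟩, hu0I⟩, -⟩ := hne
  have hK := X.K_ge
  have hy' := X.hy'
  have hy1' : X.y' < 1 := by
    have := X.n12
    have := X.n9
    nlinarith
  have hlt := X.ρP_lt X.hy' hy1' h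
  have hspec : 1 / (X.K : ℝ) ^ n ≤ X.ρP X.y' h := nlev_spec X.hK (X.ρP_pos X.hy' h)
  have hCa := X.Ca_pos
  have ha1 := X.a1_pos
  have hp := X.hp
  have hp' := X.hp'
  have hy := X.hy
  have hH0 : (0 : ℝ) < (2 : ℝ) ^ h := by positivity
  have hP0 : (0 : ℝ) < ((2 : ℝ) ^ h) ^ X.r := by positivity
  have hQ0 : (0 : ℝ) < ((2 : ℝ) ^ h) ^ X.s := by positivity
  have hP1 := X.P_ge h
  have hp1 : X.p < 1 := X.n7.trans_lt X.n9
  have hn11 := X.n11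
  have hCa1 : |X.a1| ≤ X.Ca := by rw [X.hCa]; linarith [abs_nonneg X.a2]
  have hCa2 : |X.a2| ≤ X.Ca := by rw [X.hCa]; linarith [abs_nonneg X.a1]
  -- bound of a solution along the interval
  have key : ∀ (a b γ x0 u R : ℝ) (q p1 : ℤ), |a| ≤ X.Ca → 0 < R → R ≤ ((2 : ℝ) ^ h) ^ X.r →
      (2 : ℝ) ^ h ≤ q → (q : ℝ) < 2 * (2 : ℝ) ^ h → |u - x0| ≤ X.ρP X.y' h →
      |q * (a * x0 + b) - γ - p1| ≤ X.p' / R →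
      |q * (a * u + b) - γ - p1| ≤ (X.p' + 2 * X.Ca * X.y') / R := by
    intro a b γ x0 u R q p1 ha hR hRP hq1 hq2 hd hb
    have e : q * (a * u + b) - γ - p1 = (q * (a * x0 + b) - γ - p1) + q * a * (u - x0) := by ring
    rw [e]
    refine (abs_add_le _ _).trans ?_
    rw [abs_mul, abs_mul, abs_of_nonneg (hH0.le.trans hq1)]
    have g1 : q * |a| * |u - x0| ≤ (2 * (2 : ℝ) ^ h) * X.Ca * (X.y' / ((2 : ℝ) ^ h * R)) := by
      gcongr
      refine hd.trans ?_
      unfold ρP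
      gcongr
    have g2 : (2 * (2 : ℝ) ^ h) * X.Ca * (X.y' / ((2 : ℝ) ^ h * R)) = 2 * X.Ca * X.y' / R := by
      field_simp
    have g3 : (X.p' + 2 * X.Ca * X.y') / R = X.p' / R + 2 * X.Ca * X.y' / R := by ring
    linarith
  by_cases hx : ∃ u1 ∈ kI X.K n m, ∃ q' p1' p2' : ℤ, X.WP γ δ X.p' h q' p1' p2' u1 ∧ q' ≠ q
  · right
    obtain ⟨u1, hu1I, q', p1', p2', hw', hqq⟩ := hx
    obtain ⟨w1, w2, w3, w4⟩ := hw
    obtain ⟨w1', w2', w3', w4'⟩ := hw'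
    have hq1 : (1 : ℝ) ≤ |((q - q' : ℤ) : ℝ)| := by
      rw [← Int.cast_abs]; exact_mod_cast Int.one_le_abs (sub_ne_zero.2 (Ne.symm hqq))
    have hq2 : |((q - q' : ℤ) : ℝ)| ≤ (2 : ℝ) ^ h := by
      push_cast
      rw [abs_le]; constructor <;> linarith
    obtain ⟨h', hh1, hh2⟩ := exists_two_pow hq1
    have hh3 : (2 : ℝ) ^ h' ≤ (2 : ℝ) ^ h := hh1.trans hq2
    have hr : ((2 : ℝ) ^ h') ^ X.r ≤ ((2 : ℝ) ^ h) ^ X.r :=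
      Real.rpow_le_rpow (by positivity) hh3 X.r_pos.le
    have hs : ((2 : ℝ) ^ h') ^ X.s ≤ ((2 : ℝ) ^ h) ^ X.s :=
      Real.rpow_le_rpow (by positivity) hh3 X.hs.le
    refine ⟨h', ?_, ?_⟩
    · apply nlev_lt X.hK (X.ρP_pos X.hy' h) hlt
      unfold ρP
      rw [mul_div_assoc']
      gcongr
      exact X.n12
    · intro u hu
      have hd0 := (kI_dist hu hu0I).trans hspec
      have hd1 := (kI_dist hu hu1I).trans hspec
      have fin : ∀ a b R γ x y R' : ℝ, 0 < R' → R' ≤ R →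
          |x| ≤ (X.p' + 2 * X.Ca * X.y') / R →
          |y| ≤ (X.p' + 2 * X.Ca * X.y') / R → |x - y| ≤ X.p / R' := by
        intro a b R γ x y R' hR' hRR hx hy
        refine (abs_sub _ _).trans ?_
        have g1 : X.p / R ≤ X.p / R' := by gcongr
        have g2 : 2 * (X.p' + 2 * X.Ca * X.y') / R ≤ X.p / R := by
          have : 0 < R := by linarith
          gcongr
        have g3 : 2 * (X.p' + 2 * X.Ca * X.y') / R =
          (X.p' + 2 * X.Ca * X.y') / R + (X.p' + 2 * X.Ca * X.y') / R := by ring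
        linarith
      refine X.mem_DP_of_int (q - q') (p1 - p1') (p2 - p2') hh1 hh2 ?_ ?_
      · have f := fin 0 0 _ 0 _ _ _ (by positivity) hr
          (key _ _ _ _ _ _ _ _ hCa1 hP0 le_rfl w1 w2 hd0 w3)
          (key _ _ _ _ _ _ _ _ hCa1 hP0 le_rfl w1' w2' hd1 w3')
        convert f using 2; push_cast; ring
      · have f := fin 0 0 _ 0 _ _ _ (by positivity) hs
          (key _ _ _ _ _ _ _ _ hCa2 hQ0 (X.QP h) w1 w2 hd0 w4)
          (key _ _ _ _ _ _ _ _ hCa2 hQ0 (X.QP h) w1' w2' hd1 w4')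
        convert f using 2; push_cast; ring
  · left
    push Not at hx
    refine ⟨((p1 + γ) / q - X.b1) / X.a1, ?_⟩
    rintro u ⟨⟨q', p1', p2', hw'⟩, huI⟩
    have hqq : q' = q := hx u huI q' p1' p2' hw'
    subst hqq
    refine X.cover_pt hp' hw'.1 hw'.2.2.1 hw.1 ?_
    have hd0 := (kI_dist huI hu0I).trans hspec
    have f := key _ _ _ _ _ _ _ _ hCa1 hP0 le_rfl hw.1 hw.2.1 hd0 hw.2.2.1
    have f' := hw'.2.2.1
    have hpp : p1' = p1 := by
      apply sub_eq_zero.1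
      apply int_zero_of_lt
      have e : ((p1' - p1 : ℤ) : ℝ) = (q' * (X.a1 * u + X.b1) - γ - p1) -
        (q' * (X.a1 * u + X.b1) - γ - p1') := by push_cast; ring
      rw [e]
      refine lt_of_le_of_lt (abs_sub _ _) ?_
      have g1 : X.p' / ((2 : ℝ) ^ h) ^ X.r ≤ X.p' := div_le_self hp'.le hP1
      have h0 : 0 ≤ X.Ca * X.y' := by positivity
      have g2 : (X.p' + 2 * X.Ca * X.y') / ((2 : ℝ) ^ h) ^ X.r ≤ X.p' + 2 * X.Ca * X.y' :=
        div_le_self (by linarith) hP1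
      linarith
    rw [hpp]; ring

end Par

namespace Par

variable (X : Par)

lemma rad_conv {K n : ℕ} {ρ w2 R : ℝ} (hK : 2 ≤ K) (hn : n = nlev K ρ) (hρ1 : ρ ≤ 1)
    (hw : 0 ≤ w2) (h : R * K ≤ w2 * ρ) : R ≤ w2 / (K : ℝ) ^ n := by
  have hK0 : (0 : ℝ) < K := by exact_mod_cast (by omega : 0 < K)
  have h1 : ρ ≤ K / (K : ℝ) ^ n := by rw [hn]; exact nlev_upper hK hρ1
  have h2 : R * K ≤ w2 / (K : ℝ) ^ n * K := by
    calc R * K ≤ w2 * ρ := h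
      _ ≤ w2 * (K / (K : ℝ) ^ n) := by gcongr
      _ = _ := by ring
  exact le_of_mul_le_mul_right h2 hK0

lemma final_bad {r s x y γ δ p : ℝ} (hr : 0 < r) (hs : 0 < s) (hp : 0 < p)
    (h : ∀ (h : ℕ) (q p1 p2 : ℤ), (2 : ℝ) ^ h ≤ q → (q : ℝ) < 2 * (2 : ℝ) ^ h →
      |q * x - γ - p1| ≤ p / ((2 : ℝ) ^ h) ^ r → |q * y - δ - p2| ≤ p / ((2 : ℝ) ^ h) ^ s → False) :
    (x, y) ∈ badPair r s (γ, δ) := by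
  refine ⟨min (p ^ (1 / r)) (p ^ (1 / s)), by positivity, fun q hq => ?_⟩
  have hq1 : (1 : ℝ) ≤ q := by exact_mod_cast hq
  have hq0 : (0 : ℝ) < q := by linarith
  obtain ⟨h', hh1, hh2⟩ := exists_two_pow hq1
  have hH : (0 : ℝ) < (2 : ℝ) ^ h' := by positivity
  have key : ∀ (e t : ℝ), 0 < e → p / ((2 : ℝ) ^ h') ^ e < t →
      min (p ^ (1 / r)) (p ^ (1 / s)) ≤ p ^ (1 / e) →
      min (p ^ (1 / r)) (p ^ (1 / s)) / q < t ^ (1 / e) := by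
    intro e t he ht hm
    have h1 : (p / ((2 : ℝ) ^ h') ^ e) ^ (1 / e) < t ^ (1 / e) :=
      Real.rpow_lt_rpow (by positivity) ht (by positivity)
    have h2 : (p / ((2 : ℝ) ^ h') ^ e) ^ (1 / e) = p ^ (1 / e) / (2 : ℝ) ^ h' := by
      rw [Real.div_rpow hp.le (by positivity), ← Real.rpow_mul hH.le, mul_one_div_cancel he.ne',
        Real.rpow_one]
    refine lt_of_le_of_lt ?_ h1
    rw [h2]
    gcongr
  rw [lt_max_iff]
  by_contra hcon
  push Not at hcon
  refine h h' q (round ((q : ℝ) * x - γ)) (round ((q : ℝ) * y - δ)) (by exact_mod_cast hh1)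
    (by exact_mod_cast hh2) ?_ ?_
  · by_contra hlt
    push Not at hlt
    have := key r _ hr hlt (min_le_left _ _)
    exact absurd hcon.1 (not_le.2 (by simpa [distNearestInt] using this))
  · by_contra hlt
    push Not at hlt
    have := key s _ hs hlt (min_le_right _ _)
    exact absurd hcon.2 (not_le.2 (by simpa [distNearestInt] using this))

lemma ρP_dec {y : ℝ} (hy : 0 < y) (h : ℕ) : X.ρP y (h + 1) ≤ X.ρP y h / 2 := by
  unfold ρP
  have h1 : ((2 : ℝ) ^ h) ^ X.r ≤ ((2 : ℝ) ^ (h + 1)) ^ X.r :=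
    Real.rpow_le_rpow (by positivity) (pow_le_pow_right₀ (by norm_num) (by omega)) X.r_pos.le
  rw [div_div]
  refine div_le_div_of_nonneg_left hy.le (by positivity) ?_
  have h2 : (2 : ℝ) ^ (h + 1) = 2 ^ h * 2 := pow_succ _ _
  calc (2 : ℝ) ^ h * ((2 : ℝ) ^ h) ^ X.r * 2 = 2 ^ (h + 1) * ((2 : ℝ) ^ h) ^ X.r := by rw [h2]; ring
    _ ≤ _ := by gcongr

lemma ρL_eq (h k : ℕ) : X.ρL h k = X.ρP (X.κ * ((2 : ℝ) ^ k * ((2 : ℝ) ^ k) ^ X.jj)) h := rfl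

lemma pot (γ δ0 δ wL w gg : ℝ) (hgg : gg = (2 : ℝ) ^ (X.jj / 2)) (hwL : 0 < wL) (hw : 0 < w)
    (h1 : 2 * X.c * X.K ≤ wL ^ 2 * (X.Ca * X.κ)) (h2 : X.K * wL * (1 - gg⁻¹)⁻¹ ≤ δ / 3)
    (h3 : X.K * X.p ≤ w ^ 2 * (|X.a1| * X.y)) (h4 : X.K * X.p' ≤ w ^ 2 * (|X.a1| * X.y'))
    (h5 : X.K * w ≤ δ / 3) :
    Pot X.K δ {u | (X.a1 * u + X.b1, X.a2 * u + X.b2) ∈ badPair X.r X.s (γ, δ0)} := by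
  have hgg1 : 1 < gg := by
    rw [hgg]; exact Real.one_lt_rpow (by norm_num) (by linarith [X.hjj])
  have hgg0 : 0 < gg := by linarith
  have hJ : ∀ k : ℕ, ((2 : ℝ) ^ k) ^ X.jj = (gg ^ k) ^ 2 := by
    intro k
    have e2 : gg ^ 2 = (2 : ℝ) ^ X.jj := by
      rw [hgg, ← Real.rpow_mul_natCast (by norm_num)]; congr 1; push_cast; ring
    rw [← Real.rpow_pow_comm (by norm_num), ← e2, ← pow_mul, ← pow_mul, mul_comm]
  have hK0 : (0 : ℝ) < X.K := by linarith [X.K_ge]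
  have hy1' : X.y' < 1 := by
    have := X.n12
    have := X.n9
    have := X.K_ge
    have := X.hy'
    nlinarith
  have hgi0 : 0 < gg⁻¹ := by positivity
  have hgi1 : gg⁻¹ < 1 := inv_lt_one_of_one_lt₀ hgg1
  have hκ := X.hκ0
  have hCa := X.Ca_pos
  have hc := X.c_pos
  have ha1 := X.a1_pos
  have hδ : 0 ≤ δ / 3 := le_trans (by positivity) h5
  refine ⟨(ℕ × ℕ) ⊕ (ℕ ⊕ ℕ),
    Sum.elim (fun g => nlev X.K (X.ρL g.1 g.2))
      (Sum.elim (fun h => nlev X.K (X.ρP X.y h)) (fun h => nlev X.K (X.ρP X.y' h))),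
    Sum.elim (fun g => X.DL g.1 g.2)
      (Sum.elim (fun h => X.DP 0 0 X.p h) (fun h => X.DP γ δ0 X.p' h)),
    Sum.elim (fun g => if X.ρL g.1 g.2 ≤ 1 then wL * gg⁻¹ ^ g.2 else 0)
      (Sum.elim (fun h => if X.ρP X.y h ≤ 1 then w else 0)
        (fun h => if X.ρP X.y' h ≤ 1 then w else 0)), ?_, ?_, ?_, ?_, ?_⟩
  · rintro (g | h | h) <;> simp only [Sum.elim_inl, Sum.elim_inr] <;> split_ifs <;> positivity
  · rintro (⟨h, k⟩ | h | h) hne <;> simp only [Sum.elim_inl, Sum.elim_inr] at hne ⊢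
    · obtain ⟨u, hu, A, B, C, hw⟩ := hne
      rw [if_pos (X.ρL_lt hu hw).le]; positivity
    · rw [if_pos (X.ρP_lt X.hy X.n9 h).le]; exact hw
    · rw [if_pos (X.ρP_lt X.hy' hy1' h).le]; exact hw
  · intro n
    rw [Summable.tsum_sum ENNReal.summable ENNReal.summable,
      Summable.tsum_sum ENNReal.summable ENNReal.summable]
    simp only [Sum.elim_inl, Sum.elim_inr]
    have e : ENNReal.ofReal δ = ENNReal.ofReal (δ / 3) +
        (ENNReal.ofReal (δ / 3) + ENNReal.ofReal (δ / 3)) := by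
      rw [← ENNReal.ofReal_add hδ hδ, ← ENNReal.ofReal_add hδ (by linarith)]
      congr 1; ring
    rw [e]
    gcongr
    · rw [ENNReal.tsum_prod', ENNReal.tsum_comm]
      calc _ ≤ ∑' k : ℕ, ENNReal.ofReal (X.K * (wL * gg⁻¹ ^ k)) := by
            refine ENNReal.tsum_le_tsum fun k => ?_
            exact lev_sum X.hK (fun h => X.ρL h k) (fun h => X.ρL_pos h k)
              (fun h => X.ρP_dec (by positivity) h) _ n
        _ = ENNReal.ofReal (∑' k : ℕ, X.K * wL * gg⁻¹ ^ k) := by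
            rw [ENNReal.ofReal_tsum_of_nonneg (fun k => by positivity)
              ((summable_geometric_of_lt_one hgi0.le hgi1).mul_left _)]
            simp only [mul_assoc]
        _ ≤ _ := by
            apply ENNReal.ofReal_le_ofReal
            rw [tsum_mul_left, tsum_geometric_of_lt_one hgi0.le hgi1]
            exact h2
    · exact (lev_sum X.hK (fun h => X.ρP X.y h) (fun h => X.ρP_pos X.hy h)
        (fun h => X.ρP_dec X.hy h) _ n).trans (ENNReal.ofReal_le_ofReal h5)
    · exact (lev_sum X.hK (fun h => X.ρP X.y' h) (fun h => X.ρP_pos X.hy' h)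
        (fun h => X.ρP_dec X.hy' h) _ n).trans (ENNReal.ofReal_le_ofReal h5)
  · rintro (⟨h, k⟩ | h | h) m hm <;> simp only [Sum.elim_inl, Sum.elim_inr] at hm ⊢
    · rcases X.UL h k m with ⟨z, hz⟩ | ⟨h', hh1, hh2⟩
      · left
        refine ⟨z, fun u hu => (hz u hu).trans ?_⟩
        obtain ⟨⟨hu1, A, B, C, hw⟩, -⟩ := hu
        have hlt := X.ρL_lt hu1 hw
        rw [if_pos hlt.le]
        refine rad_conv X.hK rfl hlt.le (by positivity) ?_
        unfold ρL
        rw [hJ k]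
        have hg : gg⁻¹ ^ k * gg ^ k = 1 := by rw [← mul_pow, inv_mul_cancel₀ hgg0.ne', one_pow]
        have e1 : (wL * gg⁻¹ ^ k) ^ 2 * (X.κ * ((2 : ℝ) ^ k * (gg ^ k) ^ 2) /
            ((2 : ℝ) ^ h * ((2 : ℝ) ^ h) ^ X.r)) =
            (gg⁻¹ ^ k * gg ^ k) ^ 2 * (wL ^ 2 * X.κ * (2 : ℝ) ^ k / ((2 : ℝ) ^ h * ((2 : ℝ) ^ h) ^ X.r)) := by
          ring
        rw [e1, hg, one_pow, one_mul, div_mul_eq_mul_div, div_le_div_iff₀ (by positivity) (by positivity)]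
        calc 2 * X.c * (2 : ℝ) ^ k * X.K * ((2 : ℝ) ^ h * ((2 : ℝ) ^ h) ^ X.r)
            = 2 * X.c * X.K * ((2 : ℝ) ^ k * ((2 : ℝ) ^ h * ((2 : ℝ) ^ h) ^ X.r)) := by ring
          _ ≤ wL ^ 2 * (X.Ca * X.κ) * ((2 : ℝ) ^ k * ((2 : ℝ) ^ h * ((2 : ℝ) ^ h) ^ X.r)) :=
            mul_le_mul_of_nonneg_right h1 (by positivity)
          _ = _ := by ring
      · right
        exact ⟨Sum.inr (Sum.inl h'), hh1, hh2⟩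
    · rcases X.UP h m hm with ⟨z, hz⟩ | ⟨h', k', hh1, hh2⟩
      · left
        refine ⟨z, fun u hu => (hz u hu).trans ?_⟩
        have hlt := X.ρP_lt X.hy X.n9 h
        rw [if_pos hlt.le]
        refine rad_conv X.hK rfl hlt.le (by positivity) ?_
        unfold ρP
        rw [mul_div_assoc', div_mul_eq_mul_div, div_le_div_iff₀ (by positivity) (by positivity)]
        calc X.p * X.K * ((2 : ℝ) ^ h * ((2 : ℝ) ^ h) ^ X.r)
            = X.K * X.p * ((2 : ℝ) ^ h * ((2 : ℝ) ^ h) ^ X.r) := by ring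
          _ ≤ w ^ 2 * (|X.a1| * X.y) * ((2 : ℝ) ^ h * ((2 : ℝ) ^ h) ^ X.r) :=
            mul_le_mul_of_nonneg_right h3 (by positivity)
          _ = _ := by ring
      · right
        exact ⟨Sum.inl (h', k'), hh1, hh2⟩
    · rcases X.UT γ δ0 h m with ⟨z, hz⟩ | ⟨h', hh1, hh2⟩
      · left
        refine ⟨z, fun u hu => (hz u hu).trans ?_⟩
        have hlt := X.ρP_lt X.hy' hy1' h
        rw [if_pos hlt.le]
        refine rad_conv X.hK rfl hlt.le (by positivity) ?_
        unfold ρP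
        rw [mul_div_assoc', div_mul_eq_mul_div, div_le_div_iff₀ (by positivity) (by positivity)]
        calc X.p' * X.K * ((2 : ℝ) ^ h * ((2 : ℝ) ^ h) ^ X.r)
            = X.K * X.p' * ((2 : ℝ) ^ h * ((2 : ℝ) ^ h) ^ X.r) := by ring
          _ ≤ w ^ 2 * (|X.a1| * X.y') * ((2 : ℝ) ^ h * ((2 : ℝ) ^ h) ^ X.r) :=
            mul_le_mul_of_nonneg_right h4 (by positivity)
          _ = _ := by ring
      · right
        exact ⟨Sum.inr (Sum.inl h'), hh1, hh2⟩
  · intro u hu hD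
    refine final_bad X.r_pos X.hs X.hp' ?_
    intro h q p1 p2 g1 g2 g3 g4
    exact hD (Sum.inr (Sum.inr h)) ⟨q, p1, p2, g1, g2, g3, g4⟩

end Par

lemma ev_small {f : ℝ → ℝ} (hf : Continuous f) (h0 : f 0 = 0) {c : ℝ} (hc : 0 < c) :
    ∀ᶠ z in nhdsWithin (0 : ℝ) (Ioi 0), f z < c := by
  have h1 : Tendsto f (nhds 0) (nhds 0) := by
    have := hf.tendsto 0
    rwa [h0] at this
  exact (h1.eventually_lt_const hc).filter_mono nhdsWithin_le_nhds

set_option maxHeartbeats 4000000 in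
theorem single_pot (K : ℕ) (hK : 2 ≤ K) (δ : ℝ) (hδ : 0 < δ) (a1 b1 a2 b2 r s ε c0 γ δ0 : ℝ)
    (ha1 : a1 ≠ 0) (hs : 0 < s) (hsr : s ≤ r) (hrs : r + s = 1) (hε : 0 < ε) (hc0 : 0 < c0)
    (dio : ∀ (h : ℕ) (A B C : ℤ), (A ≠ 0 ∨ B ≠ 0) → |(A : ℝ)| ≤ ((2 : ℝ) ^ h) ^ r →
      |(B : ℝ)| ≤ ((2 : ℝ) ^ h) ^ s →
      c0 * ((2 : ℝ) ^ h) ^ ε ≤ max |A * a1 + B * a2| |A * b1 + B * b2 + C| * (2 : ℝ) ^ h) :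
    Pot K δ {u | (a1 * u + b1, a2 * u + b2) ∈ badPair r s (γ, δ0)} := by
  have ha : 0 < |a1| := abs_pos.2 ha1
  obtain ⟨Ca, hCa⟩ : ∃ x, x = |a1| + |a2| := ⟨_, rfl⟩
  obtain ⟨C1, hC1⟩ : ∃ x, x = 2 * Ca / |a1| := ⟨_, rfl⟩
  obtain ⟨C2, hC2⟩ : ∃ x, x = max 1 (2 * Ca / c0) := ⟨_, rfl⟩
  obtain ⟨C3, hC3⟩ : ∃ x, x = 1 + |a2 / a1| := ⟨_, rfl⟩
  obtain ⟨C4, hC4⟩ : ∃ x, x = 4 * C3 + 12 * |a2| + 12 * |a1| + 6 * |a1| * C3 := ⟨_, rfl⟩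
  obtain ⟨jj, hjj⟩ : ∃ x, x = min s ε / 2 := ⟨_, rfl⟩
  obtain ⟨gg, hgg⟩ : ∃ x, x = (2 : ℝ) ^ (jj / 2) := ⟨_, rfl⟩
  have hCa0 : 0 < Ca := by rw [hCa]; positivity
  have hC10 : 0 < C1 := by rw [hC1]; positivity
  have hC21 : 1 ≤ C2 := by rw [hC2]; exact le_max_left _ _
  have hC22 : 2 * Ca / c0 ≤ C2 := by rw [hC2]; exact le_max_right _ _
  have hjj0 : 0 < jj := by rw [hjj]; have := lt_min hs hε; linarith
  have hjs : 2 * jj ≤ s := by rw [hjj]; linarith [min_le_left s ε]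
  have hje : 2 * jj ≤ ε := by rw [hjj]; linarith [min_le_right s ε]
  have hgg1 : 1 < gg := by
    rw [hgg]; exact Real.one_lt_rpow (by norm_num) (by linarith)
  have hgi1 : gg⁻¹ < 1 := inv_lt_one_of_one_lt₀ hgg1
  have hg1 : 0 < 1 - gg⁻¹ := by linarith
  have hK0 : (0 : ℝ) < K := by exact_mod_cast (by omega : 0 < K)
  obtain ⟨w, hw⟩ : ∃ x, x = δ / 3 / K := ⟨_, rfl⟩
  obtain ⟨wL, hwL⟩ : ∃ x, x = δ / 3 / K * (1 - gg⁻¹) := ⟨_, rfl⟩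
  have hw0 : 0 < w := by rw [hw]; positivity
  have hwL0 : 0 < wL := by rw [hwL]; positivity
  have E := ((((((((((((((eventually_mem_nhdsWithin (s := Ioi (0 : ℝ)) (a := 0)).and
    (ev_small (f := fun z => 8 * C1 * C4 ^ 2 * z ^ 4) (by fun_prop) (by simp) one_pos)).and
    (ev_small (f := fun z => 4 * C4 ^ 2 * z ^ 7) (by fun_prop) (by simp) hc0)).and
    (ev_small (f := fun z => C2 * z ^ 3) (by fun_prop) (by simp) hC10)).and
    (ev_small (f := fun z => C2 ^ 2 * z ^ 3) (by fun_prop) (by simp)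
      (show 0 < 4 * Ca * C1 by positivity))).and
    (ev_small (f := fun z => K * C1 * z) (by fun_prop) (by simp) (show 0 < 4 * Ca by positivity))).and
    (ev_small (f := fun z => z) (by fun_prop) (by simp) ha)).and
    (ev_small (f := fun z => z) (by fun_prop) (by simp) one_pos)).and
    (ev_small (f := fun z => C4 * z ^ 2) (by fun_prop) (by simp) one_pos)).and
    (ev_small (f := fun z => 16 * K * C1 * C4 ^ 2 * z ^ 4) (by fun_prop) (by simp) one_pos)).and
    (ev_small (f := fun z => 2 * z ^ 2 + 4 * Ca * z) (by fun_prop) (by simp) one_pos)).and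
    (ev_small (f := fun z => K * z ^ 2) (by fun_prop) (by simp) one_pos)).and
    (ev_small (f := fun z => 16 * K * C1 * C4 ^ 2 * z ^ 4) (by fun_prop) (by simp)
      (show 0 < wL ^ 2 by positivity))).and
    (ev_small (f := fun z => K * z) (by fun_prop) (by simp)
      (show 0 < w ^ 2 * |a1| by positivity)))
  obtain ⟨z, ⟨⟨⟨⟨⟨⟨⟨⟨⟨⟨⟨⟨⟨hz, e1⟩, e2⟩, e3⟩, e4⟩, e5⟩, e6⟩, e7⟩, e8⟩, e10⟩, e11⟩, e12⟩, f1⟩, f2⟩⟩ :=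
    E.exists
  have hz0 : 0 < z := hz
  obtain ⟨κ, hκ⟩ : ∃ x, x = z ^ 3 / (4 * Ca * C1) := ⟨_, rfl⟩
  have hκ0 : 0 < κ := by rw [hκ]; positivity
  have hκ1 : κ * (4 * Ca * C1) = z ^ 3 := by rw [hκ]; field_simp
  have hCκ : Ca * κ = z ^ 3 / (4 * C1) := by rw [hκ]; field_simp
  have hz3 : 0 < z ^ 3 := by positivity
  let X : Par :=
    { K := K, a1 := a1, b1 := b1, a2 := a2, b2 := b2, r := r, s := s, ε := ε, c0 := c0
      C1 := C1, C2 := C2, C3 := C3, C4 := C4, Ca := Ca, κ := κ, c := 2 * C4 ^ 2 * z ^ 3 * (z ^ 2) ^ 2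
      p := z ^ 3, y := z ^ 2, p' := z ^ 5, y' := z ^ 4, jj := jj
      hK := hK, ha1 := ha1, hs := hs, hsr := hsr, hrs := hrs, hε := hε, hc0 := hc0, hCa := hCa
      hC1 := hC1, hC2 := hC21, hC2' := hC22, hC3 := hC3, hC4 := hC4, hjj := hjj0, hjs := hjs
      hjε := hje, hp := by positivity, hy := by positivity, hp' := by positivity
      hy' := by positivity, hκ0 := hκ0, hκ := hκ1, hc := rfl
      n1 := by
        rw [hCκ, le_div_iff₀ (by positivity)]
        nlinarith
      n2 := by
        have : 2 * C4 ^ 2 * z ^ 3 * (z ^ 2) ^ 2 = 4 * C4 ^ 2 * z ^ 7 / 2 := by ring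
        linarith
      n3 := by
        have : 4 * Ca * C2 * κ = C2 * z ^ 3 / C1 := by rw [hκ]; field_simp
        rw [this, div_lt_one hC10]; exact e3
      n4 := by
        rw [hκ, div_mul_eq_mul_div, div_lt_one (by positivity)]; linarith
      n5 := by
        have : K * C1 ^ 2 * κ = K * C1 * z * z ^ 2 / (4 * Ca) := by rw [hκ]; field_simp
        rw [this, div_le_iff₀ (by positivity)]
        have : 0 < z ^ 2 := by positivity
        nlinarith
      n6 := by
        have : 0 < z ^ 2 := by positivity
        nlinarith
      n7 := by
        have : 0 < z ^ 2 := by positivity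
        nlinarith
      n8 := e8.le
      n9 := by nlinarith
      n10 := by
        rw [mul_comm κ, hCκ, le_div_iff₀ (by positivity)]
        nlinarith
      n11 := by nlinarith
      n12 := by
        have : 0 < z ^ 2 := by positivity
        nlinarith
      dio := dio }
  refine X.pot γ δ0 δ wL w gg hgg hwL0 hw0 ?_ ?_ ?_ ?_ ?_
  · change 2 * (2 * C4 ^ 2 * z ^ 3 * (z ^ 2) ^ 2) * K ≤ wL ^ 2 * (Ca * κ)
    rw [hCκ, mul_div_assoc', le_div_iff₀ (by positivity)]
    nlinarith
  · change K * wL * (1 - gg⁻¹)⁻¹ ≤ δ / 3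
    apply le_of_eq
    rw [hwL, ← mul_assoc, mul_inv_cancel_right₀ hg1.ne']; field_simp
  · change K * z ^ 3 ≤ w ^ 2 * (|a1| * z ^ 2)
    have : 0 < z ^ 2 := by positivity
    nlinarith
  · change K * z ^ 5 ≤ w ^ 2 * (|a1| * z ^ 4)
    have : 0 < z ^ 4 := by positivity
    nlinarith
  · change K * w ≤ δ / 3
    apply le_of_eq
    rw [hw]; field_simp

lemma dni_le (t : ℝ) (n : ℤ) : distNearestInt t ≤ |t + n| := by
  unfold distNearestInt
  have := round_le t (-n)
  simpa using this

lemma dni_nonneg (t : ℝ) : 0 ≤ distNearestInt t := abs_nonneg _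

lemma dni_neg_mul (q : ℤ) (x : ℝ) (n : ℤ) :
    distNearestInt ((q.natAbs : ℕ) * x) ≤ |(q : ℝ) * x + n| := by
  rcases le_total 0 q with h | h
  · have : ((q.natAbs : ℕ) : ℝ) = q := by
      rw [Nat.cast_natAbs, abs_of_nonneg h]
    rw [this]; exact dni_le _ _
  · have : ((q.natAbs : ℕ) : ℝ) = -q := by
      rw [Nat.cast_natAbs, abs_of_nonpos h]; push_cast; rfl
    rw [this]
    have h2 := dni_le (-(q : ℝ) * x) (-n)
    rw [← abs_neg]
    convert h2 using 2
    push_cast; ring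

/-- uniform lower bound from an eventual one -/
lemma dio_uniform (a b e : ℝ)
    (h : 0 < Filter.atTop.liminf (fun q : ℕ =>
        ENNReal.ofReal ((q : ℝ) ^ e *
          max (distNearestInt ((q : ℝ) * a)) (distNearestInt ((q : ℝ) * b))))) :
    ∃ c : ℝ, 0 < c ∧ ∀ q : ℕ, 0 < q →
      c ≤ (q : ℝ) ^ e * max (distNearestInt ((q : ℝ) * a)) (distNearestInt ((q : ℝ) * b)) := by
  set f : ℕ → ℝ := fun q => (q : ℝ) ^ e *
          max (distNearestInt ((q : ℝ) * a)) (distNearestInt ((q : ℝ) * b)) with hf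
  obtain ⟨c, hc0, hc1⟩ := exists_between h
  have hev := eventually_lt_of_lt_liminf hc1
  obtain ⟨N, hN⟩ := eventually_atTop.1 hev
  have hctop : c ≠ ⊤ := ne_top_of_lt hc1
  have hcr : 0 < c.toReal := ENNReal.toReal_pos hc0.ne' hctop
  have hN' : ∀ q, N ≤ q → c.toReal < f q := by
    intro q hq
    have := hN q hq
    rw [← ENNReal.ofReal_toReal hctop] at this
    exact (ENNReal.ofReal_lt_ofReal_iff_of_nonneg hcr.le).1 this
  have hpos : ∀ q, 0 < q → 0 < f q := by
    intro q hq
    have hqr : (0 : ℝ) < q := by exact_mod_cast hq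
    have hm : 0 ≤ max (distNearestInt ((q : ℝ) * a)) (distNearestInt ((q : ℝ) * b)) :=
      le_max_of_le_left (dni_nonneg _)
    rcases hm.lt_or_eq with hm | hm
    · exact mul_pos (Real.rpow_pos_of_pos hqr _) hm
    · exfalso
      have ha0 : distNearestInt ((q : ℝ) * a) = 0 :=
        le_antisymm ((le_max_left _ _).trans hm.symm.le) (dni_nonneg _)
      have hb0 : distNearestInt ((q : ℝ) * b) = 0 :=
        le_antisymm ((le_max_right _ _).trans hm.symm.le) (dni_nonneg _)
      have key : ∀ x : ℝ, distNearestInt ((q : ℝ) * x) = 0 →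
          distNearestInt (((N + 1) * q : ℕ) * x) = 0 := by
        intro x hx
        unfold distNearestInt at hx
        have hx := sub_eq_zero.1 (abs_eq_zero.1 hx)
        have := dni_le (((N + 1) * q : ℕ) * x) (-((N + 1) * round ((q : ℝ) * x)))
        refine le_antisymm (this.trans ?_) (dni_nonneg _)
        apply le_of_eq
        rw [abs_eq_zero]
        push_cast
        rw [← hx]; ring
      have h1 := hN' ((N + 1) * q) (by nlinarith)
      simp only [hf] at h1
      rw [key a ha0, key b hb0] at h1
      simp at h1
      linarith
  have hfin : ∀ M : ℕ, ∃ c' : ℝ, 0 < c' ∧ ∀ q, 0 < q → q < M → c' ≤ f q := by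
    intro M
    induction M with
    | zero => exact ⟨1, one_pos, fun q _ h => by omega⟩
    | succ M ih =>
      obtain ⟨c', h1, h2⟩ := ih
      rcases Nat.eq_zero_or_pos M with hM | hM
      · exact ⟨1, one_pos, fun q _ h => by omega⟩
      · refine ⟨min c' (f M), lt_min h1 (hpos M hM), fun q hq hqM => ?_⟩
        rcases Nat.lt_succ_iff_lt_or_eq.1 hqM with h | h
        · exact (min_le_left _ _).trans (h2 q hq h)
        · rw [h]; exact min_le_right _ _
  obtain ⟨c', h1, h2⟩ := hfin N
  refine ⟨min c' c.toReal, lt_min h1 hcr, fun q hq => ?_⟩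
  rcases lt_or_ge q N with h | h
  · exact (min_le_left _ _).trans (h2 q hq h)
  · exact (min_le_right _ _).trans (hN' q h).le

/-- the numeric core: a bound for `max` at `q ≤ M * H ^ s` -/
lemma dio_scale (s η c M m H : ℝ) (q : ℕ) (hs : 0 < s) (hη : η ≤ 1 / s) (hc : 0 < c)
    (hM : 1 ≤ M) (hH : 1 ≤ H) (hq : 0 < q) (hqH : (q : ℝ) ≤ M * H ^ s)
    (h : c ≤ (q : ℝ) ^ (1 / s - η) * m) (hm : 0 ≤ m) :
    c * M ^ (-(1 / s - η)) * H ^ (s * η) ≤ m * H := by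
  have hM0 : 0 < M := by linarith
  have hH0 : 0 < H := by linarith
  have he : 0 ≤ 1 / s - η := by linarith
  have h1 : (q : ℝ) ^ (1 / s - η) ≤ M ^ (1 / s - η) * H ^ (1 - s * η) := by
    refine (Real.rpow_le_rpow (by positivity) hqH he).trans (le_of_eq ?_)
    rw [Real.mul_rpow hM0.le (by positivity), ← Real.rpow_mul hH0.le]
    congr 2
    field_simp
  have h2 : c ≤ M ^ (1 / s - η) * H ^ (1 - s * η) * m :=
    h.trans (mul_le_mul_of_nonneg_right h1 hm)
  rw [Real.rpow_neg hM0.le]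
  rw [Real.rpow_sub hH0, Real.rpow_one] at h2
  have p1 : 0 < M ^ (1 / s - η) := by positivity
  have p2 : 0 < H ^ (s * η) := by positivity
  rw [mul_div_assoc', div_mul_eq_mul_div, le_div_iff₀ p2] at h2
  rw [← div_eq_mul_inv, div_mul_eq_mul_div, div_le_iff₀ p1]
  linarith

lemma badPair_swap (i j : ℝ) (θ p : ℝ × ℝ) :
    (p.2, p.1) ∈ badPair j i (θ.2, θ.1) ↔ p ∈ badPair i j θ := by
  simp only [badPair, mem_setOf_eq]
  simp only [max_comm]

lemma pow_le_self' (H s η : ℝ) (hs : 0 < s) (hη : η ≤ 1 / s) (hH : 1 ≤ H) :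
    H ^ (s * η) ≤ H := by
  have : s * η ≤ 1 := by
    rw [le_div_iff₀ hs] at hη; linarith
  calc H ^ (s * η) ≤ H ^ (1 : ℝ) := Real.rpow_le_rpow_of_exponent_le hH this
    _ = H := Real.rpow_one H

lemma pot_one (K : ℕ) (hK : 2 ≤ K) (δ : ℝ) (hδ : 0 < δ) (i j a b η c : ℝ) (θ : ℝ × ℝ)
    (hi : 0 < i) (hj : 0 < j) (hij : i + j = 1) (ha : a ≠ 0) (hη0 : 0 < η)
    (hη : η ≤ 1 / min i j) (hc : 0 < c)
    (h : ∀ q : ℕ, 0 < q → c ≤ (q : ℝ) ^ (1 / min i j - η) *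
      max (distNearestInt ((q : ℝ) * a)) (distNearestInt ((q : ℝ) * b))) :
    Pot K δ {u | (u, a * u + b) ∈ badPair i j θ} := by
  rcases le_total j i with hji | hji
  · rw [min_eq_right hji] at h hη
    have := single_pot K hK δ hδ 1 0 a b i j (j * η) (min c 1) θ.1 θ.2 one_ne_zero hj hji hij
      (by positivity) (by positivity) ?_
    · simpa using this
    intro n A B C hAB hA hB
    have hH : (1 : ℝ) ≤ 2 ^ n := one_le_pow₀ (by norm_num)
    set H : ℝ := 2 ^ n
    have hH0 : 0 < H := by linarith
    have hp := pow_le_self' H j η hj hη hH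
    by_cases hB0 : B = 0
    · subst hB0
      have hA0 : A ≠ 0 := by simpa using hAB
      have h1 : (1 : ℝ) ≤ |(A : ℝ)| := by exact_mod_cast Int.one_le_abs hA0
      have h2 : (1 : ℝ) ≤ max |A * 1 + ((0 : ℤ) : ℝ) * a| |A * 0 + ((0 : ℤ) : ℝ) * b + C| := by
        refine le_max_of_le_left ?_
        simpa using h1
      calc min c 1 * H ^ (j * η) ≤ 1 * H := by
            gcongr
            exact min_le_right _ _
        _ ≤ _ := by gcongr
    · have hq : 0 < B.natAbs := Int.natAbs_pos.2 hB0
      have hcast : ((B.natAbs : ℕ) : ℝ) = |(B : ℝ)| := by rw [Nat.cast_natAbs]; push_cast; rfl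
      have hm : max (distNearestInt ((B.natAbs : ℕ) * a)) (distNearestInt ((B.natAbs : ℕ) * b)) ≤
          max |(A : ℝ) * 1 + B * a| |(A : ℝ) * 0 + B * b + C| := by
        apply max_le_max
        · refine (dni_neg_mul B a A).trans_eq (congrArg abs ?_); ring
        · refine (dni_neg_mul B b C).trans_eq (congrArg abs ?_); ring
      have := dio_scale j η c 1 _ H B.natAbs hj hη hc le_rfl hH hq (by rw [hcast, one_mul]; exact hB)
        (h _ hq) (le_max_of_le_left (dni_nonneg _))
      rw [Real.one_rpow, mul_one] at this
      calc min c 1 * H ^ (j * η) ≤ c * H ^ (j * η) := by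
            gcongr
            exact min_le_left _ _
        _ ≤ _ := this
        _ ≤ _ := by gcongr
  · rw [min_eq_left hji] at h hη
    set M : ℝ := max 1 (2 / |a|) with hM
    have hM1 : 1 ≤ M := le_max_left _ _
    set d : ℝ := c * M ^ (-(1 / i - η)) with hd
    have hd0 : 0 < d := by positivity
    have := single_pot K hK δ hδ a b 1 0 j i (i * η) (min d 1) θ.2 θ.1 ha hi hji (by linarith)
      (by positivity) (by positivity) ?_
    · have e : {u : ℝ | (u, a * u + b) ∈ badPair i j θ} =
          {u | (a * u + b, 1 * u + 0) ∈ badPair j i (θ.2, θ.1)} := by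
        ext u
        rw [mem_setOf_eq, mem_setOf_eq, ← badPair_swap]
        simp
      rw [e]; exact this
    intro n A B C hAB hA hB
    have hH : (1 : ℝ) ≤ 2 ^ n := one_le_pow₀ (by norm_num)
    set H : ℝ := 2 ^ n
    have hH0 : 0 < H := by linarith
    have hp := pow_le_self' H i η hi hη hH
    by_cases h1 : (1 : ℝ) ≤ |A * a + B * 1|
    · have h2 : (1 : ℝ) ≤ max |A * a + B * 1| |A * b + B * 0 + C| := le_max_of_le_left h1
      calc min d 1 * H ^ (i * η) ≤ 1 * H := by
            gcongr
            exact min_le_right _ _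
        _ ≤ _ := by gcongr
    · push Not at h1
      have hA0 : A ≠ 0 := by
        rintro rfl
        have hB0 : B ≠ 0 := by simpa using hAB
        have h3 : (1 : ℝ) ≤ |(B : ℝ)| := by exact_mod_cast Int.one_le_abs hB0
        simp at h1
        linarith
      have hq : 0 < A.natAbs := Int.natAbs_pos.2 hA0
      have hcast : ((A.natAbs : ℕ) : ℝ) = |(A : ℝ)| := by rw [Nat.cast_natAbs]; push_cast; rfl
      have hm : max (distNearestInt ((A.natAbs : ℕ) * a)) (distNearestInt ((A.natAbs : ℕ) * b)) ≤
          max |(A : ℝ) * a + B * 1| |(A : ℝ) * b + B * 0 + C| := by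
        apply max_le_max
        · refine (dni_neg_mul A a B).trans_eq (congrArg abs ?_); ring
        · refine (dni_neg_mul A b C).trans_eq (congrArg abs ?_); ring
      have hHi : 1 ≤ H ^ i := Real.one_le_rpow hH hi.le
      have ha0 : 0 < |a| := abs_pos.2 ha
      have hAa : |(A : ℝ)| * |a| ≤ 2 * H ^ i := by
        rw [← abs_mul]
        have e : (A : ℝ) * a = (A * a + B * 1) - B := by ring
        rw [e]
        have := abs_sub (A * a + B * 1 : ℝ) B
        linarith
      have hAM : ((A.natAbs : ℕ) : ℝ) ≤ M * H ^ i := by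
        rw [hcast]
        calc |(A : ℝ)| ≤ 2 / |a| * H ^ i := by
              rw [div_mul_eq_mul_div, le_div_iff₀ ha0]; exact hAa
          _ ≤ M * H ^ i := by
              gcongr
              exact le_max_right _ _
      have := dio_scale i η c M _ H A.natAbs hi hη hc hM1 hH hq hAM
        (h _ hq) (le_max_of_le_left (dni_nonneg _))
      calc min d 1 * H ^ (i * η) ≤ d * H ^ (i * η) := by
            gcongr
            exact min_le_left _ _
        _ ≤ _ := this
        _ ≤ _ := by gcongr

lemma dim_limit {S : Set ℝ}
    (h : ∀ B : ℕ, 144 ≤ B → ENNReal.ofReal (Real.log B / Real.log (4 * B)) ≤ dimH S) :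
    1 ≤ dimH S := by
  have t1 : Tendsto (fun B : ℕ => Real.log (B : ℝ)) atTop atTop :=
    Real.tendsto_log_atTop.comp tendsto_natCast_atTop_atTop
  have t2 : Tendsto (fun B : ℕ => (1 + Real.log 4 / Real.log (B : ℝ))⁻¹) atTop (nhds 1) := by
    have := (t1.const_div_atTop (Real.log 4)).const_add 1
    have := this.inv₀ (by norm_num)
    simpa using this
  have t3 : Tendsto (fun B : ℕ => ENNReal.ofReal (Real.log B / Real.log (4 * B))) atTop
      (nhds 1) := by
    rw [← ENNReal.ofReal_one]
    refine (ENNReal.tendsto_ofReal t2).congr' ?_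
    filter_upwards [eventually_ge_atTop 144] with B hB
    have hB' : (144 : ℝ) ≤ B := by exact_mod_cast hB
    have hl : 0 < Real.log B := Real.log_pos (by linarith)
    have hl4 : 0 < Real.log 4 := Real.log_pos (by norm_num)
    rw [Real.log_mul (by norm_num) (by linarith)]
    congr 1
    field_simp
    ring
  refine le_of_tendsto t3 ?_
  filter_upwards [eventually_ge_atTop 144] with B hB using h B hB

theorem stmt4 (i j : ℕ → ℝ) (θ : ℕ → ℝ × ℝ) (a b : ℝ)
    (hi0 : ∀ t, 0 < i t) (hi1 : ∀ t, i t < 1)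
    (hj0 : ∀ t, 0 < j t) (hj1 : ∀ t, j t < 1)
    (hij : ∀ t, i t + j t = 1)
    (ha : a ≠ 0)
    (hdio : ∃ ε : ℝ, 0 < ε ∧
      0 < Filter.atTop.liminf (fun q : ℕ =>
        ENNReal.ofReal ((q : ℝ) ^ (1 / (⨆ t : ℕ, min (i t) (j t)) - ε) *
          max (distNearestInt ((q : ℝ) * a)) (distNearestInt ((q : ℝ) * b))))) :
    dimH (⋂ t : ℕ, (badPair (i t) (j t) (θ t) ∩
      {p : ℝ × ℝ | ∃ x : ℝ, p = (x, a * x + b)})) = 1 := by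
  obtain ⟨ε, hε, hlim⟩ := hdio
  obtain ⟨c, hc, hq⟩ := dio_uniform a b _ hlim
  have hbdd : BddAbove (range fun t => min (i t) (j t)) := by
    refine ⟨1, ?_⟩
    rintro _ ⟨t, rfl⟩
    exact (min_le_left _ _).trans (hi1 t).le
  have hle : ∀ t, min (i t) (j t) ≤ ⨆ t : ℕ, min (i t) (j t) := fun t => le_ciSup hbdd t
  have hpos : ∀ t, 0 < min (i t) (j t) := fun t => lt_min (hi0 t) (hj0 t)
  set S : ℕ → Set ℝ := fun t => {u | (u, a * u + b) ∈ badPair (i t) (j t) (θ t)} with hS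
  have hpot : ∀ t (K : ℕ), 2 ≤ K → ∀ δ : ℝ, 0 < δ → Pot K δ (S t) := by
    intro t K hK δ hδ
    have h1 : (1 : ℝ) ≤ 1 / min (i t) (j t) := by
      rw [le_div_iff₀ (hpos t), one_mul]
      exact (min_le_left _ _).trans (hi1 t).le
    refine pot_one K hK δ hδ (i t) (j t) a b (min ε 1) c (θ t) (hi0 t) (hj0 t) (hij t) ha
      (by positivity) ((min_le_right _ _).trans h1) hc ?_
    intro q hq0
    refine (hq q hq0).trans ?_
    refine mul_le_mul_of_nonneg_right ?_ (le_max_of_le_left (dni_nonneg _))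
    refine Real.rpow_le_rpow_of_exponent_le (by exact_mod_cast hq0) ?_
    exact sub_le_sub (one_div_le_one_div_of_le (hpos t) (hle t)) (min_le_left _ _)
  have hdimS : 1 ≤ dimH (⋂ t, S t) := by
    refine dim_limit fun B hB => pot_dim hB ?_
    have hB0 : (0 : ℝ) < ((4 * B : ℕ) : ℝ) := by
      have : 0 < 4 * B := by omega
      exact_mod_cast this
    set δ : ℝ := 1 / (8 * √((4 * B : ℕ) : ℝ)) / 2 with hδ
    have hδ0 : 0 < δ := by positivity
    refine Pot.iInter (fun t => δ / 2 / 2 ^ t) ?_ fun t => hpot t _ (by omega) _ (by positivity)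
    rw [← ENNReal.ofReal_tsum_of_nonneg (fun t => by positivity) (summable_geometric_two' δ),
      tsum_geometric_two' δ]
  apply le_antisymm
  · have hsub : (⋂ t : ℕ, (badPair (i t) (j t) (θ t) ∩
      {p : ℝ × ℝ | ∃ x : ℝ, p = (x, a * x + b)})) ⊆ (fun x : ℝ => (x, a * x + b)) '' univ := by
      intro p hp
      obtain ⟨x, hx⟩ := (mem_iInter.1 hp 0).2
      exact ⟨x, mem_univ _, hx.symm⟩
    refine (dimH_mono hsub).trans ?_
    have hlip : LipschitzWith (max 1 ‖a‖₊) (fun x : ℝ => (x, a * x + b)) := by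
      refine LipschitzWith.prodMk LipschitzWith.id ?_
      refine LipschitzWith.of_dist_le_mul fun x y => ?_
      rw [Real.dist_eq, Real.dist_eq, coe_nnnorm, Real.norm_eq_abs, ← abs_mul]
      apply le_of_eq
      congr 1; ring
    refine (hlip.dimH_image_le univ).trans ?_
    rw [Real.dimH_univ]
  · refine hdimS.trans ?_
    have hsub : (⋂ t, S t) ⊆ Prod.fst '' (⋂ t : ℕ, (badPair (i t) (j t) (θ t) ∩
        {p : ℝ × ℝ | ∃ x : ℝ, p = (x, a * x + b)})) := by
      intro u hu
      refine ⟨(u, a * u + b), ?_, rfl⟩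
      rw [mem_iInter] at hu ⊢
      exact fun t => ⟨hu t, u, rfl⟩
    exact (dimH_mono hsub).trans (LipschitzWith.prod_fst.dimH_image_le _)
end

section
/- Let i and j be real numbers with 0 < i, j < 1 and i + j = 1, and let θ ∈ ℝ². Then the Hausdorff dimension of Bad_θ(i,j) equals 2. -/
open Filter Set

section CantorPart
open MeasureTheory
open scoped ENNReal NNReal

/-- The rectangle of level `n` with lower left corner `z`. -/
def rct (ρ X Y : ℝ) (n : ℕ) (z : ℝ × ℝ) : Set (ℝ × ℝ) :=
  {p | z.1 ≤ p.1 ∧ p.1 ≤ z.1 + ρ / X ^ n ∧ z.2 ≤ p.2 ∧ p.2 ≤ z.2 + ρ / Y ^ n}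

/-- Lower left corner of a child. -/
noncomputable def chd (ρ X Y : ℝ) (n : ℕ) (z : ℝ × ℝ) (ab : ℕ × ℕ) : ℝ × ℝ :=
  (z.1 + ab.1 * (ρ / X ^ (n + 1)), z.2 + ab.2 * (ρ / Y ^ (n + 1)))

/-- Corners along an address. -/
noncomputable def cor (ρ X Y : ℝ) {N : ℕ} (sel : ℕ → ℝ × ℝ → Fin N → ℕ × ℕ) (z0 : ℝ × ℝ) :
    ℕ → (ℕ → Fin N) → ℝ × ℝ
  | 0, _ => z0
  | n + 1, ω => chd ρ X Y n (cor ρ X Y sel z0 n ω) (sel n (cor ρ X Y sel z0 n ω) (ω n))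

lemma width_step {ρ X : ℝ} (hρ : 0 < ρ) (hX : 1 < X) {M : ℕ} (hM : (M : ℝ) ≤ X) (n a : ℕ)
    (ha : a < M) : (a + 1 : ℝ) * (ρ / X ^ (n + 1)) ≤ ρ / X ^ n := by
  have hX0 : 0 < X := by linarith
  have h1 : (a + 1 : ℝ) ≤ X := le_trans (by exact_mod_cast ha) hM
  calc (a + 1 : ℝ) * (ρ / X ^ (n + 1)) ≤ X * (ρ / X ^ (n + 1)) := by gcongr
    _ = ρ / X ^ n := by rw [pow_succ]; field_simp

lemma rct_chd_subset {ρ X Y : ℝ} (hρ : 0 < ρ) (hX : 1 < X) (hY : 1 < Y) {M1 M2 : ℕ}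
    (hM1 : (M1 : ℝ) ≤ X) (hM2 : (M2 : ℝ) ≤ Y) (n : ℕ) (z : ℝ × ℝ) (ab : ℕ × ℕ)
    (h1 : ab.1 < M1) (h2 : ab.2 < M2) :
    rct ρ X Y (n + 1) (chd ρ X Y n z ab) ⊆ rct ρ X Y n z := by
  rintro p ⟨a1, a2, a3, a4⟩
  simp only [chd] at a1 a2 a3 a4
  have e1 := width_step hρ hX hM1 n ab.1 h1
  have e2 := width_step hρ hY hM2 n ab.2 h2
  have e3 : 0 ≤ (ab.1 : ℝ) * (ρ / X ^ (n + 1)) := by positivity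
  have e4 : 0 ≤ (ab.2 : ℝ) * (ρ / Y ^ (n + 1)) := by
    have : 0 < Y := by linarith
    positivity
  refine ⟨by linarith, by linarith, by linarith, by linarith⟩

lemma cor_congr {ρ X Y : ℝ} {N : ℕ} (sel : ℕ → ℝ × ℝ → Fin N → ℕ × ℕ) (z0 : ℝ × ℝ)
    (m : ℕ) (ω ω' : ℕ → Fin N) (h : ∀ k < m, ω k = ω' k) :
    cor ρ X Y sel z0 m ω = cor ρ X Y sel z0 m ω' := by
  induction m with
  | zero => rfl
  | succ m ih =>
    simp only [cor]
    rw [ih (fun k hk => h k (by omega)), h m (by omega)]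

lemma sep_aux {w v : ℝ} (hw : 0 < w) {M : ℕ} (x x' : ℝ) (a a' : ℕ) (ha : a < M) (ha' : a' < M)
    (hMw : M * w ≤ v) (h : v ≤ |x - x'|) : w ≤ |(x + a * w) - (x' + a' * w)| := by
  have h1 : (a + 1 : ℝ) ≤ M := by exact_mod_cast ha
  have h2 : (a' + 1 : ℝ) ≤ M := by exact_mod_cast ha'
  have h3 : (a + 1 : ℝ) * w ≤ M * w := by gcongr
  have h4 : (a' + 1 : ℝ) * w ≤ M * w := by gcongr
  have h5 : 0 ≤ (a : ℝ) * w := by positivity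
  have h6 : 0 ≤ (a' : ℝ) * w := by positivity
  rcases le_abs.1 h with h | h
  · apply le_abs.2; left; linarith
  · apply le_abs.2; right; linarith

lemma sep_same {w : ℝ} (hw : 0 < w) (x : ℝ) (a a' : ℕ) (h : a ≠ a') :
    w ≤ |(x + a * w) - (x + a' * w)| := by
  have : (x + a * w) - (x + a' * w) = ((a : ℤ) - (a' : ℤ) : ℤ) * w := by push_cast; ring
  rw [this, abs_mul, abs_of_pos hw]
  have h1 : (1 : ℝ) ≤ |(((a : ℤ) - (a' : ℤ) : ℤ) : ℝ)| := by
    rw [← Int.cast_abs]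
    have hz : (a : ℤ) - (a' : ℤ) ≠ 0 := by
      rw [sub_ne_zero]; exact_mod_cast h
    have h3 : ((1 : ℤ) : ℝ) ≤ ((|(a : ℤ) - (a' : ℤ)| : ℤ) : ℝ) := Int.cast_le.2 (Int.one_le_abs hz)
    simpa only [Int.cast_one] using h3
  nlinarith

/-- Numerical counting bound for separated points. -/
lemma count_sep {ι : Type*} (V : Finset ι) (f : ι → ℝ × ℝ) (w h r : ℝ) (hw : 0 < w) (hh : 0 < h)
    (hwr : w ≤ r) (hhr : h ≤ r) (c : ℝ × ℝ)
    (hb : ∀ v ∈ V, c.1 - r - w ≤ (f v).1 ∧ (f v).1 ≤ c.1 + r ∧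
      c.2 - r - h ≤ (f v).2 ∧ (f v).2 ≤ c.2 + r)
    (hs : ∀ v ∈ V, ∀ v' ∈ V, v ≠ v' → w ≤ |(f v).1 - (f v').1| ∨ h ≤ |(f v).2 - (f v').2|) :
    (V.card : ℝ) ≤ 16 * r ^ 2 / (w * h) := by
  set g : ι → ℕ × ℕ := fun v =>
    (⌊((f v).1 - c.1 + r + w) / w⌋₊, ⌊((f v).2 - c.2 + r + h) / h⌋₊) with hg
  have key : ∀ (w : ℝ), 0 < w → ∀ a b : ℝ, 0 ≤ a / w → 0 ≤ b / w →
      ⌊a / w⌋₊ = ⌊b / w⌋₊ → |a - b| < w := by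
    intro w hw a b ha hb hab
    have h1 := Nat.floor_le ha
    have h2 := Nat.floor_le hb
    have h3 := Nat.lt_floor_add_one (a / w)
    have h4 := Nat.lt_floor_add_one (b / w)
    rw [hab] at h1 h3
    have h5 : |a / w - b / w| < 1 := by rw [abs_lt]; constructor <;> linarith
    rw [← sub_div, abs_div, abs_of_pos hw, div_lt_one hw] at h5
    exact h5
  have hcard : V.card ≤ ((Finset.range (⌊(2 * r + w) / w⌋₊ + 1)) ×ˢ
      (Finset.range (⌊(2 * r + h) / h⌋₊ + 1))).card := by
    apply Finset.card_le_card_of_injOn g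
    · intro v hv
      obtain ⟨b1, b2, b3, b4⟩ := hb v hv
      simp only [hg, Finset.coe_product, Set.mem_prod, Finset.coe_range, Set.mem_Iio,
        Nat.lt_add_one_iff]
      constructor
      · apply Nat.floor_le_floor
        gcongr
        linarith
      · apply Nat.floor_le_floor
        gcongr
        linarith
    · intro v hv v' hv' hvv
      by_contra hne
      simp only [hg, Prod.mk.injEq] at hvv
      obtain ⟨b1, b2, b3, b4⟩ := hb v hv
      obtain ⟨c1, c2, c3, c4⟩ := hb v' hv'
      have k1 := key w hw _ _ (div_nonneg (by linarith) hw.le) (div_nonneg (by linarith) hw.le) hvv.1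
      have k2 := key h hh _ _ (div_nonneg (by linarith) hh.le) (div_nonneg (by linarith) hh.le) hvv.2
      rcases hs v hv v' hv' hne with hh1 | hh1
      · rw [show (f v).1 - c.1 + r + w - ((f v').1 - c.1 + r + w) =
          (f v).1 - (f v').1 by ring] at k1
        linarith
      · rw [show (f v).2 - c.2 + r + h - ((f v').2 - c.2 + r + h) =
          (f v).2 - (f v').2 by ring] at k2
        linarith
  rw [Finset.card_product, Finset.card_range, Finset.card_range] at hcard
  have hr : 0 < r := by linarith
  have a1 : ((⌊(2 * r + w) / w⌋₊ + 1 : ℕ) : ℝ) ≤ 4 * r / w := by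
    push_cast
    have := Nat.floor_le (show 0 ≤ (2 * r + w) / w by positivity)
    have e : (2 * r + w) / w + 1 ≤ 4 * r / w := by
      rw [div_add_one hw.ne']; gcongr; linarith
    linarith
  have a2 : ((⌊(2 * r + h) / h⌋₊ + 1 : ℕ) : ℝ) ≤ 4 * r / h := by
    push_cast
    have := Nat.floor_le (show 0 ≤ (2 * r + h) / h by positivity)
    have e : (2 * r + h) / h + 1 ≤ 4 * r / h := by
      rw [div_add_one hh.ne']; gcongr; linarith
    linarith
  calc (V.card : ℝ) ≤ ((⌊(2 * r + w) / w⌋₊ + 1 : ℕ) : ℝ) * ((⌊(2 * r + h) / h⌋₊ + 1 : ℕ) : ℝ) := by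
        exact_mod_cast hcard
    _ ≤ (4 * r / w) * (4 * r / h) := by gcongr
    _ = 16 * r ^ 2 / (w * h) := by field_simp; norm_num

lemma cyl_measure {N : ℕ} [NeZero N] (m : ℕ) (v : ℕ → Fin N) :
    Measure.infinitePi (fun _ : ℕ => ProbabilityTheory.uniformOn (Set.univ : Set (Fin N)))
      {ω | ∀ k < m, ω k = v k} = ((N : ℝ≥0∞)⁻¹) ^ m := by
  have : {ω : ℕ → Fin N | ∀ k < m, ω k = v k} = Set.pi (Finset.range m) (fun k => {v k}) := by
    ext ω; simp [Set.mem_pi]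
  rw [this, Measure.infinitePi_pi _ (by measurability)]
  simp [ProbabilityTheory.uniformOn_univ]

/-- Everything about the corners that is needed. -/
lemma cor_props {ρ X Y : ℝ} (hρ : 0 < ρ) (hX : 1 < X) (hY : 1 < Y) {M1 M2 N : ℕ}
    (hM1 : (M1 : ℝ) ≤ X) (hM2 : (M2 : ℝ) ≤ Y) (Good : ℕ → ℝ × ℝ → Prop) (z0 : ℝ × ℝ)
    (h0 : Good 0 z0) (sel : ℕ → ℝ × ℝ → Fin N → ℕ × ℕ)
    (hsel : ∀ n z, Good n z → Function.Injective (sel n z) ∧ ∀ k, (sel n z k).1 < M1 ∧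
      (sel n z k).2 < M2 ∧ Good (n + 1) (chd ρ X Y n z (sel n z k))) :
    (∀ n ω, Good n (cor ρ X Y sel z0 n ω)) ∧
    (∀ n ω, rct ρ X Y (n + 1) (cor ρ X Y sel z0 (n + 1) ω) ⊆ rct ρ X Y n (cor ρ X Y sel z0 n ω)) ∧
    (∀ m ω ω', (∃ k < m, ω k ≠ ω' k) →
      ρ / X ^ m ≤ |(cor ρ X Y sel z0 m ω).1 - (cor ρ X Y sel z0 m ω').1| ∨
      ρ / Y ^ m ≤ |(cor ρ X Y sel z0 m ω).2 - (cor ρ X Y sel z0 m ω').2|) := by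
  have hX0 : 0 < X := by linarith
  have hY0 : 0 < Y := by linarith
  have hgood : ∀ n ω, Good n (cor ρ X Y sel z0 n ω) := by
    intro n ω
    induction n with
    | zero => exact h0
    | succ n ih => exact ((hsel n _ ih).2 (ω n)).2.2
  refine ⟨hgood, ?_, ?_⟩
  · intro n ω
    obtain ⟨_, h⟩ := hsel n _ (hgood n ω)
    exact rct_chd_subset hρ hX hY hM1 hM2 n _ _ (h (ω n)).1 (h (ω n)).2.1
  · intro m
    induction m with
    | zero => rintro ω ω' ⟨k, hk, _⟩; omega
    | succ m ih =>
      rintro ω ω' ⟨k, hk, hne⟩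
      have hw : 0 < ρ / X ^ (m + 1) := by positivity
      have hh : 0 < ρ / Y ^ (m + 1) := by positivity
      by_cases hp : ∃ k < m, ω k ≠ ω' k
      · obtain ⟨_, s1⟩ := hsel m _ (hgood m ω)
        obtain ⟨_, s2⟩ := hsel m _ (hgood m ω')
        have e1 : (M1 : ℝ) * (ρ / X ^ (m + 1)) ≤ ρ / X ^ m := by
          calc (M1 : ℝ) * (ρ / X ^ (m + 1)) ≤ X * (ρ / X ^ (m + 1)) := by gcongr
            _ = ρ / X ^ m := by rw [pow_succ]; field_simp
        have e2 : (M2 : ℝ) * (ρ / Y ^ (m + 1)) ≤ ρ / Y ^ m := by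
          calc (M2 : ℝ) * (ρ / Y ^ (m + 1)) ≤ Y * (ρ / Y ^ (m + 1)) := by gcongr
            _ = ρ / Y ^ m := by rw [pow_succ]; field_simp
        rcases ih ω ω' hp with h | h
        · left
          exact sep_aux hw _ _ _ _ (s1 (ω m)).1 (s2 (ω' m)).1 e1 h
        · right
          exact sep_aux hh _ _ _ _ (s1 (ω m)).2.1 (s2 (ω' m)).2.1 e2 h
      · push Not at hp
        have hkm : k = m := by
          by_contra hkm
          exact hne (hp k (by omega))
        subst hkm
        have hc := cor_congr (ρ := ρ) (X := X) (Y := Y) sel z0 k ω ω' hp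
        obtain ⟨inj, _⟩ := hsel k _ (hgood k ω)
        have hab : sel k (cor ρ X Y sel z0 k ω) (ω k) ≠ sel k (cor ρ X Y sel z0 k ω) (ω' k) :=
          fun h => hne (inj h)
        simp only [cor, chd]
        rw [← hc]
        by_cases h1 : (sel k (cor ρ X Y sel z0 k ω) (ω k)).1 = (sel k (cor ρ X Y sel z0 k ω) (ω' k)).1
        · right
          apply sep_same hh
          intro h2
          exact hab (Prod.ext h1 h2)
        · left
          exact sep_same hw _ _ _ h1

lemma pi_bound {ρ X Y Z η d : ℝ} (hρ : 0 < ρ) (hZ : 1 < Z) (hZX : Z ≤ X) (hZY : Z ≤ Y)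
    {N : ℕ} [NeZero N] (hN : X * Y ≤ 2 * N) (hd : d = 2 - η) (hη0 : 0 ≤ η) (hη : 2 ≤ Z ^ η)
    (C : ℕ → (ℕ → Fin N) → ℝ × ℝ)
    (hC : ∀ m ω ω', (∀ k < m, ω k = ω' k) → C m ω = C m ω')
    (hsep : ∀ m ω ω', (∃ k < m, ω k ≠ ω' k) →
      ρ / X ^ m ≤ |(C m ω).1 - (C m ω').1| ∨ ρ / Y ^ m ≤ |(C m ω).2 - (C m ω').2|)
    (π : (ℕ → Fin N) → ℝ × ℝ) (hπ : ∀ ω n, π ω ∈ rct ρ X Y n (C n ω))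
    (r : ℝ) (hr : 0 < r) (hrρ : r ≤ ρ) (s : Set (ℝ × ℝ)) (hs : ∀ p ∈ s, ∀ p' ∈ s, dist p p' ≤ r) :
    Measure.infinitePi (fun _ : ℕ => ProbabilityTheory.uniformOn (Set.univ : Set (Fin N)))
      (π ⁻¹' s) ≤ ENNReal.ofReal (32 * ρ ^ (η - 2) * r ^ d) := by
  classical
  have hX0 : 0 < X := by linarith
  have hY0 : 0 < Y := by linarith
  have hZ0 : 0 < Z := by linarith
  have hN0 : 0 < (N : ℝ) := by exact_mod_cast Nat.pos_of_ne_zero (NeZero.ne N)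
  set P := Measure.infinitePi (fun _ : ℕ => ProbabilityTheory.uniformOn (Set.univ : Set (Fin N)))
    with hP
  rcases s.eq_empty_or_nonempty with rfl | ⟨c, hc⟩
  · simp
  obtain ⟨m', hm1, hm2⟩ := exists_nat_pow_near ((one_le_div hr).2 hrρ) hZ
  set m := m' + 1 with hm
  have small : ∀ W, Z ≤ W → ρ / W ^ m ≤ r := by
    intro W hW
    have : 0 < W := by linarith
    rw [div_le_iff₀ (by positivity)]
    rw [div_lt_iff₀ hr] at hm2
    calc ρ ≤ Z ^ m * r := hm2.le
      _ ≤ W ^ m * r := by gcongr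
      _ = r * W ^ m := by ring
  have hw := small X hZX
  have hh := small Y hZY
  let ext : (Fin m → Fin N) → (ℕ → Fin N) := fun v k => if h : k < m then v ⟨k, h⟩ else 0
  let V : Finset (Fin m → Fin N) := Finset.univ.filter
    (fun v => (rct ρ X Y m (C m (ext v)) ∩ s).Nonempty)
  have hsub : π ⁻¹' s ⊆ ⋃ v ∈ V, {ω | ∀ k < m, ω k = ext v k} := by
    intro ω hω
    simp only [Set.mem_iUnion]
    have he : ∀ k < m, ω k = ext (fun k => ω k) k := by
      intro k hk; simp [ext, hk]
    refine ⟨fun k => ω k, ?_, he⟩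
    simp only [V, Finset.mem_filter, Finset.mem_univ, true_and]
    refine ⟨π ω, ?_, hω⟩
    rw [← hC m ω _ he]
    exact hπ ω m
  have hcard : (V.card : ℝ) ≤ 16 * r ^ 2 / (ρ / X ^ m * (ρ / Y ^ m)) := by
    apply count_sep V (fun v => C m (ext v)) _ _ r (by positivity) (by positivity) hw hh c
    · intro v hv
      simp only [V, Finset.mem_filter, Finset.mem_univ, true_and] at hv
      obtain ⟨p, ⟨p1, p2, p3, p4⟩, hps⟩ := hv
      have hd := hs p hps c hc
      rw [Prod.dist_eq, max_le_iff, Real.dist_eq, Real.dist_eq, abs_le, abs_le] at hd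
      obtain ⟨⟨d1, d2⟩, d3, d4⟩ := hd
      refine ⟨by linarith, by linarith, by linarith, by linarith⟩
    · intro v _ v' _ hne
      apply hsep
      obtain ⟨k, hk⟩ := Function.ne_iff.1 hne
      refine ⟨k, k.2, ?_⟩
      simpa [ext] using hk
  have hPle : P (π ⁻¹' s) ≤ V.card * ((N : ℝ≥0∞)⁻¹) ^ m := by
    calc P (π ⁻¹' s) ≤ P (⋃ v ∈ V, {ω | ∀ k < m, ω k = ext v k}) := measure_mono hsub
      _ ≤ ∑ v ∈ V, P {ω | ∀ k < m, ω k = ext v k} := measure_biUnion_finset_le _ _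
      _ = V.card * ((N : ℝ≥0∞)⁻¹) ^ m := by
        simp_rw [hP, cyl_measure]
        simp
  have hreal : (V.card : ℝ≥0∞) * ((N : ℝ≥0∞)⁻¹) ^ m = ENNReal.ofReal (V.card * ((N : ℝ)⁻¹) ^ m) := by
    rw [ENNReal.ofReal_mul (by positivity), ENNReal.ofReal_pow (by positivity),
      ENNReal.ofReal_inv_of_pos hN0, ENNReal.ofReal_natCast, ENNReal.ofReal_natCast]
  rw [hreal] at hPle
  refine hPle.trans (ENNReal.ofReal_le_ofReal ?_)
  have h2m : (2 : ℝ) ^ m' ≤ (ρ / r) ^ η := by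
    calc (2 : ℝ) ^ m' ≤ (Z ^ η) ^ m' := by gcongr
      _ = (Z ^ m') ^ η := by
        rw [← Real.rpow_natCast, ← Real.rpow_natCast, ← Real.rpow_mul hZ0.le,
          ← Real.rpow_mul hZ0.le, mul_comm]
      _ ≤ (ρ / r) ^ η := by gcongr
  have hXY : (X * Y) ^ m * ((N : ℝ)⁻¹) ^ m ≤ 2 ^ m := by
    rw [← mul_pow]
    gcongr
    rw [← div_eq_mul_inv, div_le_iff₀ hN0]
    exact hN
  calc (V.card : ℝ) * ((N : ℝ)⁻¹) ^ m
      ≤ 16 * r ^ 2 / (ρ / X ^ m * (ρ / Y ^ m)) * ((N : ℝ)⁻¹) ^ m := by gcongr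
    _ = 16 * r ^ 2 / ρ ^ 2 * ((X * Y) ^ m * ((N : ℝ)⁻¹) ^ m) := by
      rw [mul_pow]; field_simp
    _ ≤ 16 * r ^ 2 / ρ ^ 2 * 2 ^ m := by gcongr
    _ = 32 * r ^ 2 / ρ ^ 2 * 2 ^ m' := by rw [hm, pow_succ]; ring
    _ ≤ 32 * r ^ 2 / ρ ^ 2 * (ρ / r) ^ η := by gcongr
    _ = 32 * ρ ^ (η - 2) * r ^ d := by
      rw [Real.div_rpow hρ.le hr.le, hd, Real.rpow_sub hρ, Real.rpow_sub hr, Real.rpow_two,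
        Real.rpow_two]
      field_simp

theorem cantor_dim_s5 {ρ X Y Z η : ℝ} (hρ : 0 < ρ) (hZ : 1 < Z) (hZX : Z ≤ X) (hZY : Z ≤ Y)
    {M1 M2 N : ℕ} (hM1 : (M1 : ℝ) ≤ X) (hM2 : (M2 : ℝ) ≤ Y)
    (hN : X * Y ≤ 2 * N) (d : ℝ≥0) (hd : (d : ℝ) = 2 - η) (hη0 : 0 ≤ η)
    (hη : 2 ≤ Z ^ η)
    (Good : ℕ → ℝ × ℝ → Prop) (z0 : ℝ × ℝ) (h0 : Good 0 z0)
    (hstep : ∀ n z, Good n z → ∃ S : Finset (ℕ × ℕ), N ≤ S.card ∧ ∀ ab ∈ S, ab.1 < M1 ∧ ab.2 < M2 ∧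
      Good (n + 1) (chd ρ X Y n z ab))
    (T : Set (ℝ × ℝ)) (hT : ∀ p, (∀ n, ∃ z, Good n z ∧ p ∈ rct ρ X Y n z) → p ∈ T) :
    (d : ℝ≥0∞) ≤ dimH T := by
  classical
  have hX0 : 0 < X := by linarith
  have hY0 : 0 < Y := by linarith
  have hNpos : 0 < N := by
    rcases Nat.eq_zero_or_pos N with h | h
    · subst h
      have : 0 < X * Y := by positivity
      simp at hN; linarith
    · exact h
  have : NeZero N := ⟨hNpos.ne'⟩
  have hsel0 : ∀ n z, ∃ g : Fin N → ℕ × ℕ, Good n z → Function.Injective g ∧ ∀ k, (g k).1 < M1 ∧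
      (g k).2 < M2 ∧ Good (n + 1) (chd ρ X Y n z (g k)) := by
    intro n z
    by_cases hg : Good n z
    · obtain ⟨S, hS1, hS2⟩ := hstep n z hg
      have hcard : Fintype.card (Fin N) ≤ Fintype.card S := by simpa using hS1
      obtain ⟨e⟩ := Function.Embedding.nonempty_of_card_le hcard
      refine ⟨fun k => (e k : ℕ × ℕ), fun _ => ⟨fun a b hab => e.injective (Subtype.ext hab),
        fun k => hS2 _ (e k).2⟩⟩
    · exact ⟨fun _ => 0, fun h => absurd h hg⟩
  choose sel hsel using hsel0
  obtain ⟨hgood, hnest, hsep⟩ := cor_props hρ (by linarith : 1 < X) (by linarith : 1 < Y) hM1 hM2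
    Good z0 h0 sel hsel
  have hrct : ∀ n z, rct ρ X Y n z = Set.Icc z (z.1 + ρ / X ^ n, z.2 + ρ / Y ^ n) := by
    intro n z
    ext p
    simp only [rct, Set.mem_ofPred_eq, Set.mem_Icc, Prod.le_def]
    tauto
  have hlim : ∀ ω : ℕ → Fin N, ∃ p, ∀ n, p ∈ rct ρ X Y n (cor ρ X Y sel z0 n ω) := by
    intro ω
    have := IsCompact.nonempty_iInter_of_sequence_nonempty_isCompact_isClosed
      (fun n => rct ρ X Y n (cor ρ X Y sel z0 n ω)) (fun n => hnest n ω)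
      (fun n => ⟨cor ρ X Y sel z0 n ω, le_rfl, by simp; positivity, le_rfl, by simp; positivity⟩)
      (by simp only [hrct]; exact isCompact_Icc) (fun n => by simp only [hrct]; exact isClosed_Icc)
    obtain ⟨p, hp⟩ := this
    exact ⟨p, fun n => Set.mem_iInter.1 hp n⟩
  choose π hπ using hlim
  set P := Measure.infinitePi (fun _ : ℕ => ProbabilityTheory.uniformOn (Set.univ : Set (Fin N)))
    with hP
  set K : ℝ := 32 * ρ ^ (η - 2) with hK
  have hK0 : 0 < K := by positivity
  have hbound := fun r hr hrρ s hs => pi_bound hρ hZ hZX hZY hN hd hη0 hη (cor ρ X Y sel z0)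
    (fun m ω ω' h => cor_congr sel z0 m ω ω' h) hsep π hπ r hr hrρ s hs
  rw [← hP, ← hK] at hbound
  have hle : OuterMeasure.map π P.toOuterMeasure ≤
      OuterMeasure.mkMetric (ENNReal.ofReal K • fun x : ℝ≥0∞ => x ^ (d : ℝ)) := by
    apply OuterMeasure.le_mkMetric _ _ (ENNReal.ofReal ρ) (by simpa using hρ)
    intro s hs
    rw [OuterMeasure.map_apply]
    show P (π ⁻¹' s) ≤ ENNReal.ofReal K * Metric.ediam s ^ (d : ℝ)
    have hfin : Metric.ediam s ≠ ⊤ := ne_top_of_le_ne_top ENNReal.ofReal_ne_top hs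
    have hdist : ∀ p ∈ s, ∀ p' ∈ s, dist p p' ≤ (Metric.ediam s).toReal := by
      intro p hp p' hp'
      rw [dist_edist]
      exact ENNReal.toReal_mono hfin (Metric.edist_le_ediam_of_mem hp hp')
    set r0 := (Metric.ediam s).toReal with hr0
    have hr00 : 0 ≤ r0 := ENNReal.toReal_nonneg
    have hr0ρ : r0 ≤ ρ := by
      have := ENNReal.toReal_mono ENNReal.ofReal_ne_top hs
      rwa [ENNReal.toReal_ofReal hρ.le] at this
    have hrw : ENNReal.ofReal K * Metric.ediam s ^ (d : ℝ) = ENNReal.ofReal (K * r0 ^ (d : ℝ)) := by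
      rw [ENNReal.ofReal_mul hK0.le, ← ENNReal.ofReal_rpow_of_nonneg hr00 d.coe_nonneg, hr0,
        ENNReal.ofReal_toReal hfin]
    rw [hrw]
    rcases hr00.eq_or_lt with h | h
    · have ht : Tendsto (fun r : ℝ => ENNReal.ofReal (K * r ^ (d : ℝ))) (nhdsWithin 0 (Set.Ioi 0))
          (nhds (ENNReal.ofReal (K * r0 ^ (d : ℝ)))) := by
        rw [← h]
        apply tendsto_nhdsWithin_of_tendsto_nhds
        apply ENNReal.tendsto_ofReal
        apply Tendsto.const_mul
        exact (Real.continuousAt_rpow_const 0 _ (Or.inr d.coe_nonneg)).tendsto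
      apply ge_of_tendsto ht
      filter_upwards [Ioc_mem_nhdsGT hρ] with r hr
      exact hbound r hr.1 hr.2 s (fun p hp p' hp' => (hdist p hp p' hp').trans (by rw [← h]; exact hr.1.le))
    · exact hbound r0 h hr0ρ s hdist
  apply le_dimH_of_hausdorffMeasure_ne_zero
  intro hzero
  have h1 := hle T
  rw [OuterMeasure.mkMetric_smul _ ENNReal.ofReal_ne_top (by simpa using hK0)] at h1
  rw [OuterMeasure.map_apply] at h1
  have h2 : π ⁻¹' T = Set.univ := by
    ext ω
    simp only [Set.mem_preimage, Set.mem_univ, iff_true]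
    exact hT _ (fun n => ⟨_, hgood n ω, hπ ω n⟩)
  rw [h2, _root_.smul_apply, OuterMeasure.coe_mkMetric] at h1
  have h3 : Measure.mkMetric (fun x : ℝ≥0∞ => x ^ (d : ℝ)) T = 0 := hzero
  rw [h3] at h1
  have h4 : P Set.univ = 1 := measure_univ
  rw [Measure.coe_toOuterMeasure, h4] at h1
  simp at h1

end CantorPart

section ArithPart

/-- Homogeneous condition of level `l`. -/
def condH (ρ X Y R : ℝ) (l : ℕ) (p : ℝ × ℝ) : Prop :=
  ∀ q : ℕ, 0 < q → (q : ℝ) < R ^ l → ∀ a b : ℤ,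
    ¬ (|p.1 - a / q| ≤ ρ / X ^ (l + 1) ∧ |p.2 - b / q| ≤ ρ / Y ^ (l + 1))

/-- Inhomogeneous condition of level `l`. -/
def condI (ρ X Y R : ℝ) (θ : ℝ × ℝ) (l : ℕ) (p : ℝ × ℝ) : Prop :=
  ∀ q : ℕ, 0 < q → (q : ℝ) * R ^ 3 < R ^ l → ∀ a b : ℤ, R ^ l ≤ q * R ^ 4 →
    ¬ (|p.1 - (a + θ.1) / q| ≤ ρ / X ^ (l + 1) ∧ |p.2 - (b + θ.2) / q| ≤ ρ / Y ^ (l + 1))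

lemma near_count (F : Finset ℕ) (s : ℝ) (t : ℕ) (h : ∀ a ∈ F, |(a : ℝ) - s| ≤ t) :
    F.card ≤ 2 * t + 1 := by
  rcases F.eq_empty_or_nonempty with rfl | hne
  · simp
  have hsub : F ⊆ Finset.Icc (F.min' hne) (F.min' hne + 2 * t) := by
    intro a ha
    rw [Finset.mem_Icc]
    refine ⟨Finset.min'_le _ _ ha, ?_⟩
    have h1 := abs_le.1 (h a ha)
    have h2 := abs_le.1 (h _ (F.min'_mem hne))
    have : (a : ℝ) ≤ (F.min' hne : ℝ) + 2 * t := by linarith [h1.2, h2.1]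
    exact_mod_cast this
  calc F.card ≤ _ := Finset.card_le_card hsub
    _ = 2 * t + 1 := by rw [Nat.card_Icc]; omega

lemma near_count2 (F : Finset (ℕ × ℕ)) (s s' : ℝ) (t : ℕ)
    (h : ∀ a ∈ F, |(a.1 : ℝ) - s| ≤ t ∧ |(a.2 : ℝ) - s'| ≤ t) :
    F.card ≤ (2 * t + 1) * (2 * t + 1) := by
  have hsub : F ⊆ F.image Prod.fst ×ˢ F.image Prod.snd := Finset.subset_product
  have h1 : (F.image Prod.fst).card ≤ 2 * t + 1 := by
    apply near_count _ s
    intro a ha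
    obtain ⟨x, hx, rfl⟩ := Finset.mem_image.1 ha
    exact (h x hx).1
  have h2 : (F.image Prod.snd).card ≤ 2 * t + 1 := by
    apply near_count _ s'
    intro a ha
    obtain ⟨x, hx, rfl⟩ := Finset.mem_image.1 ha
    exact (h x hx).2
  calc F.card ≤ _ := Finset.card_le_card hsub
    _ = _ := Finset.card_product _ _
    _ ≤ _ := Nat.mul_le_mul h1 h2

lemma line_aux {α β κ a b : ℝ} (hα : α ≠ 0) (hle : |β| ≤ |α|)
    (h : |α * a + β * b - κ| ≤ 2 * (|α| + |β|)) : |a - (κ - β * b) / α| ≤ 4 := by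
  have hα' : 0 < |α| := abs_pos.2 hα
  have : α * a + β * b - κ = α * (a - (κ - β * b) / α) := by field_simp; ring
  rw [this, abs_mul] at h
  have h2 : |α| * |a - (κ - β * b) / α| ≤ |α| * 4 := by linarith
  exact le_of_mul_le_mul_left h2 hα'

lemma line_count (F : Finset (ℕ × ℕ)) (M1 M2 : ℕ) (hF : F ⊆ Finset.range M1 ×ˢ Finset.range M2)
    (α β κ : ℝ) (h0 : α ≠ 0 ∨ β ≠ 0)
    (h : ∀ a ∈ F, |α * a.1 + β * a.2 - κ| ≤ 2 * (|α| + |β|)) : F.card ≤ 9 * (M1 + M2) := by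
  classical
  rcases le_total |β| |α| with hle | hle
  · have hα : α ≠ 0 := by
      rintro rfl
      simp at hle
      simp [hle] at h0
    have h1 : F.card ≤ 9 * (F.image Prod.snd).card := by
      apply Finset.card_le_mul_card_image
      intro b _
      have hinj : Set.InjOn Prod.fst ((F.filter (fun a => a.2 = b) : Finset (ℕ × ℕ)) : Set (ℕ × ℕ)) := by
        intro x hx y hy hxy
        simp only [Finset.coe_filter, Set.mem_ofPred_eq] at hx hy
        exact Prod.ext hxy (hx.2.trans hy.2.symm)
      rw [← Finset.card_image_of_injOn hinj]
      apply near_count _ ((κ - β * b) / α) 4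
      intro a ha
      obtain ⟨x, hx, rfl⟩ := Finset.mem_image.1 ha
      rw [Finset.mem_filter] at hx
      have := line_aux hα hle (h x hx.1)
      rw [hx.2] at this
      exact_mod_cast this
    have h2 : (F.image Prod.snd).card ≤ M2 := by
      have : F.image Prod.snd ⊆ Finset.range M2 := by
        intro a ha
        obtain ⟨x, hx, rfl⟩ := Finset.mem_image.1 ha
        exact (Finset.mem_product.1 (hF hx)).2
      simpa using Finset.card_le_card this
    omega
  · have hβ : β ≠ 0 := by
      rintro rfl
      simp at hle
      simp [hle] at h0
    have h1 : F.card ≤ 9 * (F.image Prod.fst).card := by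
      apply Finset.card_le_mul_card_image
      intro b _
      have hinj : Set.InjOn Prod.snd ((F.filter (fun a => a.1 = b) : Finset (ℕ × ℕ)) : Set (ℕ × ℕ)) := by
        intro x hx y hy hxy
        simp only [Finset.coe_filter, Set.mem_ofPred_eq] at hx hy
        exact Prod.ext (hx.2.trans hy.2.symm) hxy
      rw [← Finset.card_image_of_injOn hinj]
      apply near_count _ ((κ - α * b) / β) 4
      intro a ha
      obtain ⟨x, hx, rfl⟩ := Finset.mem_image.1 ha
      rw [Finset.mem_filter] at hx
      have h3 := h x hx.1
      rw [add_comm (α * _), add_comm |α|] at h3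
      have := line_aux hβ hle h3
      rw [hx.2] at this
      exact_mod_cast this
    have h2 : (F.image Prod.fst).card ≤ M1 := by
      have : F.image Prod.fst ⊆ Finset.range M1 := by
        intro a ha
        obtain ⟨x, hx, rfl⟩ := Finset.mem_image.1 ha
        exact (Finset.mem_product.1 (hF hx)).1
      simpa using Finset.card_le_card this
    omega

lemma exists_line (S : Set (ℝ × ℝ))
    (h : ∀ P ∈ S, ∀ Q ∈ S, ∀ T ∈ S, (Q.1 - P.1) * (T.2 - P.2) - (T.1 - P.1) * (Q.2 - P.2) = 0) :
    ∃ α β κ : ℝ, (α ≠ 0 ∨ β ≠ 0) ∧ ∀ P ∈ S, α * P.1 + β * P.2 = κ := by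
  by_cases hs : S.Subsingleton
  · rcases S.eq_empty_or_nonempty with rfl | ⟨P, hP⟩
    · exact ⟨1, 0, 0, by simp, by simp⟩
    · refine ⟨1, 0, P.1, by simp, fun Q hQ => ?_⟩
      rw [hs hQ hP]; ring
  · rw [Set.not_subsingleton_iff] at hs
    obtain ⟨P, hP, Q, hQ, hne⟩ := hs
    refine ⟨Q.2 - P.2, P.1 - Q.1, (Q.2 - P.2) * P.1 + (P.1 - Q.1) * P.2, ?_, ?_⟩
    · by_contra hcon
      push Not at hcon
      exact hne (Prod.ext (by linarith [hcon.2]) (by linarith [hcon.1]))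
    · intro T hT
      have := h P hP Q hQ T hT
      linarith

lemma det_zero {W H r : ℝ} (q1 q2 q3 : ℕ) (h1 : 0 < q1) (h2 : 0 < q2) (h3 : 0 < q3)
    (k1 : (q1 : ℝ) < r) (k2 : (q2 : ℝ) < r) (k3 : (q3 : ℝ) < r)
    (A1 A2 A3 B1 B2 B3 : ℤ)
    (x2 : |(A2 / q2 - A1 / q1 : ℝ)| ≤ W) (x3 : |(A3 / q3 - A1 / q1 : ℝ)| ≤ W)
    (y2 : |(B2 / q2 - B1 / q1 : ℝ)| ≤ H) (y3 : |(B3 / q3 - B1 / q1 : ℝ)| ≤ H)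
    (hWH : r ^ 3 * (2 * (W * H)) < 1) :
    ((A2 / q2 - A1 / q1) * (B3 / q3 - B1 / q1) - (A3 / q3 - A1 / q1) * (B2 / q2 - B1 / q1) : ℝ) = 0 := by
  have p1 : (0 : ℝ) < q1 := by exact_mod_cast h1
  have p2 : (0 : ℝ) < q2 := by exact_mod_cast h2
  have p3 : (0 : ℝ) < q3 := by exact_mod_cast h3
  have hW : 0 ≤ W := (abs_nonneg _).trans x2
  have hH : 0 ≤ H := (abs_nonneg _).trans y2
  set D : ℝ := ((A2 / q2 - A1 / q1) * (B3 / q3 - B1 / q1) - (A3 / q3 - A1 / q1) * (B2 / q2 - B1 / q1) : ℝ)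
    with hD
  set I : ℤ := q1 * (A2 * B3 - A3 * B2) - A1 * (q2 * B3 - q3 * B2) + B1 * (q2 * A3 - q3 * A2) with hI
  have e : (q1 * q2 * q3 : ℝ) * D = (I : ℝ) := by
    rw [hD, hI]; push_cast; field_simp; ring
  have hDle : |D| ≤ 2 * (W * H) := by
    calc |D| ≤ |(A2 / q2 - A1 / q1 : ℝ) * (B3 / q3 - B1 / q1)| + |(A3 / q3 - A1 / q1 : ℝ) * (B2 / q2 - B1 / q1)| :=
          abs_sub _ _
      _ = |(A2 / q2 - A1 / q1 : ℝ)| * |(B3 / q3 - B1 / q1 : ℝ)| + |(A3 / q3 - A1 / q1 : ℝ)| * |(B2 / q2 - B1 / q1 : ℝ)| := by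
          rw [abs_mul, abs_mul]
      _ ≤ W * H + W * H := by gcongr
      _ = 2 * (W * H) := by ring
  have hIlt : |(I : ℝ)| < 1 := by
    have hr0 : 0 < r := p1.trans k1
    rw [← e, abs_mul, abs_of_pos (by positivity)]
    calc (q1 * q2 * q3 : ℝ) * |D| ≤ (r * r * r) * (2 * (W * H)) := by gcongr
      _ = r ^ 3 * (2 * (W * H)) := by ring
      _ < 1 := hWH
  have hI0 : I = 0 := by
    rw [← Int.cast_abs] at hIlt
    have : |I| < 1 := by exact_mod_cast hIlt
    exact Int.abs_lt_one_iff.1 this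
  rw [hI0] at e
  have : (q1 * q2 * q3 : ℝ) ≠ 0 := by positivity
  simpa [this] using e

lemma hom_line {ρ X Y R : ℝ} (hρ : 0 < ρ) (hρ2 : 18 * ρ ^ 2 < 1) (hX : 1 < X) (hY : 1 < Y)
    (hR : 1 < R) (hXY : X * Y = R ^ 3) {M1 M2 : ℕ} (hM1 : (M1 : ℝ) ≤ X) (hM2 : (M2 : ℝ) ≤ Y)
    (n : ℕ) (z : ℝ × ℝ) :
    ∃ α β κ : ℝ, (α ≠ 0 ∨ β ≠ 0) ∧ ∀ ab : ℕ × ℕ, ab.1 < M1 → ab.2 < M2 →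
      (∃ p ∈ rct ρ X Y (n + 1) (chd ρ X Y n z ab), ¬ condH ρ X Y R n p) →
      |α * ab.1 + β * ab.2 - κ| ≤ 2 * (|α| + |β|) := by
  have hX0 : 0 < X := by linarith
  have hY0 : 0 < Y := by linarith
  have hR0 : 0 < R := by linarith
  set w := ρ / X ^ n with hw
  set h := ρ / Y ^ n with hh
  set w' := ρ / X ^ (n + 1) with hw'
  set h' := ρ / Y ^ (n + 1) with hh'
  have hw0 : 0 < w' := by positivity
  have hh0 : 0 < h' := by positivity
  have hww : w' ≤ w := by
    rw [hw, hw']; gcongr <;> linarith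
  have hhh : h' ≤ h := by
    rw [hh, hh']; gcongr <;> linarith
  have hprod : (R ^ n) ^ 3 * (2 * ((3 * w) * (3 * h))) < 1 := by
    have : (R ^ n) ^ 3 * (2 * ((3 * w) * (3 * h))) = 18 * ρ ^ 2 := by
      have e : (R ^ n) ^ 3 = X ^ n * Y ^ n := by rw [← mul_pow, hXY]; ring
      rw [e, hw, hh]; field_simp; norm_num
    rw [this]; exact hρ2
  let S : Set (ℝ × ℝ) := {P | (∃ (q : ℕ) (A B : ℤ), 0 < q ∧ (q : ℝ) < R ^ n ∧ P = ((A : ℝ) / q, (B : ℝ) / q)) ∧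
    z.1 - w ≤ P.1 ∧ P.1 ≤ z.1 + 2 * w ∧ z.2 - h ≤ P.2 ∧ P.2 ≤ z.2 + 2 * h}
  obtain ⟨α, β, κ, h0, hline⟩ := exists_line S (by
    rintro P ⟨⟨q1, A1, B1, p1, r1, rfl⟩, a1, a2, a3, a4⟩ Q ⟨⟨q2, A2, B2, p2, r2, rfl⟩, b1, b2, b3, b4⟩
      T ⟨⟨q3, A3, B3, p3, r3, rfl⟩, c1, c2, c3, c4⟩
    simp only at a1 a2 a3 a4 b1 b2 b3 b4 c1 c2 c3 c4 ⊢
    apply det_zero (W := 3 * w) (H := 3 * h) q1 q2 q3 p1 p2 p3 r1 r2 r3 A1 A2 A3 B1 B2 B3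
    · rw [abs_le]; constructor <;> linarith
    · rw [abs_le]; constructor <;> linarith
    · rw [abs_le]; constructor <;> linarith
    · rw [abs_le]; constructor <;> linarith
    · exact hprod)
  refine ⟨α * w', β * h', κ - α * z.1 - β * z.2, ?_, ?_⟩
  · rcases h0 with h0 | h0
    · left; positivity
    · right; positivity
  rintro ab hab1 hab2 ⟨p, hp, hnot⟩
  have hp2 := rct_chd_subset hρ hX hY hM1 hM2 n z ab hab1 hab2 hp
  obtain ⟨a1, a2, a3, a4⟩ := hp
  obtain ⟨b1, b2, b3, b4⟩ := hp2
  unfold condH at hnot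
  push Not at hnot
  obtain ⟨q, hq0, hqR, A, B, hA, hB⟩ := hnot
  simp only [chd] at a1 a2 a3 a4
  rw [abs_le] at hA hB
  rw [← hw'] at a1 a2 hA
  rw [← hh'] at a3 a4 hB
  rw [← hw] at b2
  rw [← hh] at b4
  have hmem : ((A : ℝ) / q, (B : ℝ) / q) ∈ S := by
    refine ⟨⟨q, A, B, hq0, hqR, rfl⟩, ?_, ?_, ?_, ?_⟩ <;> simp only <;> linarith [hA.1, hA.2, hB.1, hB.2]
  have hl := hline _ hmem
  simp only at hl
  have e : α * w' * ab.1 + β * h' * ab.2 - (κ - α * z.1 - β * z.2) =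
      α * (z.1 + ab.1 * w' - A / q) + β * (z.2 + ab.2 * h' - B / q) := by
    rw [← hl]; ring
  rw [e]
  have u1 : |z.1 + ab.1 * w' - A / q| ≤ 2 * w' := by
    rw [abs_le]; constructor <;> linarith [hA.1, hA.2]
  have u2 : |z.2 + ab.2 * h' - B / q| ≤ 2 * h' := by
    rw [abs_le]; constructor <;> linarith [hB.1, hB.2]
  calc _ ≤ |α * (z.1 + ab.1 * w' - A / q)| + |β * (z.2 + ab.2 * h' - B / q)| := abs_add_le _ _
    _ = |α| * |z.1 + ab.1 * w' - A / q| + |β| * |z.2 + ab.2 * h' - B / q| := by rw [abs_mul, abs_mul]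
    _ ≤ |α| * (2 * w') + |β| * (2 * h') := by gcongr
    _ = 2 * (|α * w'| + |β * h'|) := by
      rw [abs_mul, abs_mul, abs_of_pos hw0, abs_of_pos hh0]; ring

/-- One coordinate of the comparison of two inhomogeneous approximations. -/
lemma inhom_coord {ρ X R : ℝ} (hρ : 0 < ρ) (hR : 4 ≤ R) (hRX : R ≤ X)
    (n l : ℕ) (hl : l + 4 ≤ n) (x x1 x2 γ : ℝ) (q1 q2 : ℕ) (h0 : 0 < q1) (h12 : q1 < q2)
    (hq2 : (q2 : ℝ) * R ^ 3 < R ^ n) (hlq : R ^ l ≤ ((q2 - q1 : ℕ) : ℝ)) (A1 A2 : ℤ)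
    (hx1 : |x1 - x| ≤ ρ / X ^ n) (hx2 : |x2 - x| ≤ ρ / X ^ n)
    (k1 : |x1 - (A1 + γ) / q1| ≤ ρ / X ^ (n + 1)) (k2 : |x2 - (A2 + γ) / q2| ≤ ρ / X ^ (n + 1)) :
    |x - ((A2 - A1 : ℤ) : ℝ) / ((q2 - q1 : ℕ) : ℝ)| ≤ ρ / X ^ (l + 1 + 1) := by
  have hR0 : 0 < R := by linarith
  have hX0 : 0 < X := by linarith
  have p1 : (0 : ℝ) < q1 := by exact_mod_cast h0
  have p12 : (q1 : ℝ) < q2 := by exact_mod_cast h12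
  have hq : ((q2 - q1 : ℕ) : ℝ) = (q2 : ℝ) - q1 := by push_cast [h12.le]; ring
  have pq : 0 < (q2 : ℝ) - q1 := by linarith
  have hww : ρ / X ^ (n + 1) ≤ ρ / X ^ n := by gcongr <;> linarith
  set w := ρ / X ^ n with hw
  have hw0 : 0 < w := by positivity
  have t : ∀ (y : ℝ) (q : ℕ) (A : ℤ), (0 : ℝ) < q → (q : ℝ) ≤ q2 → |y - x| ≤ w →
      |y - (A + γ) / q| ≤ ρ / X ^ (n + 1) → |q * x - A - γ| ≤ q2 * (2 * w) := by
    intro y q A hq0 hqle hy hk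
    have e : q * x - A - γ = q * (x - (A + γ) / q) := by field_simp; ring
    rw [e, abs_mul, abs_of_pos hq0]
    have : |x - (A + γ) / q| ≤ 2 * w := by
      rw [abs_le] at *
      constructor <;> linarith [hy.1, hy.2, hk.1, hk.2]
    gcongr
  have t1 := t x1 q1 A1 p1 p12.le hx1 k1
  have t2 := t x2 q2 A2 (by linarith) le_rfl hx2 k2
  have t3 : |((q2 : ℝ) - q1) * x - (A2 - A1)| ≤ 4 * (q2 * w) := by
    rw [abs_le] at *
    constructor <;> linarith [t1.1, t1.2, t2.1, t2.2]
  rw [hq] at hlq ⊢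
  have e : x - ((A2 - A1 : ℤ) : ℝ) / ((q2 : ℝ) - q1) = (((q2 : ℝ) - q1) * x - (A2 - A1)) / ((q2 : ℝ) - q1) := by
    push_cast; field_simp
  rw [e, abs_div, abs_of_pos pq, div_le_iff₀ pq]
  refine t3.trans ?_
  have hql : ρ / X ^ (l + 1 + 1) * R ^ l ≤ ρ / X ^ (l + 1 + 1) * ((q2 : ℝ) - q1) := by gcongr
  refine le_trans ?_ hql
  obtain ⟨u, rfl⟩ := Nat.exists_eq_add_of_le hl
  have hq2' : (q2 : ℝ) ≤ R ^ (l + 1 + u) := by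
    have : R ^ (l + 4 + u) = R ^ (l + 1 + u) * R ^ 3 := by ring
    rw [this] at hq2
    exact (lt_of_mul_lt_mul_right hq2 (by positivity)).le
  have e2 : w = ρ / X ^ (l + 1 + 1) / X ^ (2 + u) := by
    rw [hw]; field_simp; ring
  rw [e2]
  have hc : 0 < ρ / X ^ (l + 1 + 1) := by positivity
  set c := ρ / X ^ (l + 1 + 1)
  calc 4 * (q2 * (c / X ^ (2 + u))) ≤ R * (R ^ (l + 1 + u) * (c / R ^ (2 + u))) := by gcongr
    _ = c * R ^ l := by field_simp; ring

lemma inhom_same {ρ X R : ℝ} (hρ : 0 < ρ) (hρ1 : ρ ≤ 1) (hR : 4 ≤ R) (hRX : R ≤ X)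
    (n : ℕ) (x x1 x2 γ : ℝ) (q : ℕ) (h0 : 0 < q)
    (hq : (q : ℝ) * R ^ 3 < R ^ n) (A1 A2 : ℤ)
    (hx1 : |x1 - x| ≤ ρ / X ^ n) (hx2 : |x2 - x| ≤ ρ / X ^ n)
    (k1 : |x1 - (A1 + γ) / q| ≤ ρ / X ^ (n + 1)) (k2 : |x2 - (A2 + γ) / q| ≤ ρ / X ^ (n + 1)) :
    A1 = A2 := by
  have hR0 : 0 < R := by linarith
  have hX0 : 0 < X := by linarith
  have p : (0 : ℝ) < q := by exact_mod_cast h0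
  have hww : ρ / X ^ (n + 1) ≤ ρ / X ^ n := by gcongr <;> linarith
  have hwR : ρ / X ^ n ≤ 1 / R ^ n := by gcongr
  set w := ρ / X ^ n with hw
  have hd : |((A1 : ℝ) - A2) / q| ≤ 4 * w := by
    have e : ((A1 : ℝ) - A2) / q = (A1 + γ) / q - (A2 + γ) / q := by ring
    rw [e]
    rw [abs_le] at *
    constructor <;> linarith [hx1.1, hx1.2, hx2.1, hx2.2, k1.1, k1.2, k2.1, k2.2]
  rw [abs_div, abs_of_pos p, div_le_iff₀ p] at hd
  have hlt : |(A1 : ℝ) - A2| < 1 := by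
    have hRn : 0 < R ^ n := by positivity
    have : 4 * (q : ℝ) < R ^ n := by
      have h4 : (4 : ℝ) ≤ R ^ 3 := hR.trans (le_self_pow₀ (by linarith) (by norm_num))
      nlinarith
    calc |(A1 : ℝ) - A2| ≤ 4 * w * q := hd
      _ ≤ 4 * (1 / R ^ n) * q := by gcongr
      _ = (4 * q) / R ^ n := by ring
      _ < 1 := by rw [div_lt_one hRn]; exact this
  have : |A1 - A2| < 1 := by exact_mod_cast hlt
  have := Int.abs_lt_one_iff.1 this
  omega

/-- Data of an inhomogeneous approximation violating `condI`. -/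
def viol (ρ X Y R : ℝ) (θ : ℝ × ℝ) (n : ℕ) (p : ℝ × ℝ) (q : ℕ) (A B : ℤ) : Prop :=
  0 < q ∧ (q : ℝ) * R ^ 3 < R ^ n ∧
    |p.1 - (A + θ.1) / q| ≤ ρ / X ^ (n + 1) ∧ |p.2 - (B + θ.2) / q| ≤ ρ / Y ^ (n + 1)

lemma rct_near {ρ X Y : ℝ} {n : ℕ} {z p : ℝ × ℝ} (h : p ∈ rct ρ X Y n z) :
    |p.1 - z.1| ≤ ρ / X ^ n ∧ |p.2 - z.2| ≤ ρ / Y ^ n := by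
  obtain ⟨a1, a2, a3, a4⟩ := h
  constructor <;> rw [abs_le] <;> constructor <;> linarith

lemma inhom_lt {ρ X Y R : ℝ} (hρ : 0 < ρ) (hR : 4 ≤ R) (hRX : R ≤ X) (hRY : R ≤ Y)
    (θ : ℝ × ℝ) (n : ℕ) (z : ℝ × ℝ) (hz : ∀ l < n, condH ρ X Y R l z) (p1 p2 : ℝ × ℝ)
    (hp1 : p1 ∈ rct ρ X Y n z) (hp2 : p2 ∈ rct ρ X Y n z) (q1 q2 : ℕ) (A1 A2 B1 B2 : ℤ)
    (v1 : viol ρ X Y R θ n p1 q1 A1 B1) (v2 : viol ρ X Y R θ n p2 q2 A2 B2) : ¬ q1 < q2 := by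
  intro h12
  obtain ⟨a1, a2, a3, a4⟩ := v1
  obtain ⟨b1, b2, b3, b4⟩ := v2
  have hR0 : 0 < R := by linarith
  have hone : (1 : ℝ) ≤ ((q2 - q1 : ℕ) : ℝ) := by
    have : 1 ≤ q2 - q1 := by omega
    exact_mod_cast this
  obtain ⟨l, hl1, hl2⟩ := exists_nat_pow_near hone (by linarith : 1 < R)
  have hln : l + 4 ≤ n := by
    have h1 : ((q2 - q1 : ℕ) : ℝ) ≤ q2 := by exact_mod_cast Nat.sub_le _ _
    have h2 : R ^ (l + 3) < R ^ n := by
      calc R ^ (l + 3) = R ^ l * R ^ 3 := by ring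
        _ ≤ q2 * R ^ 3 := by gcongr; linarith
        _ < R ^ n := b2
    have := (pow_lt_pow_iff_right₀ (by linarith : 1 < R)).1 h2
    omega
  have n1 := rct_near hp1
  have n2 := rct_near hp2
  refine hz (l + 1) (by omega) (q2 - q1) (by omega) hl2 (A2 - A1) (B2 - B1) ⟨?_, ?_⟩
  · exact inhom_coord hρ hR hRX n l hln z.1 p1.1 p2.1 θ.1 q1 q2 a1 h12 b2 hl1 A1 A2 n1.1 n2.1 a3 b3
  · exact inhom_coord hρ hR hRY n l hln z.2 p1.2 p2.2 θ.2 q1 q2 a1 h12 b2 hl1 B1 B2 n1.2 n2.2 a4 b4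

/-- Admissible corners. -/
def goodC (ρ X Y R : ℝ) (θ : ℝ × ℝ) (n : ℕ) (z : ℝ × ℝ) : Prop :=
  ∀ p ∈ rct ρ X Y n z, ∀ l < n, condH ρ X Y R l p ∧ condI ρ X Y R θ l p

lemma step_count {ρ X Y R : ℝ} (hρ : 0 < ρ) (hρ1 : ρ ≤ 1) (hρ2 : 18 * ρ ^ 2 < 1)
    (hR : 4 ≤ R) (hRX : R ≤ X) (hRY : R ≤ Y) (hXY : X * Y = R ^ 3)
    {M1 M2 : ℕ} (hM1 : (M1 : ℝ) ≤ X) (hM2 : (M2 : ℝ) ≤ Y) (θ : ℝ × ℝ)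
    (n : ℕ) (z : ℝ × ℝ) (hz : goodC ρ X Y R θ n z) :
    ∃ S : Finset (ℕ × ℕ), M1 * M2 - (9 * (M1 + M2) + 25) ≤ S.card ∧
      ∀ ab ∈ S, ab.1 < M1 ∧ ab.2 < M2 ∧ goodC ρ X Y R θ (n + 1) (chd ρ X Y n z ab) := by
  classical
  have hX : 1 < X := by linarith
  have hY : 1 < Y := by linarith
  have hX0 : 0 < X := by linarith
  have hY0 : 0 < Y := by linarith
  set U := Finset.range M1 ×ˢ Finset.range M2 with hU
  have hUmem : ∀ ab, ab ∈ U ↔ ab.1 < M1 ∧ ab.2 < M2 := by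
    intro ab; simp [hU]
  let FH := U.filter (fun ab => ∃ p ∈ rct ρ X Y (n + 1) (chd ρ X Y n z ab), ¬ condH ρ X Y R n p)
  let FI := U.filter (fun ab => ∃ p ∈ rct ρ X Y (n + 1) (chd ρ X Y n z ab), ¬ condI ρ X Y R θ n p)
  have hFH : FH.card ≤ 9 * (M1 + M2) := by
    obtain ⟨α, β, κ, h0, hl⟩ := hom_line hρ hρ2 hX hY (by linarith : 1 < R) hXY hM1 hM2 n z
    apply line_count FH M1 M2 (Finset.filter_subset _ _) α β κ h0
    intro ab hab
    rw [Finset.mem_filter, hUmem] at hab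
    exact hl ab hab.1.1 hab.1.2 hab.2
  have hFI : FI.card ≤ 25 := by
    rcases FI.eq_empty_or_nonempty with he | ⟨ab0, hab0⟩
    · rw [he]; simp
    have hviol : ∀ ab ∈ FI, ∃ p ∈ rct ρ X Y (n + 1) (chd ρ X Y n z ab), ∃ q A B,
        p ∈ rct ρ X Y n z ∧ viol ρ X Y R θ n p q A B := by
      intro ab hab
      rw [Finset.mem_filter, hUmem] at hab
      obtain ⟨⟨c1, c2⟩, p, hp, hnot⟩ := hab
      unfold condI at hnot
      push Not at hnot
      obtain ⟨q, q1, q2, A, B, _, k1, k2⟩ := hnot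
      exact ⟨p, hp, q, A, B, rct_chd_subset hρ hX hY hM1 hM2 n z ab c1 c2 hp, q1, q2, k1, k2⟩
    have hzz : ∀ l < n, condH ρ X Y R l z := by
      intro l hl
      refine (hz z ⟨le_rfl, ?_, le_rfl, ?_⟩ l hl).1 <;> · simp only [le_add_iff_nonneg_right]; positivity
    obtain ⟨p0, -, q0, A0, B0, hp0, v0⟩ := hviol ab0 hab0
    have hw0 : 0 < ρ / X ^ (n + 1) := by positivity
    have hh0 : 0 < ρ / Y ^ (n + 1) := by positivity
    apply near_count2 FI (((A0 + θ.1) / q0 - z.1) / (ρ / X ^ (n + 1)))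
      (((B0 + θ.2) / q0 - z.2) / (ρ / Y ^ (n + 1))) 2
    intro ab hab
    obtain ⟨p, hpc, q, A, B, hp, v⟩ := hviol ab hab
    have hq : q = q0 := by
      have h1 := inhom_lt hρ hR hRX hRY θ n z hzz p p0 hp hp0 q q0 A A0 B B0 v v0
      have h2 := inhom_lt hρ hR hRX hRY θ n z hzz p0 p hp0 hp q0 q A0 A B0 B v0 v
      omega
    subst hq
    obtain ⟨a1, a2, a3, a4⟩ := v
    obtain ⟨b1, b2, b3, b4⟩ := v0
    have n1 := rct_near hp
    have n2 := rct_near hp0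
    have hA := inhom_same hρ hρ1 hR hRX n z.1 p.1 p0.1 θ.1 q a1 a2 A A0 n1.1 n2.1 a3 b3
    have hB := inhom_same hρ hρ1 hR hRY n z.2 p.2 p0.2 θ.2 q a1 a2 B B0 n1.2 n2.2 a4 b4
    subst hA hB
    obtain ⟨c1, c2, c3, c4⟩ := hpc
    simp only [chd] at c1 c2 c3 c4
    have fin : ∀ (w x y g : ℝ) (a : ℕ), 0 < w → x + a * w ≤ y → y ≤ x + a * w + w → |y - g| ≤ w →
        |(a : ℝ) - (g - x) / w| ≤ (2 : ℕ) := by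
      intro w x y g a hw h1 h2 h3
      have e : (a : ℝ) - (g - x) / w = (x + a * w - g) / w := by field_simp; ring
      rw [e, abs_div, abs_of_pos hw, div_le_iff₀ hw]
      push_cast
      rw [abs_le] at *
      constructor <;> linarith [h3.1, h3.2]
    exact ⟨fin _ _ _ _ _ hw0 c1 c2 a3, fin _ _ _ _ _ hh0 c3 c4 a4⟩
  refine ⟨U \ (FH ∪ FI), ?_, ?_⟩
  · have h1 := Finset.le_card_sdiff (FH ∪ FI) U
    have h2 := Finset.card_union_le FH FI
    have h3 : U.card = M1 * M2 := by simp [hU]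
    omega
  · intro ab hab
    rw [Finset.mem_sdiff, Finset.mem_union, not_or] at hab
    obtain ⟨hab, hnH, hnI⟩ := hab
    have hab' := (hUmem ab).1 hab
    refine ⟨hab'.1, hab'.2, ?_⟩
    intro p hp l hl
    rcases Nat.lt_succ_iff_lt_or_eq.1 hl with hl | rfl
    · exact hz p (rct_chd_subset hρ hX hY hM1 hM2 n z ab hab'.1 hab'.2 hp) l hl
    · constructor
      · by_contra hc
        exact hnH (Finset.mem_filter.2 ⟨hab, p, hp, hc⟩)
      · by_contra hc
        exact hnI (Finset.mem_filter.2 ⟨hab, p, hp, hc⟩)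

end ArithPart

section FinalPart
open scoped ENNReal NNReal

lemma final_coord {R i : ℝ} (hR : 5 ≤ R) (hi0 : 0 < i) (hi1 : i < 1) (n q : ℕ) (hq : 0 < q)
    (hnq : R ^ n ≤ (q : ℝ)) (x γ c : ℝ) (hc : c ≤ ((R ^ 11)⁻¹) ^ (1 / i))
    (h : (1 / 5) / (R * R ^ i) ^ (n + 4 + 1) < |x - ((round (q * x - γ) : ℤ) + γ) / q|) :
    c / q < distNearestInt (q * x - γ) ^ (1 / i) := by
  have hR0 : 0 < R := by linarith
  have hq0 : (0 : ℝ) < q := by exact_mod_cast hq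
  have e : x - ((round (q * x - γ) : ℤ) + γ) / q = (q * x - γ - (round (q * x - γ) : ℤ)) / q := by
    field_simp; ring
  rw [e, abs_div, abs_of_pos hq0, lt_div_iff₀ hq0] at h
  change _ < distNearestInt (q * x - γ) at h
  have hqi : 0 < (q : ℝ) ^ i := by positivity
  have h1 : (R * R ^ i) ^ (n + 4 + 1) ≤ R ^ (n + 5) * (q ^ i * R ^ 5) := by
    rw [mul_pow]
    have e1 : (R ^ i) ^ (n + 4 + 1) = (R ^ n) ^ i * (R ^ i) ^ 5 := by
      rw [← Real.rpow_natCast R n, ← Real.rpow_mul hR0.le, mul_comm (n : ℝ) i, Real.rpow_mul hR0.le,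
        Real.rpow_natCast, ← pow_add]
    have e2 : R ^ i ≤ R := by
      calc R ^ i ≤ R ^ (1 : ℝ) := Real.rpow_le_rpow_of_exponent_le (by linarith) hi1.le
        _ = R := Real.rpow_one R
    rw [e1]
    gcongr
  have h2 : (R ^ 11)⁻¹ / (q : ℝ) ^ i ≤ (1 / 5) / (R * R ^ i) ^ (n + 4 + 1) * q := by
    calc (R ^ 11)⁻¹ / (q : ℝ) ^ i = (1 / R) / (R ^ (n + 5) * (q ^ i * R ^ 5)) * R ^ n := by
          field_simp; ring
      _ ≤ (1 / 5) / (R * R ^ i) ^ (n + 4 + 1) * q := by gcongr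
  have h3 := h2.trans_lt h
  have h4 : ((R ^ 11)⁻¹ / (q : ℝ) ^ i) ^ (1 / i) = ((R ^ 11)⁻¹) ^ (1 / i) / q := by
    rw [Real.div_rpow (by positivity) hqi.le, ← Real.rpow_mul hq0.le, mul_one_div_cancel hi0.ne',
      Real.rpow_one]
  calc c / q ≤ ((R ^ 11)⁻¹) ^ (1 / i) / q := by gcongr
    _ = ((R ^ 11)⁻¹ / (q : ℝ) ^ i) ^ (1 / i) := h4.symm
    _ < _ := Real.rpow_lt_rpow (by positivity) h3 (by positivity)

lemma mem_bad {R i j : ℝ} (hR : 5 ≤ R) (hi0 : 0 < i) (hi1 : i < 1) (hj0 : 0 < j) (hj1 : j < 1)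
    (θ p : ℝ × ℝ) (h : ∀ l, condI (1 / 5) (R * R ^ i) (R * R ^ j) R θ l p) : p ∈ badPair i j θ := by
  have hR0 : 0 < R := by linarith
  refine ⟨min (((R ^ 11)⁻¹) ^ (1 / i)) (((R ^ 11)⁻¹) ^ (1 / j)), by positivity, ?_⟩
  intro q hq
  have hq1 : (1 : ℝ) ≤ q := by exact_mod_cast hq
  obtain ⟨n, hn1, hn2⟩ := exists_nat_pow_near hq1 (by linarith : 1 < R)
  have hI := h (n + 4) q hq ?_ (round (q * p.1 - θ.1)) (round (q * p.2 - θ.2)) ?_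
  · rw [not_and_or, not_le, not_le] at hI
    rw [lt_max_iff]
    rcases hI with hI | hI
    · left
      exact final_coord hR hi0 hi1 n q hq hn1 _ _ _ (min_le_left _ _) hI
    · right
      exact final_coord hR hj0 hj1 n q hq hn1 _ _ _ (min_le_right _ _) hI
  · calc (q : ℝ) * R ^ 3 < R ^ (n + 1) * R ^ 3 := by gcongr
      _ = R ^ (n + 4) := by ring
  · calc R ^ (n + 4) = R ^ n * R ^ 4 := by ring
      _ ≤ q * R ^ 4 := by gcongr

lemma lower_bound (i j : ℝ) (θ : ℝ × ℝ)
    (hi0 : 0 < i) (hi1 : i < 1) (hj0 : 0 < j) (hj1 : j < 1) (hij : i + j = 1) (d : ℝ≥0)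
    (hd : (d : ℝ) < 2) : (d : ℝ≥0∞) ≤ dimH (badPair i j θ) := by
  have hη : 0 < 2 - (d : ℝ) := by linarith
  obtain ⟨R, hR2, hR⟩ := (((tendsto_rpow_atTop hη).eventually_ge_atTop 2).and
    (eventually_ge_atTop (100 : ℝ))).exists
  have hR0 : 0 < R := by linarith
  have hge : ∀ t : ℝ, 0 < t → R ≤ R * R ^ t := by
    intro t ht
    have : 1 ≤ R ^ t := Real.one_le_rpow (by linarith) ht.le
    nlinarith
  have hRX := hge i hi0
  have hRY := hge j hj0
  have hXY : (R * R ^ i) * (R * R ^ j) = R ^ 3 := by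
    have : R ^ i * R ^ j = R := by rw [← Real.rpow_add hR0, hij, Real.rpow_one]
    calc (R * R ^ i) * (R * R ^ j) = R * R * (R ^ i * R ^ j) := by ring
      _ = R ^ 3 := by rw [this]; ring
  have hbad : ∀ p, (∀ l, condI (1 / 5) (R * R ^ i) (R * R ^ j) R θ l p) → p ∈ badPair i j θ :=
    fun p hp => mem_bad (by linarith) hi0 hi1 hj0 hj1 θ p hp
  generalize R * R ^ i = X at *
  generalize R * R ^ j = Y at *
  have hM1 : ((⌊X⌋₊ : ℕ) : ℝ) ≤ X := Nat.floor_le (by linarith)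
  have hM2 : ((⌊Y⌋₊ : ℕ) : ℝ) ≤ Y := Nat.floor_le (by linarith)
  have hM1' := Nat.lt_floor_add_one X
  have hM2' := Nat.lt_floor_add_one Y
  set M1 := ⌊X⌋₊
  set M2 := ⌊Y⌋₊
  have hN : X * Y ≤ 2 * ((M1 * M2 - (9 * (M1 + M2) + 25) : ℕ) : ℝ) := by
    have h1 : M1 * M2 ≤ (M1 * M2 - (9 * (M1 + M2) + 25)) + (9 * (M1 + M2) + 25) := by omega
    have h2 : (M1 * M2 : ℝ) ≤ ((M1 * M2 - (9 * (M1 + M2) + 25) : ℕ) : ℝ) + (9 * (M1 + M2) + 25) := by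
      exact_mod_cast h1
    have h3 : (X - 1) * (Y - 1) ≤ M1 * M2 := by
      apply mul_le_mul <;> linarith
    nlinarith
  refine cantor_dim_s5 (ρ := 1 / 5) (by norm_num) (by linarith : 1 < R) hRX hRY hM1 hM2 hN d
    (η := 2 - d) (by ring) hη.le hR2 (goodC (1 / 5) X Y R θ) 0 ?_ ?_ _ ?_
  · intro p _ l hl; omega
  · intro n z hz
    exact step_count (by norm_num) (by norm_num) (by norm_num) (by linarith) hRX hRY hXY hM1 hM2 θ n z hz
  · intro p hp
    apply hbad
    intro l
    obtain ⟨z, hz, hpz⟩ := hp (l + 1)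
    exact (hz p hpz l (by omega)).2

end FinalPart

theorem stmt5 (i j : ℝ) (θ : ℝ × ℝ)
    (hi0 : 0 < i) (hi1 : i < 1) (hj0 : 0 < j) (hj1 : j < 1) (hij : i + j = 1) :
    dimH (badPair i j θ) = 2 := by
  apply le_antisymm
  · calc dimH (badPair i j θ) ≤ dimH (Set.univ : Set (ℝ × ℝ)) := dimH_mono (Set.subset_univ _)
      _ = 2 := by
        rw [Real.dimH_univ_eq_finrank]
        simp [Module.finrank_prod]
  · apply ENNReal.le_of_forall_nnreal_lt
    intro d hd
    apply lower_bound i j θ hi0 hi1 hj0 hj1 hij d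
    have : d < 2 := by exact_mod_cast hd
    exact_mod_cast this
end
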